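/- Assume the negative uniform gradient estimate holds for some σ_∞ < 0. Then there exists at most one tight evolution system of measures: if (μ_t)_{t∈I} and (ν_t)_{t∈I} are both tight evolution systems of measures, then μ_t = ν_t for every t ∈ I. -/

import Mathlib

open Set Filter MeasureTheory

noncomputable section

abbrev Euc (d : ℕ) := EuclideanSpace ℝ (Fin d)

noncomputable def hess (d : ℕ) (g : Euc d → ℝ) (x : Euc d) (i j : Fin d) : ℝ :=
  fderiv ℝ (fun y => fderiv ℝ g y (EuclideanSpace.single j 1)) x (EuclideanSpace.single i 1)

noncomputable def minEig (d : ℕ) (A : Fin d → Fin d → ℝ) : ℝ :=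
  sInf {r : ℝ | ∃ ξ : Euc d, ‖ξ‖ = 1 ∧ (∑ i, ∑ j, A i j * ξ i * ξ j) = r}

noncomputable def pdist (d : ℕ) (p q : ℝ × Euc d) : ℝ :=
  Real.sqrt |p.1 - q.1| + ‖p.2 - q.2‖

def LocHolderParab (d : ℕ) (α : ℝ) (I : Set ℝ) (g : ℝ → Euc d → ℝ) : Prop :=
  ∀ K : Set (ℝ × Euc d), IsCompact K → K ⊆ I ×ˢ (univ : Set (Euc d)) →
    ∃ C > 0, ∀ p ∈ K, ∀ q ∈ K, |g p.1 p.2 - g q.1 q.2| ≤ C * pdist d p q ^ α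

noncomputable def Aop (d : ℕ) (Q : ℝ → Euc d → Fin d → Fin d → ℝ)
    (b : ℝ → Euc d → Fin d → ℝ) (c : ℝ → Euc d → ℝ)
    (t : ℝ) (g : Euc d → ℝ) (x : Euc d) : ℝ :=
  (∑ i, ∑ j, Q t x i j * hess d g x i j)
    + (∑ i, b t x i * fderiv ℝ g x (EuclideanSpace.single i 1))
    + c t x * g x

structure IsClassicalSolution (d : ℕ) (Q : ℝ → Euc d → Fin d → Fin d → ℝ)
    (b : ℝ → Euc d → Fin d → ℝ) (c : ℝ → Euc d → ℝ)
    (s : ℝ) (f : Euc d → ℝ) (u : ℝ → Euc d → ℝ) : Prop where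
  cont : ContinuousOn (fun p : ℝ × Euc d => u p.1 p.2) (Ici s ×ˢ univ)
  tdiff : ∀ t, s < t → ∀ x, DifferentiableAt ℝ (fun τ => u τ x) t
  tderiv_cont : ContinuousOn (fun p : ℝ × Euc d => deriv (fun τ => u τ p.2) p.1) (Ioi s ×ˢ univ)
  xdiff : ∀ t, s < t → ContDiff ℝ 2 (u t)
  grad_cont : ContinuousOn (fun p : ℝ × Euc d => fderiv ℝ (u p.1) p.2) (Ioi s ×ˢ univ)
  hess_cont : ContinuousOn (fun p : ℝ × Euc d => hess d (u p.1) p.2) (Ioi s ×ˢ univ)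
  pde : ∀ t, s < t → ∀ x, deriv (fun τ => u τ x) t = Aop d Q b c t (u t) x
  init : ∀ x, u s x = f x

def BoundedOnStrips (d : ℕ) (s : ℝ) (u : ℝ → Euc d → ℝ) : Prop :=
  ∀ T, s < T → ∃ M, ∀ t ∈ Icc s T, ∀ x, |u t x| ≤ M

def LocBddOn (I : Set ℝ) (g : ℝ → ℝ) : Prop :=
  ∀ a b : ℝ, Icc a b ⊆ I → ∃ M, ∀ t ∈ Icc a b, |g t| ≤ M

/-- The negative uniform gradient estimate with rate `σinf < 0`. -/
def NegUniformGradEst (d : ℕ) (I : Set ℝ) (Q : ℝ → Euc d → Fin d → Fin d → ℝ)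
    (b : ℝ → Euc d → Fin d → ℝ) (σinf : ℝ) : Prop :=
  ∀ s ∈ I, ∀ f : Euc d → ℝ, ContDiff ℝ 1 f →
    ∀ F G : ℝ, (∀ x, |f x| ≤ F) → (∀ x, ‖fderiv ℝ f x‖ ≤ G) →
    ∀ u : ℝ → Euc d → ℝ,
      IsClassicalSolution d Q b (fun _ _ => 0) s f u → BoundedOnStrips d s u →
      ∀ t, s < t → ∀ x : Euc d,
        ‖fderiv ℝ (u t) x‖ ≤ Real.exp (σinf * (t - s)) * (F + G)

/-- A tight evolution system of measures for the evolution operator associated to `A`. -/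
structure IsTightEvolutionSystem (d : ℕ) (I : Set ℝ)
    (Q : ℝ → Euc d → Fin d → Fin d → ℝ) (b : ℝ → Euc d → Fin d → ℝ)
    (μ : ℝ → Measure (Euc d)) : Prop where
  prob : ∀ t ∈ I, IsProbabilityMeasure (μ t)
  tight : ∀ ε : ℝ, 0 < ε → ∃ R > (0:ℝ), ∀ t ∈ I,
    1 - ε < ((μ t) (Metric.ball (0 : Euc d) R)).toReal
  invariant : ∀ s ∈ I, ∀ t ∈ I, s < t →
    ∀ f : Euc d → ℝ, Continuous f → (∃ M, ∀ x, |f x| ≤ M) →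
    ∀ u : ℝ → Euc d → ℝ,
      IsClassicalSolution d Q b (fun _ _ => 0) s f u → BoundedOnStrips d s u →
      ∫ x, u t x ∂(μ t) = ∫ x, f x ∂(μ s)

section devel
set_option maxSynthPendingDepth 3
set_option linter.all false
set_option linter.unusedSectionVars false
set_option linter.deprecated false

section NrmCalc
variable {E F G H : Type*} [NormedAddCommGroup E] [NormedSpace ℝ E]
  [NormedAddCommGroup F] [NormedSpace ℝ F] [NormedAddCommGroup G] [NormedSpace ℝ G]
  [NormedAddCommGroup H] [NormedSpace ℝ H]

/-- bounded, jointly continuous, spatially `β`-Hölder, with constant `M` -/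
structure Nrm (β : ℝ) (g : ℝ → E → F) (M : ℝ) : Prop where
  cont : Continuous fun p : ℝ × E => g p.1 p.2
  bd : ∀ t x, ‖g t x‖ ≤ M
  hol : ∀ t x y, ‖g t x - g t y‖ ≤ M * ‖x - y‖ ^ β

namespace Nrm
variable {β M M' : ℝ} {g g' : ℝ → E → F}

lemma nonneg (h : Nrm β g M) : 0 ≤ M := (norm_nonneg _).trans (h.bd 0 0)

lemma mono (h : Nrm β g M) (hM : M ≤ M') : Nrm β g M' :=
  ⟨h.cont, fun t x => (h.bd t x).trans hM, fun t x y => (h.hol t x y).trans (by gcongr)⟩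

lemma congr (h : Nrm β g M) (e : ∀ t x, g' t x = g t x) : Nrm β g' M := by
  obtain rfl : g' = g := by funext t x; exact e t x
  exact h

lemma add (h : Nrm β g M) (h' : Nrm β g' M') : Nrm β (fun t x => g t x + g' t x) (M + M') := by
  refine ⟨h.cont.add h'.cont, fun t x => (norm_add_le _ _).trans (add_le_add (h.bd t x) (h'.bd t x)),
    fun t x y => ?_⟩
  rw [add_sub_add_comm, add_mul]
  exact (norm_add_le _ _).trans (add_le_add (h.hol t x y) (h'.hol t x y))

lemma neg (h : Nrm β g M) : Nrm β (fun t x => - g t x) M := by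
  refine ⟨h.cont.neg, fun t x => by rw [norm_neg]; exact h.bd t x, fun t x y => ?_⟩
  rw [neg_sub_neg, norm_sub_rev]; exact h.hol t x y

lemma sub (h : Nrm β g M) (h' : Nrm β g' M') : Nrm β (fun t x => g t x - g' t x) (M + M') := by
  simpa only [sub_eq_add_neg] using h.add h'.neg

lemma zero : Nrm β (fun (_ : ℝ) (_ : E) => (0 : F)) 0 :=
  ⟨continuous_const, by simp, by simp⟩

lemma const (c : F) : Nrm β (fun (_ : ℝ) (_ : E) => c) ‖c‖ :=
  ⟨continuous_const, by simp, fun _ _ _ => by simp; positivity⟩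

lemma sum {ι : Type*} (s : Finset ι) {g : ι → ℝ → E → F} {M : ι → ℝ}
    (h : ∀ i ∈ s, Nrm β (g i) (M i)) :
    Nrm β (fun t x => ∑ i ∈ s, g i t x) (∑ i ∈ s, M i) := by
  classical
  induction s using Finset.induction_on with
  | empty => simpa using zero
  | insert a s ha ih =>
    simp only [Finset.sum_insert ha]
    exact (h a (by simp)).add (ih fun i hi => h i (by simp [hi]))

/-- bilinear products -/
lemma bilin (B : F →L[ℝ] G →L[ℝ] H) {K : ℝ} (hK : 0 ≤ K) (hB : ∀ u v, ‖B u v‖ ≤ K * ‖u‖ * ‖v‖)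
    {k : ℝ → E → G} (h : Nrm β g M) (h' : Nrm β k M') :
    Nrm β (fun t x => B (g t x) (k t x)) (2 * K * M * M') := by
  have hM := h.nonneg
  have hM' := h'.nonneg
  refine ⟨?_, fun t x => ?_, fun t x y => ?_⟩
  · exact (B.continuous.comp h.cont).clm_apply h'.cont
  · calc ‖B (g t x) (k t x)‖ ≤ K * ‖g t x‖ * ‖k t x‖ := hB _ _
      _ ≤ K * M * M' := by gcongr; exacts [h.bd t x, h'.bd t x]
      _ ≤ 2 * K * M * M' := by
        have : 0 ≤ K * M * M' := by positivity
        linarith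
  · have e : B (g t x) (k t x) - B (g t y) (k t y)
        = B (g t x - g t y) (k t x) + B (g t y) (k t x - k t y) := by
      simp only [map_sub, ContinuousLinearMap.sub_apply]; abel
    rw [e]
    calc _ ≤ ‖B (g t x - g t y) (k t x)‖ + ‖B (g t y) (k t x - k t y)‖ := norm_add_le _ _
      _ ≤ K * ‖g t x - g t y‖ * ‖k t x‖ + K * ‖g t y‖ * ‖k t x - k t y‖ := add_le_add (hB _ _) (hB _ _)
      _ ≤ K * (M * ‖x - y‖ ^ β) * M' + K * M * (M' * ‖x - y‖ ^ β) := by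
        gcongr
        exacts [h.hol t x y, h'.bd t x, h.bd t y, h'.hol t x y]
      _ = _ := by ring

lemma app {q : ℝ → E → F →L[ℝ] G} (h : Nrm β q M) (h' : Nrm β g M') :
    Nrm β (fun t x => q t x (g t x)) (2 * M * M') := by
  have := bilin (ContinuousLinearMap.id ℝ (F →L[ℝ] G)) zero_le_one
    (fun u v => by simpa using u.le_opNorm v) h h'
  simpa using this

lemma smul {η : ℝ → E → ℝ} (h : Nrm β η M) (h' : Nrm β g M') :
    Nrm β (fun t x => η t x • g t x) (2 * M * M') := by
  have := bilin (ContinuousLinearMap.lsmul ℝ ℝ : ℝ →L[ℝ] F →L[ℝ] F) zero_le_one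
    (fun u v => by simp [norm_smul]) h h'
  simpa using this

lemma smulRight {η : ℝ → E → (E →L[ℝ] ℝ)} (h : Nrm β η M) (h' : Nrm β g M') :
    Nrm β (fun t x => (η t x).smulRight (g t x)) (2 * M * M') := by
  have := bilin (ContinuousLinearMap.smulRightL ℝ E F) zero_le_one
    (fun u v => by simp) h h'
  simpa using this

lemma const_smul (c : ℝ) (h : Nrm β g M) : Nrm β (fun t x => c • g t x) (|c| * M) := by
  refine ⟨h.cont.const_smul c, fun t x => ?_, fun t x y => ?_⟩
  · rw [norm_smul, Real.norm_eq_abs]; gcongr; exact h.bd t x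
  · rw [← smul_sub, norm_smul, Real.norm_eq_abs, mul_assoc]; gcongr; exact h.hol t x y

lemma clm (L : F →L[ℝ] G) (h : Nrm β g M) : Nrm β (fun t x => L (g t x)) (‖L‖ * M) := by
  refine ⟨L.continuous.comp h.cont, fun t x => ?_, fun t x y => ?_⟩
  · exact (L.le_opNorm _).trans (by gcongr; exact h.bd t x)
  · rw [← map_sub, mul_assoc]; exact (L.le_opNorm _).trans (by gcongr; exact h.hol t x y)

/-- time dependent scalar factor -/
lemma tmul {θ : ℝ → ℝ} {K : ℝ} (hθ : Continuous θ) (hb : ∀ t, |θ t| ≤ K) (h : Nrm β g M) :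
    Nrm β (fun t x => θ t • g t x) (K * M) := by
  have hK : 0 ≤ K := (abs_nonneg _).trans (hb 0)
  refine ⟨(hθ.comp continuous_fst).smul h.cont, fun t x => ?_, fun t x y => ?_⟩
  · rw [norm_smul, Real.norm_eq_abs]; gcongr; exacts [hb t, h.bd t x]
  · rw [← smul_sub, norm_smul, Real.norm_eq_abs, mul_assoc]; gcongr; exacts [hb t, h.hol t x y]

lemma comp_time {θ : ℝ → ℝ} (hθ : Continuous θ) (h : Nrm β g M) :
    Nrm β (fun t x => g (θ t) x) M :=
  ⟨h.cont.comp ((hθ.comp continuous_fst).prodMk continuous_snd), fun _ _ => h.bd _ _,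
    fun _ _ _ => h.hol _ _ _⟩

lemma of_lip (h0 : 0 < β) (h1 : β ≤ 1) (hc : Continuous fun p : ℝ × E => g p.1 p.2)
    (hb : ∀ t x, ‖g t x‖ ≤ M) (hl : ∀ t x y, ‖g t x - g t y‖ ≤ M * ‖x - y‖) :
    Nrm β g (2 * M) := by
  have hM : 0 ≤ M := (norm_nonneg _).trans (hb 0 0)
  refine ⟨hc, fun t x => (hb t x).trans (by linarith), fun t x y => ?_⟩
  rcases le_total ‖x - y‖ 1 with h | h
  · have : ‖x - y‖ ≤ ‖x - y‖ ^ β := by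
      simpa using Real.rpow_le_rpow_of_exponent_ge' (norm_nonneg (x - y)) h h0.le h1
    calc _ ≤ M * ‖x - y‖ := hl t x y
      _ ≤ M * ‖x - y‖ ^ β := by gcongr
      _ ≤ _ := by
        have : 0 ≤ M * ‖x - y‖ ^ β := by positivity
        linarith
  · have : 1 ≤ ‖x - y‖ ^ β := Real.one_le_rpow h h0.le
    calc _ ≤ ‖g t x‖ + ‖g t y‖ := norm_sub_le _ _
      _ ≤ 2 * M * 1 := by linarith [hb t x, hb t y]
      _ ≤ _ := by gcongr

end Nrm

/-- `C^{2+β}` bounds in space, zero initial datum -/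
structure XB (β : ℝ) (w : ℝ → E → ℝ) (w1 : ℝ → E → E →L[ℝ] ℝ) (w2 : ℝ → E → E →L[ℝ] E →L[ℝ] ℝ)
    (a M : ℝ) : Prop where
  cont : Continuous fun p : ℝ × E => w p.1 p.2
  sup : ∀ t x, |w t x| ≤ a
  n1 : Nrm β w1 M
  n2 : Nrm β w2 M
  d1 : ∀ t x, HasFDerivAt (w t) (w1 t x) x
  d2 : ∀ t x, HasFDerivAt (w1 t) (w2 t x) x
  init : ∀ x, w 0 x = 0

/-- the equation `∂ₜ w = q w₂ + b w₁ - λ w + g` for `t > 0` -/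
def Solves (q : ℝ → E → (E →L[ℝ] E →L[ℝ] ℝ) →L[ℝ] ℝ) (b : ℝ → E → (E →L[ℝ] ℝ) →L[ℝ] ℝ)
    (lam : ℝ) (g w : ℝ → E → ℝ) (w1 : ℝ → E → E →L[ℝ] ℝ) (w2 : ℝ → E → E →L[ℝ] E →L[ℝ] ℝ) : Prop :=
  ∀ t, 0 < t → ∀ x, HasDerivAt (fun τ => w τ x)
    (q t x (w2 t x) + b t x (w1 t x) - lam * w t x + g t x) t

variable {β a M ε : ℝ} {w : ℝ → E → ℝ} {w1 : ℝ → E → E →L[ℝ] ℝ} {w2 : ℝ → E → E →L[ℝ] E →L[ℝ] ℝ}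

lemma grad_interp {f : E → ℝ} {f1 : E → E →L[ℝ] ℝ} {f2 : E → E →L[ℝ] E →L[ℝ] ℝ}
    (hd : ∀ x, HasFDerivAt f (f1 x) x) (hd2 : ∀ x, HasFDerivAt f1 (f2 x) x)
    (ha : ∀ x, |f x| ≤ a) (hM : ∀ x, ‖f2 x‖ ≤ M) {ρ : ℝ} (hρ : 0 < ρ) (x : E) :
    ‖f1 x‖ ≤ ρ * M + 2 * a / ρ := by
  have ha0 : 0 ≤ a := (abs_nonneg _).trans (ha 0)
  have hM0 : 0 ≤ M := (norm_nonneg (f2 0)).trans (hM 0)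
  refine ContinuousLinearMap.opNorm_le_bound _ (by positivity) fun v => ?_
  rcases eq_or_ne v 0 with rfl | hv
  · simp
  have hv' : 0 < ‖v‖ := norm_pos_iff.2 hv
  set c := ρ / ‖v‖ with hc
  have hc0 : 0 < c := by positivity
  have hl : ∀ y z, ‖f1 y - f1 z‖ ≤ M * ‖y - z‖ := fun y z =>
    Convex.norm_image_sub_le_of_norm_hasFDerivWithin_le (fun u _ => (hd2 u).hasFDerivWithinAt)
      (fun u _ => hM u) convex_univ (mem_univ z) (mem_univ y)
  have hcv : ‖c • v‖ = ρ := by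
    rw [norm_smul, Real.norm_eq_abs, abs_of_pos hc0, hc]; field_simp
  have key := Convex.norm_image_sub_le_of_norm_hasFDerivWithin_le' (φ := f1 x) (C := M * ρ)
    (s := Metric.closedBall x ρ) (f := f)
    (fun u _ => (hd u).hasFDerivWithinAt)
    (fun u hu => (hl u x).trans (by gcongr; exact mem_closedBall_iff_norm.1 hu))
    (convex_closedBall x ρ) (Metric.mem_closedBall_self hρ.le)
    (y := x + c • v) (by simp [hcv])
  rw [add_sub_cancel_left, hcv, map_smul, smul_eq_mul, Real.norm_eq_abs] at key
  have h1 := abs_le.1 (ha x)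
  have h2 := abs_le.1 (ha (x + c • v))
  have h3 := abs_le.1 key
  have h4 : |c * f1 x v| ≤ M * ρ * ρ + 2 * a := by
    rw [abs_le]; constructor <;> linarith
  rw [abs_mul, abs_of_pos hc0, hc] at h4
  rw [Real.norm_eq_abs]
  have : ρ / ‖v‖ * |f1 x v| * (‖v‖ / ρ) ≤ (M * ρ * ρ + 2 * a) * (‖v‖ / ρ) := by gcongr
  calc |f1 x v| = ρ / ‖v‖ * |f1 x v| * (‖v‖ / ρ) := by field_simp
    _ ≤ _ := this
    _ = _ := by field_simp

lemma XB.interp (h : XB β w w1 w2 a M) (h0 : 0 < β) (h1 : β ≤ 1 / 2) (hε : 0 < ε) (hε1 : ε ≤ 1) :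
    Nrm β w (3 * ε * M + 4 * a / ε ^ 3) ∧ Nrm β w1 (3 * ε * M + 4 * a / ε ^ 3) := by
  have ha : 0 ≤ a := (abs_nonneg _).trans (h.sup 0 0)
  have hM : 0 ≤ M := h.n1.nonneg
  have hg : ∀ t x, ‖w1 t x‖ ≤ ε ^ 2 * M + 2 * a / ε ^ 2 := fun t x =>
    grad_interp (h.d1 t) (h.d2 t) (h.sup t) (h.n2.bd t) (by positivity) x
  have hβ1 : β ≤ 1 := by linarith
  have e21 : ε ^ 2 ≤ ε := by nlinarith
  have e32 : ε ^ 3 ≤ ε ^ 2 := by nlinarith [sq_nonneg ε]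
  have e31 : ε ^ 3 ≤ 1 := by nlinarith
  have i1 : 2 * a / ε ^ 2 ≤ 2 * a / ε ^ 3 := by gcongr
  have i2 : a ≤ a / ε ^ 3 := by rw [le_div_iff₀ (by positivity)]; nlinarith
  have i3 : ε ^ 2 * M ≤ ε * M := by gcongr
  have i4 : 4 * a / ε ^ 3 = 2 * (2 * a / ε ^ 3) := by ring
  have i5 : 2 * a / ε ^ 3 = 2 * (a / ε ^ 3) := by ring
  have i6 : 0 ≤ ε * M := by positivity
  have i7 : 0 ≤ a / ε ^ 3 := by positivity
  have l2 : ∀ t x y, ‖w1 t x - w1 t y‖ ≤ M * ‖x - y‖ := fun t x y =>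
    Convex.norm_image_sub_le_of_norm_hasFDerivWithin_le (fun u _ => (h.d2 t u).hasFDerivWithinAt)
      (fun u _ => h.n2.bd t u) convex_univ (mem_univ y) (mem_univ x)
  have l1 : ∀ t x y, ‖w t x - w t y‖ ≤ (ε ^ 2 * M + 2 * a / ε ^ 2) * ‖x - y‖ := fun t x y =>
    Convex.norm_image_sub_le_of_norm_hasFDerivWithin_le (fun u _ => (h.d1 t u).hasFDerivWithinAt)
      (fun u _ => hg t u) convex_univ (mem_univ y) (mem_univ x)
  constructor
  · refine ⟨h.cont, fun t x => (h.sup t x).trans (by linarith), fun t x y => ?_⟩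
    rcases le_total ‖x - y‖ 1 with hxy | hxy
    · have : ‖x - y‖ ≤ ‖x - y‖ ^ β := by
        simpa using Real.rpow_le_rpow_of_exponent_ge' (norm_nonneg (x - y)) hxy h0.le hβ1
      refine (l1 t x y).trans ?_
      gcongr <;> linarith
    · have : 1 ≤ ‖x - y‖ ^ β := Real.one_le_rpow hxy h0.le
      calc _ ≤ ‖w t x‖ + ‖w t y‖ := norm_sub_le _ _
        _ ≤ (3 * ε * M + 4 * a / ε ^ 3) * 1 := by
          have := h.sup t x; have := h.sup t y; rw [← Real.norm_eq_abs] at *; linarith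
        _ ≤ _ := by gcongr
  · refine ⟨h.n1.cont, fun t x => (hg t x).trans (by linarith), fun t x y => ?_⟩
    rcases le_total ‖x - y‖ (ε ^ 2) with hxy | hxy
    · have k1 : ‖x - y‖ ≤ ε * ‖x - y‖ ^ β := by
        rcases (norm_nonneg (x - y)).eq_or_lt' with hz | hz
        · rw [hz]; positivity
        have k2 : ‖x - y‖ ^ (1 - β) ≤ ε := by
          calc ‖x - y‖ ^ (1 - β) ≤ (ε ^ 2) ^ (1 - β) := by
                gcongr
            _ ≤ (ε ^ 2) ^ (1 / 2 : ℝ) := by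
                apply Real.rpow_le_rpow_of_exponent_ge (by positivity) (by nlinarith) (by linarith)
            _ = ε := by rw [← Real.sqrt_eq_rpow, Real.sqrt_sq hε.le]
        calc ‖x - y‖ = ‖x - y‖ ^ (1 - β) * ‖x - y‖ ^ β := by
              rw [← Real.rpow_add hz]; simp
          _ ≤ _ := by gcongr
      calc _ ≤ M * ‖x - y‖ := l2 t x y
        _ ≤ M * (ε * ‖x - y‖ ^ β) := by gcongr
        _ = ε * M * ‖x - y‖ ^ β := by ring
        _ ≤ _ := by gcongr; linarith
    · have k1 : ε ≤ ‖x - y‖ ^ β := by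
        calc ε = (ε ^ 2) ^ (1 / 2 : ℝ) := by rw [← Real.sqrt_eq_rpow, Real.sqrt_sq hε.le]
          _ ≤ (ε ^ 2) ^ β :=
            Real.rpow_le_rpow_of_exponent_ge (by positivity) (by nlinarith) (by linarith)
          _ ≤ _ := by gcongr
      calc _ ≤ ‖w1 t x‖ + ‖w1 t y‖ := norm_sub_le _ _
        _ ≤ 2 * (ε ^ 2 * M + 2 * a / ε ^ 2) := by linarith [hg t x, hg t y]
        _ = (2 * ε * M + 4 * a / ε ^ 3) * ε := by field_simp; ring
        _ ≤ _ := by gcongr; linarith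
end NrmCalc

section Neumann
variable {E F : Type*} [NormedAddCommGroup E] [NormedSpace ℝ E]
  [NormedAddCommGroup F] [NormedSpace ℝ F] [CompleteSpace F]

lemma hasSum_geo (K : ℝ) : HasSum (fun n : ℕ => K * (1 / 2 : ℝ) ^ n) (2 * K) := by
  have := (hasSum_geometric_two).mul_left K
  rwa [mul_comm K 2] at this

lemma Nrm.tsum {β K : ℝ} {h : ℕ → ℝ → E → F} (hh : ∀ n, Nrm β (h n) (K * (1 / 2 : ℝ) ^ n)) :
    Nrm β (fun t x => ∑' n, h n t x) (2 * K) := by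
  have hs : ∀ t x, Summable fun n => h n t x := fun t x =>
    Summable.of_norm_bounded (hasSum_geo K).summable fun n => (hh n).bd t x
  refine ⟨?_, fun t x => ?_, fun t x y => ?_⟩
  · exact continuous_tsum (fun n => (hh n).cont) (hasSum_geo K).summable fun n p => (hh n).bd p.1 p.2
  · exact tsum_of_norm_bounded (hasSum_geo K) fun n => (hh n).bd t x
  · rw [← (hs t x).tsum_sub (hs t y)]
    refine tsum_of_norm_bounded ((hasSum_geo K).mul_right _) fun n => (hh n).hol t x y

lemma neumann {q : ℝ → E → (E →L[ℝ] E →L[ℝ] ℝ) →L[ℝ] ℝ} {b : ℝ → E → (E →L[ℝ] ℝ) →L[ℝ] ℝ}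
    {β lam Mq Mb a C : ℝ} (hq : Nrm β q Mq) (hb : Nrm β b Mb)
    (H : ∀ (g : ℝ → E → ℝ) (M : ℝ), Nrm β g M → ∃ w w1 w2 e, XB β w w1 w2 (a * M) (C * M) ∧
      Nrm β e (M / 2) ∧ Solves q b lam (fun t x => g t x - e t x) w w1 w2) :
    ∀ (g : ℝ → E → ℝ) (M : ℝ), Nrm β g M → ∃ w w1 w2, XB β w w1 w2 (2 * (a * M)) (2 * (C * M)) ∧
      Solves q b lam g w w1 w2 := by
  intro g M hg
  choose! W W1 W2 e hX he hS using H
  let G : ℕ → (ℝ → E → ℝ) := fun n => Nat.rec g (fun n gn => e gn (M * (1 / 2 : ℝ) ^ n)) n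
  have hG : ∀ n, Nrm β (G n) (M * (1 / 2 : ℝ) ^ n) := by
    intro n
    induction n with
    | zero => simpa [G] using hg
    | succ n ih =>
      have := he _ _ ih
      refine Nrm.mono this (le_of_eq ?_)
      rw [pow_succ]; ring
  set m : ℕ → ℝ := fun n => M * (1 / 2 : ℝ) ^ n with hm
  have hGs : ∀ n, G (n + 1) = e (G n) (m n) := fun n => rfl
  set w := fun n => W (G n) (m n)
  set w1 := fun n => W1 (G n) (m n)
  set w2 := fun n => W2 (G n) (m n)
  have hx : ∀ n, XB β (w n) (w1 n) (w2 n) (a * M * (1 / 2 : ℝ) ^ n) (C * M * (1 / 2 : ℝ) ^ n) := by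
    intro n; have := hX _ _ (hG n)
    simpa only [mul_assoc] using this
  have hs : ∀ n, Solves q b lam (fun t x => G n t x - G (n + 1) t x) (w n) (w1 n) (w2 n) :=
    fun n => hS _ _ (hG n)
  have s0 : ∀ t x, Summable fun n => w n t x := fun t x =>
    Summable.of_norm_bounded (hasSum_geo (a * M)).summable fun n => (hx n).sup t x
  have n1 : Nrm β (fun t x => ∑' n, w1 n t x) (2 * (C * M)) := Nrm.tsum fun n => (hx n).n1
  have n2 : Nrm β (fun t x => ∑' n, w2 n t x) (2 * (C * M)) := Nrm.tsum fun n => (hx n).n2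
  have s1 : ∀ t x, Summable fun n => w1 n t x := fun t x =>
    Summable.of_norm_bounded (hasSum_geo (C * M)).summable fun n => (hx n).n1.bd t x
  have s2 : ∀ t x, Summable fun n => w2 n t x := fun t x =>
    Summable.of_norm_bounded (hasSum_geo (C * M)).summable fun n => (hx n).n2.bd t x
  have sG : ∀ t x, Summable fun n => G n t x := fun t x =>
    Summable.of_norm_bounded (hasSum_geo M).summable fun n => (hG n).bd t x
  refine ⟨fun t x => ∑' n, w n t x, fun t x => ∑' n, w1 n t x, fun t x => ∑' n, w2 n t x,
    ⟨?_, ?_, n1, n2, ?_, ?_, ?_⟩, ?_⟩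
  · exact continuous_tsum (fun n => (hx n).cont) (hasSum_geo (a * M)).summable
      fun n p => (hx n).sup p.1 p.2
  · intro t x
    rw [← Real.norm_eq_abs]
    exact tsum_of_norm_bounded (hasSum_geo (a * M)) fun n => by simpa using (hx n).sup t x
  · intro t x
    exact hasFDerivAt_tsum (hasSum_geo (C * M)).summable (fun n x => (hx n).d1 t x)
      (fun n x => (hx n).n1.bd t x) (s0 t 0) x
  · intro t x
    exact hasFDerivAt_tsum (hasSum_geo (C * M)).summable (fun n x => (hx n).d2 t x)
      (fun n x => (hx n).n2.bd t x) (s1 t 0) x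
  · intro x; simp [(hx _).init]
  · intro t ht x
    set K := Mq * (C * M) + Mb * (C * M) + |lam| * (a * M) + (M + M)
    have hMq := hq.nonneg
    have hMb := hb.nonneg
    have key := hasDerivAt_tsum_of_isPreconnected (hasSum_geo K).summable isOpen_Ioi
      isPreconnected_Ioi (g := fun n τ => w n τ x)
      (g' := fun n t => q t x (w2 n t x) + b t x (w1 n t x) - lam * w n t x + (G n t x - G (n+1) t x))
      (t := Ioi (0:ℝ)) (y₀ := t) (y := t) (fun n τ hτ => hs n τ hτ x) ?_ ht (s0 t x) ht
    · have a1 := (q t x).hasSum (s2 t x).hasSum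
      have a2 := (b t x).hasSum (s1 t x).hasSum
      have a3 := ((s0 t x).hasSum).mul_left lam
      have a4 : HasSum (fun n => G n t x - G (n + 1) t x) (g t x) := by
        have h1 := (sG t x).hasSum
        have h2 := (hasSum_nat_add_iff' 1).2 h1
        have := h1.sub h2
        simpa [G] using this
      have a5 := (((a1.add a2).sub a3).add a4).tsum_eq
      exact a5 ▸ key
    · intro n τ hτ
      have b1 : ‖q τ x (w2 n τ x)‖ ≤ Mq * (C * M * (1 / 2 : ℝ) ^ n) :=
        ((q τ x).le_opNorm _).trans (mul_le_mul (hq.bd _ _) ((hx n).n2.bd _ _) (norm_nonneg _) hMq)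
      have b2 : ‖b τ x (w1 n τ x)‖ ≤ Mb * (C * M * (1 / 2 : ℝ) ^ n) :=
        ((b τ x).le_opNorm _).trans (mul_le_mul (hb.bd _ _) ((hx n).n1.bd _ _) (norm_nonneg _) hMb)
      have b3 : ‖lam * w n τ x‖ ≤ |lam| * (a * M * (1 / 2 : ℝ) ^ n) := by
        rw [norm_mul]; exact mul_le_mul_of_nonneg_left ((hx n).sup _ _) (abs_nonneg _)
      have b4 := (hG n).bd τ x
      have b5 := (hG (n+1)).bd τ x
      have b6 : M * (1 / 2 : ℝ) ^ (n+1) ≤ M * (1 / 2 : ℝ) ^ n := by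
        have := hg.nonneg
        rw [pow_succ]; nlinarith [show 0 ≤ M * (1/2:ℝ)^n by positivity]
      calc _ ≤ ‖q τ x (w2 n τ x)‖ + ‖b τ x (w1 n τ x)‖ + ‖lam * w n τ x‖ + (‖G n τ x‖ + ‖G (n+1) τ x‖) :=
            (norm_add_le _ _).trans (add_le_add ((norm_sub_le _ _).trans
              (add_le_add (norm_add_le _ _) le_rfl)) (norm_sub_le _ _))
        _ ≤ K * (1 / 2 : ℝ) ^ n := by simp only [K]; linarith
end Neumann

open scoped SchwartzMap Topology

section gauss
variable {E : Type} [NormedAddCommGroup E] [InnerProductSpace ℝ E]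

lemma tempG_fderiv {F : Type} [NormedAddCommGroup F] [NormedSpace ℝ F] {p : E → F}
    (h : p.HasTemperateGrowth) : (fderiv ℝ p).HasTemperateGrowth := by
  refine ⟨h.1.fderiv_right (by simp), fun n => ?_⟩
  obtain ⟨k, C, hC⟩ := h.2 (n + 1)
  exact ⟨k, C, fun x => by rw [norm_iteratedFDeriv_fderiv]; exact hC x⟩

lemma gauss_fderiv {F : Type} [NormedAddCommGroup F] [NormedSpace ℝ F] {p : E → F}
    (h : p.HasTemperateGrowth) (x : E) :
    HasFDerivAt (fun z : E => Real.exp (-‖z‖ ^ 2 / 4) • p z)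
      (Real.exp (-‖x‖ ^ 2 / 4) • (fderiv ℝ p x + ((-1 / 2 : ℝ) • innerSL ℝ x).smulRight (p x))) x := by
  have h1 : HasFDerivAt (fun z : E => ‖z‖ ^ 2) (2 • innerSL ℝ x) x :=
    (hasStrictFDerivAt_norm_sq x).hasFDerivAt
  have h2 : HasFDerivAt (fun z : E => -‖z‖ ^ 2 / 4) ((-1 / 2 : ℝ) • innerSL ℝ x) x := by
    have := (h1.neg.const_mul (1 / 4 : ℝ))
    refine (this.congr_fderiv ?_).congr_of_eventuallyEq (Eventually.of_forall fun z => ?_)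
    · ext v; simp; ring
    · simp; ring
  have h3 := h2.exp.smul (h.1.differentiable (by simp) x).hasFDerivAt
  refine h3.congr_fderiv ?_
  ext v; simp [smul_smul, mul_comm]; ring_nf

lemma gauss_decay (n : ℕ) : ∀ (F : Type) [NormedAddCommGroup F] [NormedSpace ℝ F] (p : E → F),
    p.HasTemperateGrowth → ∀ k : ℕ, ∃ C, ∀ x,
      ‖x‖ ^ k * ‖iteratedFDeriv ℝ n (fun z : E => Real.exp (-‖z‖ ^ 2 / 4) • p z) x‖ ≤ C := by
  induction n with
  | zero =>
    intro F _ _ p hp k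
    obtain ⟨m, C, hC⟩ := hp.2 0
    have hC0 : 0 ≤ C := by
      have := (norm_nonneg _).trans (hC 0)
      simpa using this
    have hb : ∃ B, ∀ r : ℝ, 0 ≤ r → (1 + r) ^ (k + m) * Real.exp (-r ^ 2 / 4) ≤ B := by
      refine ⟨(k + m).factorial * Real.exp 3, fun r hr => ?_⟩
      have h1 := Real.pow_div_factorial_le_exp (1 + r) (by positivity) (k + m)
      rw [div_le_iff₀ (by positivity)] at h1
      calc _ ≤ (Real.exp (1 + r) * (k + m).factorial) * Real.exp (-r ^ 2 / 4) := by gcongr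
        _ = (k + m).factorial * Real.exp (1 + r + -r ^ 2 / 4) := by rw [Real.exp_add (1 + r) (-r ^ 2 / 4)]; ring
        _ ≤ _ := by
          gcongr
          nlinarith [sq_nonneg (r - 2)]
    obtain ⟨B, hB⟩ := hb
    refine ⟨B * C, fun x => ?_⟩
    have h1 := hC x
    simp only [norm_iteratedFDeriv_zero] at h1 ⊢
    rw [norm_smul, Real.norm_of_nonneg (Real.exp_pos _).le]
    calc _ ≤ (1 + ‖x‖) ^ k * (Real.exp (-‖x‖ ^ 2 / 4) * (C * (1 + ‖x‖) ^ m)) := by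
          gcongr; linarith [norm_nonneg x]
      _ = (1 + ‖x‖) ^ (k + m) * Real.exp (-‖x‖ ^ 2 / 4) * C := by rw [pow_add]; ring
      _ ≤ _ := by gcongr; exact hB _ (norm_nonneg _)
  | succ n ih =>
    intro F _ _ p hp k
    have h2 := tempG_fderiv hp
    obtain ⟨C, hC⟩ := ih _ (fun x => fderiv ℝ p x + ((-1 / 2 : ℝ) • innerSL ℝ x).smulRight (p x)) (by
      have h3 : (fun x : E => (ContinuousLinearMap.smulRightL ℝ E F) ((-1 / 2 : ℝ) • innerSL ℝ x) (p x)).HasTemperateGrowth := by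
        have h4 : (fun x : E => ((-1 / 2 : ℝ) • innerSL ℝ x)).HasTemperateGrowth :=
          ((-1 / 2 : ℝ) • innerSL ℝ (E := E)).hasTemperateGrowth
        exact (ContinuousLinearMap.bilinear_hasTemperateGrowth (ContinuousLinearMap.smulRightL ℝ E F) h4 hp)
      exact h2.add h3) k
    refine ⟨C, fun x => ?_⟩
    rw [← norm_iteratedFDeriv_fderiv]
    have : fderiv ℝ (fun z : E => Real.exp (-‖z‖ ^ 2 / 4) • p z) = fun x => (Real.exp (-‖x‖ ^ 2 / 4) • (fderiv ℝ p x + ((-1 / 2 : ℝ) • innerSL ℝ x).smulRight (p x))) := by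
      funext x; exact (gauss_fderiv hp x).fderiv
    rw [this]; exact hC x

/-- The Gaussian as a Schwartz function. -/
def gau0 (E : Type) [NormedAddCommGroup E] [InnerProductSpace ℝ E] : 𝓢(E, ℝ) where
  toFun z := Real.exp (-‖z‖ ^ 2 / 4)
  smooth' := by
    have : ContDiff ℝ (⊤ : ℕ∞) (fun z : E => ‖z‖ ^ 2) := contDiff_norm_sq ℝ
    exact (this.neg.div_const 4).exp
  decay' k n := by
    obtain ⟨C, hC⟩ := gauss_decay (E := E) n ℝ (fun _ => 1) (Function.HasTemperateGrowth.const 1) k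
    refine ⟨C, fun x => ?_⟩
    simpa using hC x

lemma gau0_apply (z : E) : gau0 E z = Real.exp (-‖z‖ ^ 2 / 4) := rfl
end gauss

section kern
variable {E : Type} [NormedAddCommGroup E] [InnerProductSpace ℝ E] [FiniteDimensional ℝ E]
  [MeasurableSpace E] [BorelSpace E]
  {F : Type} [NormedAddCommGroup F] [NormedSpace ℝ F]

/-- derivative of a Schwartz function -/
abbrev sD (ψ : 𝓢(E, F)) : 𝓢(E, E →L[ℝ] F) := SchwartzMap.fderivCLM ℝ E F ψ

lemma sD_has (ψ : 𝓢(E, F)) (x : E) : HasFDerivAt ψ (sD ψ x) x := by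
  rw [SchwartzMap.fderivCLM_apply]; exact (ψ.differentiableAt).hasFDerivAt

lemma sch_decay (ψ : 𝓢(E, F)) (k : ℕ) : ∃ C, 0 ≤ C ∧ ∀ z, ‖ψ z‖ ≤ C * (1 + ‖z‖) ^ (-(k : ℝ)) := by
  obtain h := SchwartzMap.one_add_le_sup_seminorm_apply (𝕜 := ℝ) (m := (k, 0)) le_rfl le_rfl ψ
  refine ⟨2 ^ k * ((Finset.Iic (k, 0)).sup fun m => SchwartzMap.seminorm ℝ m.1 m.2) ψ, le_trans (by positivity) (h 0), fun z => ?_⟩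
  have h1 := h z
  rw [norm_iteratedFDeriv_zero] at h1
  rw [Real.rpow_neg (by positivity), Real.rpow_natCast, ← div_eq_mul_inv, le_div_iff₀ (by positivity), mul_comm]
  exact h1

lemma sch_int_weight (k : ℕ) (hk : Module.finrank ℝ E < k) :
    Integrable (fun z : E => (1 + ‖z‖) ^ (-(k : ℝ))) :=
  integrable_one_add_norm (by exact_mod_cast hk)

lemma w_shift (k : ℕ) (z a : E) (ha : ‖a‖ ≤ 1) :
    (1 + ‖z + a‖) ^ (-(k : ℝ)) ≤ 2 ^ k * (1 + ‖z‖) ^ (-(k : ℝ)) := by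
  rw [Real.rpow_neg (by positivity), Real.rpow_neg (by positivity), Real.rpow_natCast, Real.rpow_natCast,
    ← div_eq_mul_inv, le_div_iff₀ (by positivity), inv_mul_le_iff₀ (by positivity), ← mul_pow]
  gcongr
  have : ‖z‖ ≤ ‖z + a‖ + ‖a‖ := by simpa using norm_sub_le (z + a) a
  linarith [norm_nonneg (z + a)]

lemma shift_deriv (ψ : 𝓢(E, F)) {φ : E → ℝ} (hφ : Continuous φ) {M : ℝ} (hM : ∀ z, |φ z| ≤ M) :
    HasFDerivAt (fun a : E => ∫ z, φ z • ψ (z + a)) (∫ z, φ z • sD ψ z) 0 := by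
  set k := Module.finrank ℝ E + 1
  obtain ⟨C, hC0, hC⟩ := sch_decay (sD ψ) k
  have h := hasFDerivAt_integral_of_dominated_of_fderiv_le (𝕜 := ℝ) (μ := (volume : Measure E))
    (F := fun (a : E) z => φ z • ψ (z + a)) (F' := fun a z => φ z • sD ψ (z + a)) (x₀ := (0 : E))
    (s := Metric.closedBall 0 1) (bound := fun z => M * (C * (2 ^ k * (1 + ‖z‖) ^ (-(k : ℝ)))))
    (Metric.closedBall_mem_nhds _ one_pos)
    (Eventually.of_forall fun a => ((hφ.smul (ψ.continuous.comp (continuous_id.add continuous_const))).aestronglyMeasurable))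
    (by
      simp only [add_zero]
      refine ((ψ.integrable (μ := volume)).norm.const_mul M).mono (hφ.smul ψ.continuous).aestronglyMeasurable ?_
      refine Eventually.of_forall fun z => ?_
      rw [norm_smul, norm_mul, norm_norm]
      gcongr
      exact (hM z).trans (le_abs_self _))
    ((hφ.smul ((sD ψ).continuous.comp (continuous_id.add continuous_const))).aestronglyMeasurable)
    (Eventually.of_forall fun z a ha => by
      rw [norm_smul]
      have hM0 : 0 ≤ M := (abs_nonneg _).trans (hM 0)
      refine mul_le_mul (hM z) ((hC _).trans ?_) (norm_nonneg _) hM0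
      gcongr
      exact w_shift k z a (by simpa using ha))
    ((((sch_int_weight k (Nat.lt_succ_self _)).const_mul _).const_mul _).const_mul _)
    (Eventually.of_forall fun z a ha => by
      have := (sD_has ψ (z + a)).comp a ((hasFDerivAt_id a).const_add z)
      exact (this.const_smul (φ z)))
  simpa using h

lemma int_sD (ψ : 𝓢(E, F)) : ∫ z, sD ψ z = 0 := by
  have h := shift_deriv ψ (φ := fun _ => 1) continuous_const (M := 1) (by simp)
  simp only [one_smul] at h
  have h2 : (fun a : E => ∫ z, ψ (z + a)) = fun _ => ∫ z, ψ z := by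
    funext a; exact integral_add_right_eq_self (fun z => ψ z) a
  rw [h2] at h
  exact h.unique (hasFDerivAt_const _ _)

/-- scaled kernel averages -/
def Kc (ψ : 𝓢(E, F)) (f : E → ℝ) (τ : ℝ) (x : E) : F := ∫ z, f (x - √τ • z) • ψ z

lemma Kc_deriv (ψ : 𝓢(E, F)) {f : E → ℝ} (hf : Continuous f) {M : ℝ} (hM : ∀ z, |f z| ≤ M)
    {τ : ℝ} (hτ : 0 < τ) (x : E) :
    HasFDerivAt (Kc ψ f τ) ((√τ)⁻¹ • Kc (sD ψ) f τ x) x := by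
  have h := shift_deriv ψ (φ := fun z => f (x - √τ • z)) (by fun_prop) (fun z => hM _)
  have hs : (√τ) ≠ 0 := (Real.sqrt_pos.2 hτ).ne'
  have hL : HasFDerivAt (fun y : E => (√τ)⁻¹ • (y - x)) ((√τ)⁻¹ • ContinuousLinearMap.id ℝ E) x :=
    ((hasFDerivAt_id x).sub_const x).const_smul _
  have h0 : (fun y : E => (√τ)⁻¹ • (y - x)) x = 0 := by simp
  have h2 := (h0 ▸ h).comp x hL
  refine (h2.congr_fderiv ?_).congr_of_eventuallyEq (Eventually.of_forall fun y => ?_)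
  · ext v; simp [Kc]
  · have := integral_add_right_eq_self (μ := (volume : Measure E)) (fun z => f (y - √τ • z) • ψ z) ((√τ)⁻¹ • (y - x))
    simp only [Kc, Function.comp]
    rw [← this]
    refine integral_congr_ae (Eventually.of_forall fun z => ?_)
    simp only [smul_add, smul_smul, mul_inv_cancel₀ hs, one_smul]
    congr 2; abel

/-- weight constant -/
def wA (ψ : 𝓢(E, F)) : ℝ := ∫ z, (1 + ‖z‖) * ‖ψ z‖

lemma wA_int (ψ : 𝓢(E, F)) : Integrable (fun z => (1 + ‖z‖) * ‖ψ z‖) := by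
  have h0 := ψ.integrable_pow_mul volume 0
  have h1 := ψ.integrable_pow_mul volume 1
  refine (h0.add h1).congr (Eventually.of_forall fun z => ?_)
  simp; ring

lemma wA_nonneg (ψ : 𝓢(E, F)) : 0 ≤ wA ψ := integral_nonneg fun z => by positivity

lemma Kc_bd (ψ : 𝓢(E, F)) {f : E → ℝ} {M : ℝ} (hM : ∀ z, |f z| ≤ M) (τ : ℝ) (x : E) :
    ‖Kc ψ f τ x‖ ≤ M * wA ψ := by
  have hM0 : 0 ≤ M := (abs_nonneg _).trans (hM 0)
  rw [wA, ← integral_const_mul]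
  refine norm_integral_le_of_norm_le ((wA_int ψ).const_mul M) (Eventually.of_forall fun z => ?_)
  rw [norm_smul]
  refine mul_le_mul (hM _) ?_ (norm_nonneg _) hM0
  nlinarith [norm_nonneg z, norm_nonneg (ψ z)]

lemma Kc_hol (ψ : 𝓢(E, F)) (h0 : ∫ z, ψ z = 0) {f : E → ℝ} (hf : Continuous f) {M β : ℝ} (hβ : 0 ≤ β) (hβ1 : β ≤ 1)
    (hM : ∀ z, |f z| ≤ M) (hH : ∀ x y, |f x - f y| ≤ M * ‖x - y‖ ^ β) {τ : ℝ} (hτ : 0 ≤ τ) (x : E) :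
    ‖Kc ψ f τ x‖ ≤ M * wA ψ * τ ^ (β / 2) := by
  have hM0 : 0 ≤ M := (abs_nonneg _).trans (hM 0)
  have e : Kc ψ f τ x = ∫ z, (f (x - √τ • z) - f x) • ψ z := by
    simp only [sub_smul]
    rw [integral_sub, integral_smul, h0, smul_zero, sub_zero]; rfl
    · refine ((ψ.integrable (μ := volume)).norm.const_mul M).mono (Continuous.aestronglyMeasurable ?_) ?_
      · have := ψ.continuous; fun_prop
      refine Eventually.of_forall fun z => ?_
      rw [norm_smul, norm_mul, norm_norm]
      gcongr
      exact (hM _).trans (le_abs_self _)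
    · exact (ψ.integrable (μ := volume)).smul _
  have e2 : M * wA ψ * τ ^ (β / 2) = ∫ z, (M * τ ^ (β / 2)) * ((1 + ‖z‖) * ‖ψ z‖) := by
    rw [integral_const_mul, wA]; ring
  rw [e, e2]
  refine norm_integral_le_of_norm_le ((wA_int ψ).const_mul _) (Eventually.of_forall fun z => ?_)
  rw [norm_smul, ← mul_assoc]
  refine mul_le_mul_of_nonneg_right ?_ (norm_nonneg _)
  refine (hH _ _).trans ?_
  rw [mul_assoc]
  refine mul_le_mul_of_nonneg_left ?_ hM0
  have : ‖x - √τ • z - x‖ = √τ * ‖z‖ := by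
    rw [sub_sub_cancel_left, norm_neg, norm_smul, Real.norm_of_nonneg (Real.sqrt_nonneg _)]
  rw [this, Real.mul_rpow (by positivity) (by positivity)]
  have h3 : √τ ^ β = τ ^ (β / 2) := by
    rw [Real.sqrt_eq_rpow, ← Real.rpow_mul hτ]; congr 1; ring
  rw [h3]
  gcongr
  calc ‖z‖ ^ β ≤ (1 + ‖z‖) ^ β := by gcongr; linarith
    _ ≤ (1 + ‖z‖) ^ (1 : ℝ) := Real.rpow_le_rpow_of_exponent_le (by linarith [norm_nonneg z]) hβ1
    _ = _ := Real.rpow_one _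

lemma Kc_cont (ψ : 𝓢(E, F)) {g : ℝ → E → ℝ} (hg : Continuous fun p : ℝ × E => g p.1 p.2) {M : ℝ}
    (hM : ∀ t z, |g t z| ≤ M) : Continuous fun p : ℝ × ℝ × E => Kc ψ (g p.2.1) p.1 p.2.2 := by
  refine continuous_of_dominated (bound := fun z => M * ‖ψ z‖) ?_ ?_ ((ψ.integrable (μ := volume)).norm.const_mul M) ?_
  · intro p
    have h1 : Continuous fun z : E => g p.2.1 (p.2.2 - √p.1 • z) :=
      hg.comp (f := fun z : E => (p.2.1, p.2.2 - √p.1 • z)) (by fun_prop)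
    exact (h1.smul ψ.continuous).aestronglyMeasurable
  · intro p
    refine Eventually.of_forall fun z => ?_
    rw [norm_smul]; gcongr; exact hM _ _
  · refine Eventually.of_forall fun z => ?_
    have h1 : Continuous fun p : ℝ × ℝ × E => g p.2.1 (p.2.2 - √p.1 • z) :=
      hg.comp (f := fun p : ℝ × ℝ × E => (p.2.1, p.2.2 - √p.1 • z)) (by fun_prop)
    exact h1.smul continuous_const
end kern

open scoped SchwartzMap Topology

section pot
variable {E : Type} [NormedAddCommGroup E] [InnerProductSpace ℝ E] [FiniteDimensional ℝ E]
  [MeasurableSpace E] [BorelSpace E]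
  {F : Type} [NormedAddCommGroup F] [NormedSpace ℝ F]

/-- integrand of the time potential -/
def jI (lam c : ℝ) (ψ : 𝓢(E, F)) (g : ℝ → E → ℝ) (t : ℝ) (x : E) (τ : ℝ) : F :=
  (Real.exp (-lam * τ) * τ ^ c) • (Iio t).indicator (fun τ => Kc ψ (g (t - τ)) τ x) τ

/-- time potential -/
def Jp (lam c : ℝ) (ψ : 𝓢(E, F)) (g : ℝ → E → ℝ) (t : ℝ) (x : E) : F :=
  ∫ τ in Ioi (0 : ℝ), jI lam c ψ g t x τ

/-- kernel bound -/
def HB (ψ : 𝓢(E, F)) (g : ℝ → E → ℝ) (B γ : ℝ) : Prop :=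
  ∀ t x τ, 0 < τ → ‖Kc ψ (g t) τ x‖ ≤ B * τ ^ γ

lemma jI_meas (lam c : ℝ) (ψ : 𝓢(E, F)) {g : ℝ → E → ℝ} (hg : Continuous fun p : ℝ × E => g p.1 p.2) {M : ℝ}
    (hM : ∀ t z, |g t z| ≤ M) (t : ℝ) (x : E) :
    AEStronglyMeasurable (jI lam c ψ g t x) (volume.restrict (Ioi (0 : ℝ))) := by
  have h1 : Measurable fun τ : ℝ => Real.exp (-lam * τ) * τ ^ c := by fun_prop
  have h2 : Continuous fun τ : ℝ => Kc ψ (g (t - τ)) τ x :=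
    (Kc_cont ψ hg hM).comp (f := fun τ : ℝ => (τ, t - τ, x)) (by fun_prop)
  exact h1.aestronglyMeasurable.smul (h2.aestronglyMeasurable.indicator measurableSet_Iio)

lemma jI_bd {lam c B γ : ℝ} (hlam : 1 ≤ lam) {ψ : 𝓢(E, F)} {g : ℝ → E → ℝ} (hB : 0 ≤ B) (hb : HB ψ g B γ)
    (t : ℝ) (x : E) {τ : ℝ} (hτ : 0 < τ) :
    ‖jI lam c ψ g t x τ‖ ≤ B * (Real.exp (-τ) * τ ^ (c + γ + 1 - 1)) := by
  have h1 : ‖(Iio t).indicator (fun τ => Kc ψ (g (t - τ)) τ x) τ‖ ≤ B * τ ^ γ := by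
    refine (norm_indicator_le_norm_self _ _).trans (hb _ _ _ hτ)
  rw [jI, norm_smul, Real.norm_of_nonneg (by positivity)]
  calc _ ≤ (Real.exp (-τ) * τ ^ c) * (B * τ ^ γ) := by gcongr; nlinarith
    _ = _ := by
      have : c + γ + 1 - 1 = c + γ := by ring
      rw [this, Real.rpow_add hτ]; ring

lemma jI_bint {c γ : ℝ} (h : -1 < c + γ) (B : ℝ) :
    Integrable (fun τ => B * (Real.exp (-τ) * τ ^ (c + γ + 1 - 1))) (volume.restrict (Ioi (0 : ℝ))) :=
  (Real.GammaIntegral_convergent (by linarith)).const_mul B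

lemma jI_int {lam c B γ : ℝ} (hlam : 1 ≤ lam) {ψ : 𝓢(E, F)} {g : ℝ → E → ℝ}
    (hg : Continuous fun p : ℝ × E => g p.1 p.2) {M : ℝ} (hM : ∀ t z, |g t z| ≤ M)
    (hB : 0 ≤ B) (hb : HB ψ g B γ) (h : -1 < c + γ)
    (t : ℝ) (x : E) : Integrable (jI lam c ψ g t x) (volume.restrict (Ioi (0 : ℝ))) :=
  (jI_bint h B).mono' (jI_meas lam c ψ hg hM t x)
    (ae_restrict_of_forall_mem measurableSet_Ioi fun τ hτ => jI_bd hlam hB hb t x hτ)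

lemma Jp_bd {lam c B γ : ℝ} (hlam : 1 ≤ lam) {ψ : 𝓢(E, F)} {g : ℝ → E → ℝ}
    (hB : 0 ≤ B) (hb : HB ψ g B γ) (h : -1 < c + γ)
    (t : ℝ) (x : E) : ‖Jp lam c ψ g t x‖ ≤ B * Real.Gamma (c + γ + 1) := by
  rw [Real.Gamma_eq_integral (by linarith), ← integral_const_mul]
  exact norm_integral_le_of_norm_le (jI_bint h B)
    (ae_restrict_of_forall_mem measurableSet_Ioi fun τ hτ => jI_bd hlam hB hb t x hτ)

lemma Jp_cont {lam c B γ : ℝ} (hlam : 1 ≤ lam) {ψ : 𝓢(E, F)} {g : ℝ → E → ℝ}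
    (hg : Continuous fun p : ℝ × E => g p.1 p.2) {M : ℝ} (hM : ∀ t z, |g t z| ≤ M)
    (hB : 0 ≤ B) (hb : HB ψ g B γ) (h : -1 < c + γ) :
    Continuous fun p : ℝ × E => Jp lam c ψ g p.1 p.2 := by
  rw [continuous_iff_continuousAt]
  intro p
  refine continuousAt_of_dominated (bound := fun τ => B * (Real.exp (-τ) * τ ^ (c + γ + 1 - 1)))
    (Eventually.of_forall fun p => jI_meas lam c ψ hg hM p.1 p.2)
    (Eventually.of_forall fun p => ae_restrict_of_forall_mem measurableSet_Ioi fun τ hτ => jI_bd hlam hB hb _ _ hτ)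
    (jI_bint h B) ?_
  have hne : ∀ᵐ τ ∂(volume.restrict (Ioi (0 : ℝ))), τ ≠ p.1 :=
    ae_restrict_of_ae (by simp [ae_iff])
  filter_upwards [hne] with τ hτ
  have hc : Continuous fun p : ℝ × E => Kc ψ (g (p.1 - τ)) τ p.2 :=
    (Kc_cont ψ hg hM).comp (f := fun p : ℝ × E => (τ, p.1 - τ, p.2)) (by fun_prop)
  have hf : ContinuousAt (fun p : ℝ × E => p.1) p := continuousAt_fst
  refine ContinuousAt.smul continuousAt_const ?_
  rcases lt_or_gt_of_ne hτ with h1 | h1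
  · refine hc.continuousAt.congr ?_
    filter_upwards [hf.eventually (lt_mem_nhds h1)] with y hy
    rw [indicator_of_mem (by exact hy)]
  · refine (continuousAt_const (y := (0 : F))).congr ?_
    filter_upwards [hf.eventually (gt_mem_nhds h1)] with y hy
    rw [indicator_of_notMem (by simpa using hy.le)]

lemma jI_deriv (lam : ℝ) {c : ℝ} (ψ : 𝓢(E, F)) {g : ℝ → E → ℝ}
    (hg : Continuous fun p : ℝ × E => g p.1 p.2) {M : ℝ} (hM : ∀ t z, |g t z| ≤ M) (t : ℝ) (x : E)
    {τ : ℝ} (hτ : 0 < τ) :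
    HasFDerivAt (fun y => jI lam c ψ g t y τ) (jI lam (c - 1 / 2) (sD ψ) g t x τ) x := by
  unfold jI
  by_cases h : τ ∈ Iio t
  · simp only [indicator_of_mem h]
    have hk := (Kc_deriv ψ (f := g (t - τ)) (hg.comp (f := fun z : E => (t - τ, z)) (by fun_prop)) (hM _) hτ x).const_smul
      (Real.exp (-lam * τ) * τ ^ c)
    refine hk.congr_fderiv ?_
    rw [smul_smul, Real.rpow_sub hτ, ← Real.sqrt_eq_rpow]
    congr 1; rw [mul_assoc]; rfl
  · simp only [indicator_of_notMem h, smul_zero]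
    exact hasFDerivAt_const _ _

lemma Jp_deriv {lam c B γ B' γ' : ℝ} (hlam : 1 ≤ lam) {ψ : 𝓢(E, F)} {g : ℝ → E → ℝ}
    (hg : Continuous fun p : ℝ × E => g p.1 p.2) {M : ℝ} (hM : ∀ t z, |g t z| ≤ M)
    (hB : 0 ≤ B) (hb : HB ψ g B γ) (h : -1 < c + γ)
    (hB' : 0 ≤ B') (hb' : HB (sD ψ) g B' γ') (h' : -1 < c - 1 / 2 + γ') (t : ℝ) (x : E) :
    HasFDerivAt (Jp lam c ψ g t) (Jp lam (c - 1 / 2) (sD ψ) g t x) x := by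
  refine hasFDerivAt_integral_of_dominated_of_fderiv_le (s := univ) univ_mem
    (Eventually.of_forall fun p => jI_meas lam c ψ hg hM t p) (jI_int hlam hg hM hB hb h t x)
    (jI_meas lam (c - 1 / 2) (sD ψ) hg hM t x)
    (ae_restrict_of_forall_mem measurableSet_Ioi fun τ hτ y _ => jI_bd hlam hB' hb' t y hτ)
    (jI_bint h' B')
    (ae_restrict_of_forall_mem measurableSet_Ioi fun τ hτ y _ => jI_deriv lam ψ hg hM t y hτ)

lemma jI_lip {lam B γ : ℝ} {c : ℝ} (hlam : 1 ≤ lam) (ψ : 𝓢(E, F)) {g : ℝ → E → ℝ}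
    (hg : Continuous fun p : ℝ × E => g p.1 p.2) {M : ℝ} (hM : ∀ t z, |g t z| ≤ M)
    (hB : 0 ≤ B) (hb : HB (sD ψ) g B γ) (t : ℝ) (x y : E)
    {τ : ℝ} (hτ : 0 < τ) :
    ‖jI lam c ψ g t x τ - jI lam c ψ g t y τ‖ ≤ B * τ ^ (c - 1 / 2 + γ) * ‖x - y‖ := by
  refine Convex.norm_image_sub_le_of_norm_hasFDerivWithin_le (f := fun y => jI lam c ψ g t y τ)
    (fun z _ => (jI_deriv lam ψ hg hM t z hτ).hasFDerivWithinAt) (fun z _ => ?_) convex_univ (mem_univ _) (mem_univ _)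
  refine (jI_bd hlam hB hb t z hτ).trans ?_
  have : c - 1 / 2 + γ + 1 - 1 = c - 1 / 2 + γ := by ring
  rw [this]
  gcongr
  have : Real.exp (-τ) ≤ 1 := Real.exp_le_one_iff.2 (by linarith)
  nlinarith [Real.rpow_pos_of_pos hτ (c - 1 / 2 + γ)]

lemma Jp_hol {lam B B' β : ℝ} (hlam : 1 ≤ lam) (h0 : 0 < β) (h1 : β < 1) {ψ : 𝓢(E, F)} {g : ℝ → E → ℝ}
    (hg : Continuous fun p : ℝ × E => g p.1 p.2) {M : ℝ} (hM : ∀ t z, |g t z| ≤ M)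
    (hB : 0 ≤ B) (hb : HB ψ g B (β / 2)) (hB' : 0 ≤ B') (hb' : HB (sD ψ) g B' (β / 2)) (t : ℝ) (x y : E) :
    ‖Jp lam (-1) ψ g t x - Jp lam (-1) ψ g t y‖ ≤ (4 * B / β + 2 * B' / (1 - β)) * ‖x - y‖ ^ β := by
  have hint : ∀ z, Integrable (jI lam (-1) ψ g t z) (volume.restrict (Ioi (0 : ℝ))) := fun z =>
    jI_int hlam hg hM hB hb (by linarith) t z
  rcases eq_or_ne x y with rfl | hxy
  · simp [Real.zero_rpow h0.ne']
  set r := ‖x - y‖ with hr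
  have hr0 : 0 < r := norm_pos_iff.2 (sub_ne_zero.2 hxy)
  unfold Jp
  rw [← integral_sub (hint x) (hint y), ← Ioc_union_Ioi_eq_Ioi (sq_nonneg r),
    setIntegral_union (f := fun a => jI lam (-1) ψ g t x a - jI lam (-1) ψ g t y a) (Ioc_disjoint_Ioi le_rfl) measurableSet_Ioi
      (((hint x).sub (hint y)).mono_measure (Measure.restrict_mono_set _ Ioc_subset_Ioi_self))
      (((hint x).sub (hint y)).mono_measure (Measure.restrict_mono_set _ (Ioi_subset_Ioi (sq_nonneg r))))]
  refine (norm_add_le _ _).trans ?_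
  rw [add_mul]
  have hr2 : (r ^ 2) ^ (β / 2) = r ^ β := by
    rw [← Real.rpow_natCast, ← Real.rpow_mul hr0.le]; congr 1; push_cast; ring
  refine add_le_add ?_ ?_
  · have hi : IntervalIntegrable (fun τ : ℝ => 2 * B * τ ^ (β / 2 - 1)) volume 0 (r ^ 2) :=
      (intervalIntegral.intervalIntegrable_rpow' (by linarith)).const_mul _
    have hi' := (intervalIntegrable_iff_integrableOn_Ioc_of_le (sq_nonneg r)).1 hi
    refine (norm_integral_le_of_norm_le hi' (ae_restrict_of_forall_mem measurableSet_Ioc fun τ hτ => ?_)).trans ?_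
    · refine (norm_sub_le _ _).trans ?_
      have e1 := jI_bd (c := -1) hlam hB hb t x hτ.1
      have e2 := jI_bd (c := -1) hlam hB hb t y hτ.1
      have e3 : Real.exp (-τ) ≤ 1 := Real.exp_le_one_iff.2 (by linarith [hτ.1])
      have e4 : -1 + β / 2 + 1 - 1 = β / 2 - 1 := by ring
      rw [e4] at e1 e2
      have e5 : B * (Real.exp (-τ) * τ ^ (β / 2 - 1)) ≤ B * (1 * τ ^ (β / 2 - 1)) := by
        have := Real.rpow_pos_of_pos hτ.1 (β / 2 - 1); gcongr
      linarith
    · rw [← intervalIntegral.integral_of_le (sq_nonneg r), intervalIntegral.integral_const_mul,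
        integral_rpow (by left; linarith), sub_add_cancel, Real.zero_rpow (by positivity), hr2]
      apply le_of_eq; field_simp; ring
  · have hlt : β / 2 - 3 / 2 < -1 := by linarith
    have hi := (integrableOn_Ioi_rpow_of_lt hlt (sq_pos_of_pos hr0)).const_mul (B' * r)
    refine (norm_integral_le_of_norm_le hi (ae_restrict_of_forall_mem measurableSet_Ioi fun τ hτ => ?_)).trans ?_
    · have hτ0 : 0 < τ := (sq_pos_of_pos hr0).trans hτ
      refine (jI_lip hlam ψ hg hM hB' hb' t x y hτ0).trans (le_of_eq ?_)
      have : (-1 - 1 / 2 + β / 2) = β / 2 - 3 / 2 := by ring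
      rw [this]; ring
    · rw [integral_const_mul, integral_Ioi_rpow_of_lt hlt (sq_pos_of_pos hr0)]
      have e1 : (r ^ 2) ^ (β / 2 - 3 / 2 + 1) = r ^ β / r := by
        rw [← Real.rpow_natCast, ← Real.rpow_mul hr0.le, ← Real.rpow_sub_one hr0.ne']; congr 1; push_cast; ring
      rw [e1]
      have e2 : β / 2 - 3 / 2 + 1 = -((1 - β) / 2) := by ring
      rw [e2]
      have : 1 - β ≠ 0 := by linarith
      apply le_of_eq; field_simp
end pot

open scoped SchwartzMap Topology

section heat
variable {E : Type} [NormedAddCommGroup E] [InnerProductSpace ℝ E] [FiniteDimensional ℝ E]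
  [MeasurableSpace E] [BorelSpace E]

/-- normalised Gaussian -/
def gauN (E : Type) [NormedAddCommGroup E] [InnerProductSpace ℝ E] [FiniteDimensional ℝ E]
  [MeasurableSpace E] [BorelSpace E] : 𝓢(E, ℝ) := (∫ z : E, gau0 E z)⁻¹ • gau0 E

lemma gau0_int_pos : 0 < ∫ z : E, gau0 E z := by
  refine integral_pos_of_integrable_nonneg_nonzero (x := 0) (gau0 E).continuous ((gau0 E).integrable) (fun z => (Real.exp_pos _).le) ?_
  exact (Real.exp_pos _).ne'

lemma gauN_int : ∫ z : E, gauN E z = 1 := by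
  have : ∀ z, gauN E z = (∫ z : E, gau0 E z)⁻¹ * gau0 E z := fun z => rfl
  simp only [this]
  rw [integral_const_mul, inv_mul_cancel₀ gau0_int_pos.ne']

lemma gauN_nonneg (z : E) : 0 ≤ gauN E z := by
  have : gauN E z = (∫ z : E, gau0 E z)⁻¹ * gau0 E z := rfl
  rw [this]
  exact mul_nonneg (inv_nonneg.2 gau0_int_pos.le) (Real.exp_pos _).le

lemma gauN_D (z : E) : sD (gauN E) z = gauN E z • ((-1 / 2 : ℝ) • innerSL ℝ z) := by
  have h := (gauss_fderiv (E := E) (p := fun _ => (∫ z : E, gau0 E z)⁻¹) (Function.HasTemperateGrowth.const _) z)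
  have e : (fun z : E => Real.exp (-‖z‖ ^ 2 / 4) • (∫ z : E, gau0 E z)⁻¹) = gauN E := by
    funext z
    have : gauN E z = (∫ z : E, gau0 E z)⁻¹ * gau0 E z := rfl
    rw [this, gau0_apply, smul_eq_mul, mul_comm]
  have e' := congrFun e z
  rw [e] at h
  rw [(sD_has (gauN E) z).unique h, ← e']
  ext v; simp; ring

lemma gauN_D2 (z u v : E) : sD (sD (gauN E)) z u v =
    gauN E z * (inner ℝ z u * inner ℝ z v / 4 - inner ℝ u v / 2) := by
  have h1 : HasFDerivAt (fun z : E => sD (gauN E) z v) ((ContinuousLinearMap.apply ℝ ℝ v).comp (sD (sD (gauN E)) z)) z :=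
    (ContinuousLinearMap.apply ℝ ℝ v).hasFDerivAt.comp z (sD_has (sD (gauN E)) z)
  have h2 : HasFDerivAt (fun z : E => gauN E z * ((-1 / 2) * innerSL ℝ v z))
      (gauN E z • ((-1 / 2 : ℝ) • innerSL ℝ v) + ((-1 / 2) * innerSL ℝ v z) • sD (gauN E) z) z :=
    (sD_has (gauN E) z).mul ((innerSL ℝ v).hasFDerivAt.const_mul (-1 / 2))
  have e : (fun z : E => sD (gauN E) z v) = fun z : E => gauN E z * ((-1 / 2) * innerSL ℝ v z) := by
    funext z; rw [gauN_D]; simp [real_inner_comm]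
  rw [e] at h1
  have h3 := congrArg (fun L => L u) (h1.unique h2)
  simp only [ContinuousLinearMap.comp_apply, ContinuousLinearMap.apply_apply] at h3
  rw [h3, gauN_D]
  simp [real_inner_comm]; ring

variable {ι : Type} [Fintype ι]

/-- trace functional -/
def lapL (e : OrthonormalBasis ι ℝ E) : (E →L[ℝ] E →L[ℝ] ℝ) →L[ℝ] ℝ :=
  ∑ i, (ContinuousLinearMap.apply ℝ ℝ (e i)).comp (ContinuousLinearMap.apply ℝ (E →L[ℝ] ℝ) (e i))

lemma lapL_apply (e : OrthonormalBasis ι ℝ E) (H : E →L[ℝ] E →L[ℝ] ℝ) : lapL e H = ∑ i, H (e i) (e i) := by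
  simp [lapL]

lemma heat_id (e : OrthonormalBasis ι ℝ E) (z : E) : lapL e (sD (sD (gauN E)) z) =
    -(1 / 2) * (Module.finrank ℝ E * gauN E z + sD (gauN E) z z) := by
  rw [lapL_apply]
  simp only [gauN_D2, gauN_D]
  have h1 : ∑ i, inner ℝ z (e i) * inner ℝ z (e i) = ‖z‖ ^ 2 := by
    rw [← real_inner_self_eq_norm_sq, ← e.sum_inner_mul_inner z z]
    exact Finset.sum_congr rfl fun i _ => by rw [real_inner_comm z (e i)]
  have h2 : ∑ i : ι, inner ℝ (e i) (e i) = (Module.finrank ℝ E : ℝ) := by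
    simp [Module.finrank_eq_card_basis e.toBasis]
  rw [← Finset.mul_sum, Finset.sum_sub_distrib, ← Finset.sum_div, ← Finset.sum_div, h1, h2]
  simp; ring

lemma scale_deriv (ψ : 𝓢(E, ℝ)) {φ : E → ℝ} (hφ : Continuous φ) {M : ℝ} (hM : ∀ z, |φ z| ≤ M) :
    HasDerivAt (fun m : ℝ => ∫ z, φ z * ψ (m • z)) (∫ z, φ z * sD ψ z z) 1 := by
  set k := Module.finrank ℝ E + 1
  obtain ⟨C, hC0, hC⟩ := sch_decay (sD ψ) (k + 1)
  have hM0 : 0 ≤ M := (abs_nonneg _).trans (hM 0)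
  have h := hasDerivAt_integral_of_dominated_loc_of_deriv_le (𝕜 := ℝ) (μ := (volume : Measure E))
    (F := fun (m : ℝ) z => φ z * ψ (m • z)) (F' := fun m z => φ z * sD ψ (m • z) z) (x₀ := (1 : ℝ))
    (s := Metric.ball 1 (1 / 2)) (bound := fun z => M * (C * (2 ^ (k + 1) * (1 + ‖z‖) ^ (-(k : ℝ)))))
    (Metric.ball_mem_nhds _ (by norm_num))
    (Eventually.of_forall fun a => by
      have := ψ.continuous
      exact (Continuous.aestronglyMeasurable (by fun_prop)))
    (by
      simp only [one_smul]
      refine ((ψ.integrable (μ := volume)).norm.const_mul M).mono (hφ.mul ψ.continuous).aestronglyMeasurable ?_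
      refine Eventually.of_forall fun z => ?_
      rw [norm_mul, norm_mul, norm_norm]
      gcongr
      exact (hM z).trans (le_abs_self _))
    (by
      have := (sD ψ).continuous
      refine Continuous.aestronglyMeasurable (hφ.mul (Continuous.clm_apply (by fun_prop) continuous_id)))
    (Eventually.of_forall fun z a ha => by
      rw [norm_mul]
      refine mul_le_mul (hM z) ?_ (norm_nonneg _) hM0
      refine ((sD ψ (a • z)).le_opNorm z).trans ?_
      have ha' : 1 / 2 ≤ a := by
        rw [Metric.mem_ball, Real.dist_eq, abs_lt] at ha; linarith [ha.1]
      have hz : (1 + ‖z‖) / 2 ≤ 1 + ‖a • z‖ := by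
        rw [norm_smul, Real.norm_of_nonneg (by linarith)]; nlinarith [norm_nonneg z]
      calc ‖sD ψ (a • z)‖ * ‖z‖ ≤ (C * (1 + ‖a • z‖) ^ (-((k + 1 : ℕ) : ℝ))) * (1 + ‖z‖) := by
            gcongr
            · exact hC _
            · linarith
        _ ≤ (C * ((1 + ‖z‖) / 2) ^ (-((k + 1 : ℕ) : ℝ))) * (1 + ‖z‖) := by
            gcongr ?_ * _
            refine mul_le_mul_of_nonneg_left (Real.rpow_le_rpow_of_nonpos (by positivity) hz ?_) hC0
            exact neg_nonpos.2 (Nat.cast_nonneg _)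
        _ = _ := by
            rw [Real.div_rpow (by positivity) (by norm_num), Real.rpow_neg (by positivity), Real.rpow_neg (by norm_num), Real.rpow_neg (by positivity),
              Real.rpow_natCast, Real.rpow_natCast, Real.rpow_natCast, pow_succ (1 + ‖z‖)]
            have : 1 + ‖z‖ ≠ 0 := by positivity
            field_simp)
    ((((sch_int_weight k (Nat.lt_succ_self _)).const_mul _).const_mul _).const_mul _)
    (Eventually.of_forall fun z a ha => by
      have h1 : HasDerivAt (fun m : ℝ => m • z) z a := by simpa using (hasDerivAt_id a).smul_const z
      exact ((sD_has ψ (a • z)).comp_hasDerivAt a h1).const_mul (φ z))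
  simpa using h.2

lemma Kc_scale (ψ : 𝓢(E, ℝ)) (f : E → ℝ) {τ τ' : ℝ} (hτ : 0 < τ) (hτ' : 0 < τ') (x : E) :
    Kc ψ f τ' x = √(τ / τ') ^ Module.finrank ℝ E * ∫ z, f (x - √τ • z) * ψ (√(τ / τ') • z) := by
  have hm : 0 < √(τ / τ') := Real.sqrt_pos.2 (div_pos hτ hτ')
  have h := Measure.integral_comp_smul (volume : Measure E) (fun w => f (x - √τ' • w) • ψ w) (√(τ / τ'))
  have e : ∀ z : E, √τ' • (√(τ / τ') • z) = √τ • z := fun z => by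
    rw [smul_smul, ← Real.sqrt_mul hτ'.le, mul_div_cancel₀ _ hτ'.ne']
  simp only [e, smul_eq_mul] at h
  rw [h, abs_of_pos (by positivity)]
  simp only [Kc, smul_eq_mul]
  field_simp

lemma Kc_tderiv (e : OrthonormalBasis ι ℝ E) {f : E → ℝ} (hf : Continuous f) {M : ℝ} (hM : ∀ z, |f z| ≤ M)
    {τ : ℝ} (hτ : 0 < τ) (x : E) :
    HasDerivAt (fun τ => Kc (gauN E) f τ x) (τ⁻¹ * lapL e (Kc (sD (sD (gauN E))) f τ x)) τ := by
  have hφ : Continuous fun z => f (x - √τ • z) := by fun_prop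
  have h1 := scale_deriv (gauN E) (φ := fun z => f (x - √τ • z)) hφ (fun z => hM _)
  have hone : √(τ / τ) = 1 := by rw [div_self hτ.ne', Real.sqrt_one]
  have hm : HasDerivAt (fun τ' : ℝ => √(τ / τ')) (-(1 / (2 * τ))) τ := by
    have a1 : HasDerivAt (fun τ' : ℝ => τ / τ') (-(1 / τ)) τ := by
      have := (hasDerivAt_inv hτ.ne').const_mul τ
      refine (this.congr_deriv ?_).congr_of_eventuallyEq (Eventually.of_forall fun y => ?_)
      · field_simp
      · simp [div_eq_mul_inv]
    have := a1.sqrt (by rw [div_self hτ.ne']; norm_num)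
    refine this.congr_deriv ?_
    rw [hone]; field_simp
  have h2 := (hone.symm ▸ h1 : HasDerivAt _ _ (√(τ / τ))).comp τ hm
  have h3 := (hm.pow (Module.finrank ℝ E)).mul h2
  have h4 : HasDerivAt (fun τ => Kc (gauN E) f τ x) _ τ := h3.congr_of_eventuallyEq (by
    filter_upwards [lt_mem_nhds hτ] with τ' hτ'
    rw [Kc_scale (gauN E) f hτ hτ' x]; rfl)
  refine h4.congr_deriv ?_
  have hi2 : Integrable fun z => f (x - √τ • z) • sD (sD (gauN E)) z := by
    refine (((sD (sD (gauN E))).integrable (μ := volume)).norm.const_mul M).mono' (hφ.smul (sD (sD (gauN E))).continuous).aestronglyMeasurable ?_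
    refine Eventually.of_forall fun z => ?_
    rw [norm_smul]; gcongr; exact hM _
  have hi0 : Integrable fun z => f (x - √τ • z) * gauN E z := by
    refine (((gauN E).integrable (μ := volume)).norm.const_mul M).mono' (hφ.mul (gauN E).continuous).aestronglyMeasurable ?_
    refine Eventually.of_forall fun z => ?_
    rw [norm_mul]; gcongr; exact hM _
  have e1 : lapL e (Kc (sD (sD (gauN E))) f τ x) = ∫ z, f (x - √τ • z) * lapL e (sD (sD (gauN E)) z) := by
    rw [Kc, ← ContinuousLinearMap.integral_comp_comm _ hi2]
    simp
  have hi1 : Integrable fun z => f (x - √τ • z) * sD (gauN E) z z := by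
    have h5 := ((lapL e).integrable_comp hi2)
    have h6 := (h5.const_mul (-2)).sub (hi0.const_mul (Module.finrank ℝ E : ℝ))
    refine h6.congr (Eventually.of_forall fun z => ?_)
    simp only [Pi.sub_apply, map_smul, heat_id, smul_eq_mul]; ring
  have e2 : ∫ z, f (x - √τ • z) * lapL e (sD (sD (gauN E)) z) =
      -(1 / 2) * (Module.finrank ℝ E * (∫ z, f (x - √τ • z) * gauN E z) + ∫ z, f (x - √τ • z) * sD (gauN E) z z) := by
    rw [← integral_const_mul, ← integral_add (hi0.const_mul _) hi1, ← integral_const_mul]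
    refine integral_congr_ae (Eventually.of_forall fun z => ?_)
    simp only [heat_id]; ring
  rw [e1, e2]
  simp only [Pi.pow_apply, hone, one_pow, Function.comp, one_smul]
  field_simp; ring
end heat

open scoped SchwartzMap Topology

lemma duhamel_fubini {k H : ℝ → ℝ → ℝ} (hkm : Measurable fun p : ℝ × ℝ => k p.1 p.2) {κ : ℝ → ℝ}
    (hk : ∀ s τ, 0 < τ → |k s τ| ≤ κ τ) {T : ℝ} (hT : 0 < T) (hκ : IntegrableOn κ (Ioo 0 T))
    (hH : Continuous fun p : ℝ × ℝ => H p.1 p.2) (hd : ∀ s τ, 0 < τ → HasDerivAt (H s) (k s τ) τ)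
    (hci : IntervalIntegrable (fun r => ∫ s in (0 : ℝ)..r, k s (r - s)) volume 0 T) :
    ∫ s in (0 : ℝ)..T, H s (T - s) = ∫ r in (0 : ℝ)..T, (H r 0 + ∫ s in (0 : ℝ)..r, k s (r - s)) := by
  set S : Set (ℝ × ℝ) := {p | 0 < p.1 ∧ p.1 < p.2 ∧ p.2 < T} with hS
  have hSm : MeasurableSet S := by
    refine MeasurableSet.inter ?_ (MeasurableSet.inter ?_ ?_)
    · exact measurableSet_lt measurable_const measurable_fst
    · exact measurableSet_lt measurable_fst measurable_snd
    · exact measurableSet_lt measurable_snd measurable_const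
  set Φ : ℝ → ℝ → ℝ := fun s r => S.indicator (fun p => k p.1 (p.2 - p.1)) (s, r) with hΦ
  have hΦi : Integrable (Function.uncurry Φ) (volume.prod volume) := by
    have h1 : Integrable ((Ioo 0 T).indicator κ) := hκ.integrable_indicator measurableSet_Ioo
    have h2 : Integrable ((Ioo 0 T).indicator (fun _ : ℝ => (1 : ℝ))) :=
      (integrable_indicator_iff measurableSet_Ioo).2 ((continuous_const.integrableOn_Icc).mono_set Ioo_subset_Icc_self)
    have h3 := (h2.convolution_integrand (ContinuousLinearMap.mul ℝ ℝ) h1).swap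
    refine h3.mono' ?_ (Eventually.of_forall fun p => ?_)
    · have : Measurable fun p : ℝ × ℝ => k p.1 (p.2 - p.1) :=
        hkm.comp (measurable_fst.prodMk (measurable_snd.sub measurable_fst))
      exact (this.indicator hSm).aestronglyMeasurable
    · rcases p with ⟨s, r⟩
      simp only [Function.uncurry, hΦ, Function.comp, Prod.swap, ContinuousLinearMap.mul_apply']
      by_cases hp : (s, r) ∈ S
      · obtain ⟨a, b, c⟩ := hp
        simp only at a b c
        rw [indicator_of_mem (show (s, r) ∈ S from ⟨a, b, c⟩), indicator_of_mem (show s ∈ Ioo 0 T from ⟨a, b.trans c⟩),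
          indicator_of_mem (show r - s ∈ Ioo 0 T from ⟨by linarith, by linarith⟩), one_mul]
        exact hk _ _ (by simp; linarith)
      · rw [indicator_of_notMem hp, norm_zero]
        refine mul_nonneg (indicator_nonneg (fun _ _ => zero_le_one) _) (indicator_nonneg (fun τ hτ => (abs_nonneg _).trans (hk 0 τ hτ.1)) _)
  have hsw := integral_integral_swap hΦi
  -- inner integral in r
  have e1 : ∀ s, ∫ r, Φ s r = (Ioo 0 T).indicator (fun s => H s (T - s) - H s 0) s := by
    intro s
    by_cases hs : s ∈ Ioo 0 T
    · rw [indicator_of_mem hs]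
      have a1 : ∀ r, Φ s r = (Ioo s T).indicator (fun r => k s (r - s)) r := by
        intro r
        by_cases hr : r ∈ Ioo s T
        · rw [indicator_of_mem hr]; exact indicator_of_mem (show (s, r) ∈ S from ⟨hs.1, hr.1, hr.2⟩) _
        · rw [indicator_of_notMem hr]; exact indicator_of_notMem (fun h => hr ⟨h.2.1, h.2.2⟩) _
      simp only [a1]
      rw [integral_indicator measurableSet_Ioo, ← integral_Ioc_eq_integral_Ioo, ← intervalIntegral.integral_of_le hs.2.le,
        intervalIntegral.integral_comp_sub_right (fun τ => k s τ) s, sub_self]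
      refine intervalIntegral.integral_eq_sub_of_hasDerivAt_of_le (by linarith [hs.2]) ?_ (fun τ hτ => hd s τ hτ.1) ?_
      · exact (hH.comp (f := fun τ : ℝ => (s, τ)) (by fun_prop)).continuousOn
      · rw [intervalIntegrable_iff_integrableOn_Ioo_of_le (by linarith [hs.2])]
        have : Measurable (k s) := hkm.comp (measurable_const.prodMk measurable_id)
        refine Integrable.mono' (hκ.mono_set (Ioo_subset_Ioo_right (by linarith [hs.1]))) this.aestronglyMeasurable
          (ae_restrict_of_forall_mem measurableSet_Ioo fun τ hτ => hk s τ hτ.1)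
    · rw [indicator_of_notMem hs]
      have a1 : ∀ r, Φ s r = 0 := fun r => indicator_of_notMem (fun h => hs ⟨h.1, h.2.1.trans h.2.2⟩) _
      simp [a1]
  have e2 : ∀ r, ∫ s, Φ s r = (Ioo 0 T).indicator (fun r => ∫ s in (0 : ℝ)..r, k s (r - s)) r := by
    intro r
    by_cases hr : r ∈ Ioo 0 T
    · rw [indicator_of_mem hr, intervalIntegral.integral_of_le hr.1.le, integral_Ioc_eq_integral_Ioo, ← integral_indicator measurableSet_Ioo]
      refine integral_congr_ae (Eventually.of_forall fun s => ?_)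
      by_cases hs : s ∈ Ioo 0 r
      · simp only; rw [indicator_of_mem hs]; exact indicator_of_mem (show (s, r) ∈ S from ⟨hs.1, hs.2, hr.2⟩) _
      · simp only; rw [indicator_of_notMem hs]; exact indicator_of_notMem (fun h => hs ⟨h.1, h.2.1⟩) _
    · rw [indicator_of_notMem hr]
      have a1 : ∀ s, Φ s r = 0 := fun s => indicator_of_notMem (fun h => hr ⟨h.1.trans h.2.1, h.2.2⟩) _
      simp [a1]
  simp only [e1, e2] at hsw
  rw [integral_indicator measurableSet_Ioo, integral_indicator measurableSet_Ioo, ← integral_Ioc_eq_integral_Ioo, ← integral_Ioc_eq_integral_Ioo,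
    ← intervalIntegral.integral_of_le hT.le, ← intervalIntegral.integral_of_le hT.le] at hsw
  have c1 : Continuous fun s => H s (T - s) := hH.comp (f := fun s : ℝ => (s, T - s)) (by fun_prop)
  have c2 : Continuous fun s => H s 0 := hH.comp (f := fun s : ℝ => (s, 0)) (by fun_prop)
  rw [intervalIntegral.integral_sub (c1.intervalIntegrable _ _) (c2.intervalIntegrable _ _)] at hsw
  rw [intervalIntegral.integral_add (c2.intervalIntegrable _ _) hci]
  linarith

section heat2
variable {E : Type} [NormedAddCommGroup E] [InnerProductSpace ℝ E] [FiniteDimensional ℝ E]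
  [MeasurableSpace E] [BorelSpace E] {ι : Type} [Fintype ι]

lemma heat_repr (e : OrthonormalBasis ι ℝ E) {lam β B0 B2 : ℝ} (hβ : 0 < β) (hlam : 1 ≤ lam) {g : ℝ → E → ℝ}
    (hg : Continuous fun p : ℝ × E => g p.1 p.2) {M : ℝ} (hM : ∀ t z, |g t z| ≤ M)
    (hB0 : 0 ≤ B0) (hb0 : HB (gauN E) g B0 0) (hB2 : 0 ≤ B2) (hb2 : HB (sD (sD (gauN E))) g B2 (β / 2))
    {T : ℝ} (hT : 0 < T) (x : E) :
    Jp lam 0 (gauN E) g T x = ∫ r in (0 : ℝ)..T,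
      (g r x + (lapL e (Jp lam (-1) (sD (sD (gauN E))) g r x) - lam * Jp lam 0 (gauN E) g r x)) := by
  set K0 : ℝ → ℝ → ℝ := fun s τ => Kc (gauN E) (g s) τ x with hK0
  set K2 : ℝ → ℝ → ℝ := fun s τ => lapL e (Kc (sD (sD (gauN E))) (g s) τ x) with hK2
  set k : ℝ → ℝ → ℝ := fun s τ => Real.exp (-lam * τ) * (τ⁻¹ * K2 s τ - lam * K0 s τ) with hk
  set H : ℝ → ℝ → ℝ := fun s τ => Real.exp (-lam * τ) * K0 s τ with hH
  have cK0 : Continuous fun p : ℝ × ℝ => K0 p.1 p.2 :=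
    (Kc_cont (gauN E) hg hM).comp (f := fun p : ℝ × ℝ => (p.2, p.1, x)) (by fun_prop)
  have cK2 : Continuous fun p : ℝ × ℝ => K2 p.1 p.2 :=
    (lapL e).continuous.comp ((Kc_cont (sD (sD (gauN E))) hg hM).comp (f := fun p : ℝ × ℝ => (p.2, p.1, x)) (by fun_prop))
  have hkm : Measurable fun p : ℝ × ℝ => k p.1 p.2 := by
    have m0 := cK0.measurable
    have m2 := cK2.measurable
    simp only [hk]
    fun_prop
  have hint0 := fun r => jI_int (c := 0) hlam hg hM hB0 hb0 (by norm_num) r x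
  have hint2 := fun r => jI_int (c := -1) hlam hg hM hB2 hb2 (by linarith) r x
  have key : ∀ r, 0 < r → ∫ s in (0 : ℝ)..r, k s (r - s) =
      lapL e (Jp lam (-1) (sD (sD (gauN E))) g r x) - lam * Jp lam 0 (gauN E) g r x := by
    intro r hr
    have a1 : ∫ s in (0 : ℝ)..r, k s (r - s) = ∫ τ in (0 : ℝ)..r, k (r - τ) τ := by
      have := intervalIntegral.integral_comp_sub_left (a := 0) (b := r) (fun τ => k (r - τ) τ) r
      simpa using this
    rw [a1, intervalIntegral.integral_of_le hr.le, integral_Ioc_eq_integral_Ioo, ← Ioi_inter_Iio, ← setIntegral_indicator measurableSet_Iio]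
    unfold Jp
    rw [← ContinuousLinearMap.integral_comp_comm _ (hint2 r), ← integral_const_mul,
      ← integral_sub ((lapL e).integrable_comp (hint2 r)) ((hint0 r).const_mul lam)]
    refine setIntegral_congr_fun measurableSet_Ioi fun τ hτ => ?_
    simp only [jI]
    by_cases h : τ ∈ Iio r
    · simp only [indicator_of_mem h, map_smul, hk, hK0, hK2, Real.rpow_zero, Real.rpow_neg_one, smul_eq_mul]; ring
    · simp only [indicator_of_notMem h, smul_zero, map_zero, mul_zero, sub_zero]
  have hH0 : ∀ r, H r 0 = g r x := by
    intro r
    simp only [hH, hK0, Kc, Real.sqrt_zero, zero_smul, sub_zero, smul_eq_mul, mul_zero, Real.exp_zero, one_mul]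
    rw [integral_const_mul, gauN_int, mul_one]
  have cV : Continuous fun r => lapL e (Jp lam (-1) (sD (sD (gauN E))) g r x) - lam * Jp lam 0 (gauN E) g r x := by
    have c2 := (Jp_cont (c := -1) hlam hg hM hB2 hb2 (by linarith)).comp (f := fun r : ℝ => (r, x)) (by fun_prop)
    have c0 := (Jp_cont (c := 0) hlam hg hM hB0 hb0 (by norm_num)).comp (f := fun r : ℝ => (r, x)) (by fun_prop)
    exact ((lapL e).continuous.comp c2).sub (continuous_const.mul c0)
  have fub := duhamel_fubini (k := k) (H := H) hkm (κ := fun τ => ‖lapL e‖ * B2 * τ ^ (β / 2 - 1) + lam * B0) ?_ hT ?_ ?_ ?_ ?_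
  · have b1 : Jp lam 0 (gauN E) g T x = ∫ s in (0 : ℝ)..T, H s (T - s) := by
      have := intervalIntegral.integral_comp_sub_left (a := 0) (b := T) (fun τ => H (T - τ) τ) T
      simp only [sub_sub_cancel, sub_self, sub_zero] at this
      rw [this, intervalIntegral.integral_of_le hT.le, integral_Ioc_eq_integral_Ioo, ← Ioi_inter_Iio, ← setIntegral_indicator measurableSet_Iio]
      unfold Jp
      refine setIntegral_congr_fun measurableSet_Ioi fun τ hτ => ?_
      simp only [jI]
      by_cases h : τ ∈ Iio T
      · simp only [indicator_of_mem h, hH, hK0, Real.rpow_zero, smul_eq_mul]; ring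
      · simp only [indicator_of_notMem h, smul_zero]
    rw [b1, fub]
    refine intervalIntegral.integral_congr_ae (Eventually.of_forall fun r hr => ?_)
    rw [uIoc_of_le hT.le] at hr
    rw [key r hr.1, hH0]
  · intro s τ hτ
    have h2 : |K2 s τ| ≤ ‖lapL e‖ * (B2 * τ ^ (β / 2)) :=
      ((lapL e).le_opNorm _).trans (by gcongr; exact hb2 _ _ _ hτ)
    have h0 : |K0 s τ| ≤ B0 := by simpa using hb0 s x τ hτ
    have he : Real.exp (-lam * τ) ≤ 1 := Real.exp_le_one_iff.2 (by nlinarith)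
    simp only [hk]
    rw [abs_mul, abs_of_pos (Real.exp_pos _)]
    calc _ ≤ 1 * (τ⁻¹ * (‖lapL e‖ * (B2 * τ ^ (β / 2))) + lam * B0) := by
          gcongr
          refine (abs_sub _ _).trans ?_
          rw [abs_mul, abs_mul, abs_of_pos (inv_pos.2 hτ), abs_of_pos (show 0 < lam by linarith)]
          gcongr
      _ = _ := by rw [Real.rpow_sub_one hτ.ne']; field_simp
  · have : IntervalIntegrable (fun τ : ℝ => ‖lapL e‖ * B2 * τ ^ (β / 2 - 1) + lam * B0) volume 0 T :=
      ((intervalIntegral.intervalIntegrable_rpow' (by linarith)).const_mul _).add (continuous_const.intervalIntegrable _ _)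
    exact (intervalIntegrable_iff_integrableOn_Ioo_of_le hT.le).1 this
  · simp only [hH]; fun_prop
  · intro s τ hτ
    have h1 := Kc_tderiv e (f := g s) (hg.comp (f := fun z : E => (s, z)) (by fun_prop)) (hM s) hτ x
    have h2 : HasDerivAt (fun τ : ℝ => Real.exp (-lam * τ)) (Real.exp (-lam * τ) * (-lam)) τ := by
      have := ((hasDerivAt_id τ).const_mul (-lam)).exp
      simpa using this
    refine (h2.mul h1).congr_deriv ?_
    simp only [hk, hK0, hK2]; ring
  · refine (cV.intervalIntegrable 0 T).congr ?_
    intro r hr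
    rw [uIoc_of_le hT.le] at hr
    exact (key r hr.1).symm

lemma heat_solver (e : OrthonormalBasis ι ℝ E) {β : ℝ} (hβ : 0 < β) (hβ1 : β < 1) :
    ∃ C, 0 ≤ C ∧ ∀ lam, 1 ≤ lam → ∀ (g : ℝ → E → ℝ) M, Nrm β g M → ∃ w w1 w2,
      XB β w w1 w2 (M / lam) (C * M) ∧ Solves (fun _ _ => lapL e) (fun _ _ => 0) lam g w w1 w2 := by
  set G := gauN E
  set A0 := wA G
  set A1 := wA (sD G)
  set A2 := wA (sD (sD G))
  set A3 := wA (sD (sD (sD G)))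
  set Cb := A1 * Real.Gamma (-(1/2) + 0 + 1)
  set C2 := A2 * Real.Gamma (-1 + β / 2 + 1)
  set C3 := 4 * A2 / β + 2 * A3 / (1 - β)
  have hA0 : 0 ≤ A0 := wA_nonneg _
  have hA1 : 0 ≤ A1 := wA_nonneg _
  have hA2 : 0 ≤ A2 := wA_nonneg _
  have hA3 : 0 ≤ A3 := wA_nonneg _
  have hCb : 0 ≤ Cb := mul_nonneg hA1 (Real.Gamma_nonneg_of_nonneg (by norm_num))
  have hC2 : 0 ≤ C2 := mul_nonneg hA2 (Real.Gamma_nonneg_of_nonneg (by linarith))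
  have hC3 : 0 ≤ C3 := add_nonneg (by positivity) (div_nonneg (by positivity) (by linarith))
  refine ⟨2 * (Cb + C2) + C3, by positivity, fun lam hlam g M hN => ?_⟩
  have hM0 := hN.nonneg
  have hM : ∀ t z, |g t z| ≤ M := hN.bd
  have hg := hN.cont
  have hgt : ∀ t, Continuous (g t) := fun t => hg.comp (f := fun z : E => (t, z)) (by fun_prop)
  have hb0 : HB G g (M * A0) 0 := fun t x τ hτ => by
    rw [Real.rpow_zero, mul_one]; exact Kc_bd G (hM t) τ x
  have hb1 : HB (sD G) g (M * A1) 0 := fun t x τ hτ => by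
    rw [Real.rpow_zero, mul_one]; exact Kc_bd (sD G) (hM t) τ x
  have hb2 : HB (sD (sD G)) g (M * A2) (β / 2) := fun t x τ hτ =>
    Kc_hol _ (int_sD _) (hgt t) hβ.le hβ1.le (hM t) (hN.hol t) hτ.le x
  have hb3 : HB (sD (sD (sD G))) g (M * A3) (β / 2) := fun t x τ hτ =>
    Kc_hol _ (int_sD _) (hgt t) hβ.le hβ1.le (hM t) (hN.hol t) hτ.le x
  have d1 : ∀ t x, HasFDerivAt (Jp lam 0 G g t) (Jp lam (-(1 / 2)) (sD G) g t x) x := fun t x => by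
    have := Jp_deriv (c := 0) hlam hg hM (by positivity) hb0 (by norm_num) (by positivity) hb1 (by norm_num) t x
    rwa [zero_sub] at this
  have d2 : ∀ t x, HasFDerivAt (Jp lam (-(1 / 2)) (sD G) g t) (Jp lam (-1) (sD (sD G)) g t x) x := fun t x => by
    have := Jp_deriv (c := -(1 / 2)) hlam hg hM (by positivity) hb1 (by norm_num) (by positivity) hb2 (by linarith) t x
    have e : (-(1 / 2) - 1 / 2 : ℝ) = -1 := by norm_num
    rwa [e] at this
  have bd2 : ∀ t x, ‖Jp lam (-1) (sD (sD G)) g t x‖ ≤ C2 * M := fun t x => by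
    have := Jp_bd (c := -1) hlam (by positivity) hb2 (by linarith) t x
    refine this.trans (le_of_eq ?_); simp only [C2]; ring
  have bd1 : ∀ t x, ‖Jp lam (-(1 / 2)) (sD G) g t x‖ ≤ Cb * M := fun t x => by
    have := Jp_bd (c := -(1 / 2)) hlam (by positivity) hb1 (by norm_num) t x
    refine this.trans (le_of_eq ?_); simp only [Cb]; ring
  have c0 := Jp_cont (c := 0) hlam hg hM (by positivity) hb0 (by norm_num)
  have c1 := Jp_cont (c := -(1 / 2)) hlam hg hM (by positivity) hb1 (by norm_num)
  have c2 := Jp_cont (c := -1) hlam hg hM (by positivity) hb2 (by linarith)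
  refine ⟨Jp lam 0 G g, Jp lam (-(1 / 2)) (sD G) g, Jp lam (-1) (sD (sD G)) g, ⟨c0, ?_, ?_, ?_, d1, d2, ?_⟩, ?_⟩
  · intro t x
    have hbound : ∀ τ ∈ Ioi (0 : ℝ), ‖jI lam 0 G g t x τ‖ ≤ M * Real.exp (-lam * τ) := by
      intro τ hτ
      rw [jI, norm_smul, Real.rpow_zero, mul_one, Real.norm_of_nonneg (Real.exp_pos _).le, mul_comm]
      refine mul_le_mul_of_nonneg_right ((norm_indicator_le_norm_self _ _).trans ?_) (Real.exp_pos _).le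
      have : M = ∫ z, M * G z := by rw [integral_const_mul, gauN_int, mul_one]
      rw [this]
      refine norm_integral_le_of_norm_le ((G.integrable (μ := volume)).const_mul M) (Eventually.of_forall fun z => ?_)
      rw [norm_smul, Real.norm_of_nonneg (gauN_nonneg z)]
      exact mul_le_mul_of_nonneg_right (hM _ _) (gauN_nonneg z)
    have hi : IntegrableOn (fun τ => Real.exp (-lam * τ)) (Ioi (0 : ℝ)) := exp_neg_integrableOn_Ioi 0 (by linarith)
    refine (norm_integral_le_of_norm_le (hi.const_mul M) (ae_restrict_of_forall_mem measurableSet_Ioi hbound)).trans (le_of_eq ?_)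
    rw [integral_const_mul, integral_exp_mul_Ioi (by linarith)]
    simp [div_eq_mul_inv]
  · refine (Nrm.of_lip (M := (Cb + C2) * M) hβ hβ1.le c1 (fun t x => (bd1 t x).trans (by nlinarith)) ?_).mono (by nlinarith)
    intro t x y
    refine Convex.norm_image_sub_le_of_norm_hasFDerivWithin_le (f := Jp lam (-(1 / 2)) (sD G) g t)
      (fun z _ => (d2 t z).hasFDerivWithinAt) (fun z _ => (bd2 t z).trans (by nlinarith)) convex_univ (mem_univ _) (mem_univ _)
  · refine ⟨c2, fun t x => (bd2 t x).trans (by nlinarith [mul_nonneg hCb hM0, mul_nonneg hC2 hM0, mul_nonneg hC3 hM0]), fun t x y => ?_⟩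
    refine (Jp_hol hlam hβ hβ1 hg hM (by positivity) hb2 (by positivity) hb3 t x y).trans ?_
    refine mul_le_mul_of_nonneg_right ?_ (by positivity)
    have : 4 * (M * A2) / β + 2 * (M * A3) / (1 - β) = C3 * M := by simp only [C3]; ring
    rw [this]; nlinarith [mul_nonneg hCb hM0, mul_nonneg hC2 hM0]
  · intro x
    have : ∀ τ ∈ Ioi (0 : ℝ), jI lam 0 G g 0 x τ = 0 := fun τ hτ => by
      rw [jI, indicator_of_notMem (by simpa using (le_of_lt hτ)), smul_zero]
    rw [Jp, setIntegral_congr_fun measurableSet_Ioi this]; simp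
  · intro t ht x
    have hc : Continuous fun r => g r x + (lapL e (Jp lam (-1) (sD (sD G)) g r x) - lam * Jp lam 0 G g r x) := by
      have a0 := c0.comp (f := fun r : ℝ => (r, x)) (by fun_prop)
      have a2 := c2.comp (f := fun r : ℝ => (r, x)) (by fun_prop)
      have ag := hg.comp (f := fun r : ℝ => (r, x)) (by fun_prop)
      exact ag.add (((lapL e).continuous.comp a2).sub (continuous_const.mul a0))
    have h1 := intervalIntegral.integral_hasDerivAt_right (hc.intervalIntegrable 0 t) (hc.stronglyMeasurableAtFilter _ _) hc.continuousAt
    refine (h1.congr_of_eventuallyEq ?_).congr_deriv ?_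
    · filter_upwards [lt_mem_nhds ht] with r hr
      exact heat_repr e hβ hlam hg hM (by positivity) hb0 (by positivity) hb2 hr x
    · simp; ring
end heat2

section const
variable {E : Type} [NormedAddCommGroup E] [InnerProductSpace ℝ E] [FiniteDimensional ℝ E]
  [MeasurableSpace E] [BorelSpace E] {ι : Type} [Fintype ι]

lemma Nrm.comp_lin {F : Type} [NormedAddCommGroup F] [NormedSpace ℝ F] {β M : ℝ} {g : ℝ → E → F}
    (h : Nrm β g M) (h0 : 0 ≤ β) (h1 : β ≤ 1) (S : E →L[ℝ] E) :
    Nrm β (fun t x => g t (S x)) ((1 + ‖S‖) * M) := by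
  have hM := h.nonneg
  refine ⟨h.cont.comp (f := fun p : ℝ × E => (p.1, S p.2)) (by fun_prop), fun t x => (h.bd _ _).trans ?_, fun t x y => (h.hol _ _ _).trans ?_⟩
  · nlinarith [norm_nonneg S, mul_nonneg (norm_nonneg S) hM]
  · rw [← map_sub]
    have e1 : ‖S (x - y)‖ ^ β ≤ (‖S‖ * ‖x - y‖) ^ β := Real.rpow_le_rpow (norm_nonneg _) (S.le_opNorm _) h0
    rw [Real.mul_rpow (norm_nonneg _) (norm_nonneg _)] at e1
    have e2 : ‖S‖ ^ β ≤ 1 + ‖S‖ :=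
      calc ‖S‖ ^ β ≤ (1 + ‖S‖) ^ β := by gcongr; linarith
        _ ≤ (1 + ‖S‖) ^ (1 : ℝ) := Real.rpow_le_rpow_of_exponent_le (by linarith [norm_nonneg S]) h1
        _ = _ := Real.rpow_one _
    calc M * ‖S (x - y)‖ ^ β ≤ M * ((1 + ‖S‖) * ‖x - y‖ ^ β) := by
          gcongr; exact e1.trans (by gcongr)
      _ = _ := by ring

/-- constant coefficient operator -/
def qL (e : OrthonormalBasis ι ℝ E) (L : E →L[ℝ] E) : (E →L[ℝ] E →L[ℝ] ℝ) →L[ℝ] ℝ :=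
  ∑ i, (ContinuousLinearMap.apply ℝ ℝ (L (e i))).comp (ContinuousLinearMap.apply ℝ (E →L[ℝ] ℝ) (L (e i)))

lemma qL_apply (e : OrthonormalBasis ι ℝ E) (L : E →L[ℝ] E) (H : E →L[ℝ] E →L[ℝ] ℝ) : qL e L H = ∑ i, H (L (e i)) (L (e i)) := by
  simp [qL]

/-- solvability with constant `C` for all `lam ≥ 1` -/
def Slv (β : ℝ) (q : ℝ → E → (E →L[ℝ] E →L[ℝ] ℝ) →L[ℝ] ℝ) (C : ℝ) : Prop :=
  ∀ lam, 1 ≤ lam → ∀ (g : ℝ → E → ℝ) M, Nrm β g M → ∃ w w1 w2,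
      XB β w w1 w2 (C * M / lam) (C * M) ∧ Solves q (fun _ _ => 0) lam g w w1 w2

lemma XB.mono {β a M a' M' : ℝ} {w : ℝ → E → ℝ} {w1 : ℝ → E → E →L[ℝ] ℝ} {w2 : ℝ → E → E →L[ℝ] E →L[ℝ] ℝ}
    (h : XB β w w1 w2 a M) (ha : a ≤ a') (hM : M ≤ M') : XB β w w1 w2 a' M' :=
  ⟨h.cont, fun t x => (h.sup t x).trans ha, h.n1.mono hM, h.n2.mono hM, h.d1, h.d2, h.init⟩

lemma const_solver (e : OrthonormalBasis ι ℝ E) (L : E ≃L[ℝ] E) {β : ℝ} (hβ : 0 < β) (hβ1 : β < 1) :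
    ∃ C, 0 ≤ C ∧ Slv β (fun _ _ => qL e (L : E →L[ℝ] E)) C := by
  obtain ⟨C, hC, hs⟩ := heat_solver e hβ hβ1
  set S : E →L[ℝ] E := (L.symm : E →L[ℝ] E)
  set L' : E →L[ℝ] E := (L : E →L[ℝ] E)
  set R : (E →L[ℝ] ℝ) →L[ℝ] (E →L[ℝ] ℝ) := (ContinuousLinearMap.compL ℝ E E ℝ).flip S with hR
  set T2 : (E →L[ℝ] E →L[ℝ] ℝ) →L[ℝ] (E →L[ℝ] E →L[ℝ] ℝ) :=
    ((ContinuousLinearMap.compL ℝ E E (E →L[ℝ] ℝ)).flip S).comp (ContinuousLinearMap.compL ℝ E (E →L[ℝ] ℝ) (E →L[ℝ] ℝ) R) with hT2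
  set k := 1 + ‖L'‖
  have hk : 1 ≤ k := by simp [k]
  set K := k + ‖R‖ * ((1 + ‖S‖) * (C * k)) + ‖T2‖ * ((1 + ‖S‖) * (C * k))
  have hK : 0 ≤ ‖R‖ * ((1 + ‖S‖) * (C * k)) := by positivity
  have hK' : 0 ≤ ‖T2‖ * ((1 + ‖S‖) * (C * k)) := by positivity
  refine ⟨K, by positivity, fun lam hlam g M hg => ?_⟩
  have hM := hg.nonneg
  obtain ⟨w, w1, w2, hX, hS⟩ := hs lam hlam _ _ (hg.comp_lin hβ.le hβ1.le L')
  refine ⟨fun t x => w t (S x), fun t x => R (w1 t (S x)), fun t x => T2 (w2 t (S x)), ⟨?_, ?_, ?_, ?_, ?_, ?_, ?_⟩, ?_⟩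
  · exact hX.cont.comp (f := fun p : ℝ × E => (p.1, S p.2)) (by fun_prop)
  · intro t x
    refine (hX.sup _ _).trans ?_
    gcongr
    simp only [K]; linarith
  · refine ((hX.n1.comp_lin hβ.le hβ1.le S).clm R).mono ?_
    calc _ = ‖R‖ * ((1 + ‖S‖) * (C * k)) * M := by ring
      _ ≤ _ := by gcongr; simp only [K]; linarith
  · refine ((hX.n2.comp_lin hβ.le hβ1.le S).clm T2).mono ?_
    calc _ = ‖T2‖ * ((1 + ‖S‖) * (C * k)) * M := by ring
      _ ≤ _ := by gcongr; simp only [K]; linarith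
  · intro t x
    exact (hX.d1 t (S x)).comp x S.hasFDerivAt
  · intro t x
    exact R.hasFDerivAt.comp x ((hX.d2 t (S x)).comp x S.hasFDerivAt)
  · intro x; exact hX.init _
  · intro t ht x
    refine (hS t ht (S x)).congr_deriv ?_
    have e1 : L' (S x) = x := L.apply_symm_apply x
    have e2 : ∀ y, S (L' y) = y := fun y => L.symm_apply_apply y
    simp only [lapL_apply, qL_apply, e1, hT2, hR, ContinuousLinearMap.comp_apply, ContinuousLinearMap.compL_apply,
      ContinuousLinearMap.flip_apply, e2, ContinuousLinearMap.zero_apply]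

lemma perturb {β C : ℝ} {q0 : (E →L[ℝ] E →L[ℝ] ℝ) →L[ℝ] ℝ} (hC : 0 ≤ C) (h : Slv β (fun _ _ => q0) C) {ε : ℝ}
    (hε : 4 * ε * C ≤ 1) {q : ℝ → E → (E →L[ℝ] E →L[ℝ] ℝ) →L[ℝ] ℝ} (hq : Nrm β (fun t x => q t x - q0) ε) :
    Slv β q (2 * C) := by
  intro lam hlam
  have hlam0 : 0 < lam := by linarith
  have hq' : Nrm β q (ε + ‖q0‖) := (hq.add (Nrm.const q0)).congr fun t x => by simp
  have := neumann (lam := lam) (a := C / lam) (C := C) hq' (Nrm.zero (F := (E →L[ℝ] ℝ) →L[ℝ] ℝ)) (fun g M hg => by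
    obtain ⟨w, w1, w2, hX, hS⟩ := h lam hlam g M hg
    refine ⟨w, w1, w2, fun t x => (q t x - q0) (w2 t x), hX.mono (le_of_eq (by ring)) le_rfl, (hq.app hX.n2).mono ?_, ?_⟩
    · nlinarith [hg.nonneg]
    · intro t ht x
      refine (hS t ht x).congr_deriv ?_
      simp; ring)
  intro g M hg
  obtain ⟨w, w1, w2, hX, hS⟩ := this g M hg
  exact ⟨w, w1, w2, hX.mono (le_of_eq (by ring)) (le_of_eq (by ring)), hS⟩
end const

section cut
variable {E : Type} [NormedAddCommGroup E] [NormedSpace ℝ E]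

/-- smooth cutoff with controlled derivatives -/
structure Cut (β : ℝ) (η : ℝ → E → ℝ) (η1 : ℝ → E → E →L[ℝ] ℝ) (η2 : ℝ → E → E →L[ℝ] E →L[ℝ] ℝ) (ηt : ℝ → E → ℝ) (N : ℝ) : Prop where
  n0 : Nrm β η N
  n1 : Nrm β η1 N
  n2 : Nrm β η2 N
  nt : Nrm β ηt N
  d1 : ∀ t x, HasFDerivAt (η t) (η1 t x) x
  d2 : ∀ t x, HasFDerivAt (η1 t) (η2 t x) x
  dt : ∀ t x, HasDerivAt (fun τ => η τ x) (ηt t x) t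

variable {β N a M m P lam : ℝ} {η w ηt g : ℝ → E → ℝ} {η1 w1 : ℝ → E → E →L[ℝ] ℝ} {η2 w2 : ℝ → E → E →L[ℝ] E →L[ℝ] ℝ}
  {q q' : ℝ → E → (E →L[ℝ] E →L[ℝ] ℝ) →L[ℝ] ℝ} {b b' : ℝ → E → (E →L[ℝ] ℝ) →L[ℝ] ℝ}

lemma XB.cut (hη : Cut β η η1 η2 ηt N) (h : XB β w w1 w2 a M) (hm : Nrm β w m) (hm1 : Nrm β w1 m) :
    XB β (fun t x => η t x * w t x) (fun t x => η t x • w1 t x + w t x • η1 t x)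
      (fun t x => (η t x • w2 t x + (η1 t x).smulRight (w1 t x)) + (w t x • η2 t x + (w1 t x).smulRight (η1 t x)))
      (N * a) (2 * N * M + 6 * N * m) := by
  have hN := hη.n0.nonneg
  have hM := h.n2.nonneg
  have hm0 := hm.nonneg
  refine ⟨hη.n0.cont.mul h.cont, fun t x => ?_, ((hη.n0.smul h.n1).add (hm.smul hη.n1)).mono ?_,
    (((hη.n0.smul h.n2).add (hη.n1.smulRight hm1)).add ((hm.smul hη.n2).add (hm1.smulRight hη.n1))).mono ?_,
    fun t x => ?_, fun t x => ?_, fun x => by rw [h.init, mul_zero]⟩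
  · rw [abs_mul]; exact mul_le_mul (hη.n0.bd t x) (h.sup t x) (abs_nonneg _) hN
  · nlinarith [mul_nonneg hN hm0]
  · nlinarith [mul_nonneg hN hm0]
  · exact (hη.d1 t x).mul (h.d1 t x)
  · exact ((hη.d1 t x).smul (h.d2 t x) |>.add ((h.d1 t x).smul (hη.d2 t x)))

/-- error term -/
def cutErr (η w ηt : ℝ → E → ℝ) (η1 w1 : ℝ → E → E →L[ℝ] ℝ) (η2 : ℝ → E → E →L[ℝ] E →L[ℝ] ℝ)
    (q : ℝ → E → (E →L[ℝ] E →L[ℝ] ℝ) →L[ℝ] ℝ) (b b' : ℝ → E → (E →L[ℝ] ℝ) →L[ℝ] ℝ) (t : ℝ) (x : E) : ℝ :=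
  (ηt t x • w t x - q t x ((η1 t x).smulRight (w1 t x) + (w t x • η2 t x + (w1 t x).smulRight (η1 t x))))
    - (b t x (w t x • η1 t x) + η t x • ((b t x - b' t x) (w1 t x)))

lemma cutErr_nrm (hη : Cut β η η1 η2 ηt N) (hm : Nrm β w m) (hm1 : Nrm β w1 m) (hq : Nrm β q P) (hb : Nrm β b P) (hb' : Nrm β b' P) :
    Nrm β (cutErr η w ηt η1 w1 η2 q b b') (N * m * (2 + 24 * P)) := by
  have := ((hη.nt.smul hm).sub (hq.app ((hη.n1.smulRight hm1).add ((hm.smul hη.n2).add (hm1.smulRight hη.n1))))).sub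
    ((hb.app (hm.smul hη.n1)).add (hη.n0.smul ((hb.sub hb').app hm1)))
  exact this.mono (le_of_eq (by ring))

lemma Cut.solves (hη : Cut β η η1 η2 ηt N) (hd1 : True)
    (hq : ∀ t, 0 < t → ∀ x, η t x ≠ 0 → HasDerivAt (fun τ => w τ x) (q t x (w2 t x) + b' t x (w1 t x) - lam * w t x + g t x) t)
    (hz : ∀ t, 0 < t → ∀ x, η t x = 0 → HasDerivAt (fun τ => η τ x * w τ x) (ηt t x * w t x) t) :
    Solves q b lam (fun t x => η t x * g t x + cutErr η w ηt η1 w1 η2 q b b' t x) (fun t x => η t x * w t x)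
      (fun t x => η t x • w1 t x + w t x • η1 t x)
      (fun t x => (η t x • w2 t x + (η1 t x).smulRight (w1 t x)) + (w t x • η2 t x + (w1 t x).smulRight (η1 t x))) := by
  intro t ht x
  by_cases h0 : η t x = 0
  · refine (hz t ht x h0).congr_deriv ?_
    simp [cutErr, h0]
  · refine ((hη.dt t x).mul (hq t ht x h0)).congr_deriv ?_
    simp [cutErr]; ring
end cut

section patch
variable {E : Type} [NormedAddCommGroup E] [InnerProductSpace ℝ E] [FiniteDimensional ℝ E] [MeasurableSpace E] [BorelSpace E] {κ : Type} [Fintype κ] {β : ℝ}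

lemma Slv.mono {q : ℝ → E → (E →L[ℝ] E →L[ℝ] ℝ) →L[ℝ] ℝ} {C C' : ℝ} (h : Slv β q C) (hC : C ≤ C') : Slv β q C' := by
  intro lam hl g M hg
  have := hg.nonneg
  obtain ⟨w, w1, w2, hX, hS⟩ := h lam hl g M hg
  exact ⟨w, w1, w2, hX.mono (by gcongr) (by gcongr), hS⟩

lemma XB.sum {w : κ → ℝ → E → ℝ} {w1 : κ → ℝ → E → E →L[ℝ] ℝ} {w2 : κ → ℝ → E → E →L[ℝ] E →L[ℝ] ℝ} {a M : ℝ}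
    (h : ∀ k, XB β (w k) (w1 k) (w2 k) a M) :
    XB β (fun t x => ∑ k, w k t x) (fun t x => ∑ k, w1 k t x) (fun t x => ∑ k, w2 k t x)
      (Fintype.card κ * a) (Fintype.card κ * M) := by
  refine ⟨continuous_finset_sum _ fun k _ => (h k).cont, fun t x => ?_, ?_, ?_, fun t x => ?_, fun t x => ?_, fun x => ?_⟩
  · refine (Finset.abs_sum_le_sum_abs _ _).trans ((Finset.sum_le_sum fun k _ => (h k).sup t x).trans ?_)
    simp
  · refine (Nrm.sum Finset.univ fun k _ => (h k).n1).mono (by simp)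
  · refine (Nrm.sum Finset.univ fun k _ => (h k).n2).mono (by simp)
  · exact HasFDerivAt.fun_sum fun k _ => (h k).d1 t x
  · exact HasFDerivAt.fun_sum fun k _ => (h k).d2 t x
  · exact Finset.sum_eq_zero fun k _ => (h k).init x

/-- full solvability at one value of `lam` -/
def Sol (β : ℝ) (q : ℝ → E → (E →L[ℝ] E →L[ℝ] ℝ) →L[ℝ] ℝ) (b : ℝ → E → (E →L[ℝ] ℝ) →L[ℝ] ℝ) (lam C : ℝ) : Prop :=
  ∀ (g : ℝ → E → ℝ) M, Nrm β g M → ∃ w w1 w2, XB β w w1 w2 (C * M) (C * M) ∧ Solves q b lam g w w1 w2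

lemma patch (h0 : 0 < β) (h1 : β ≤ 1 / 2) {q : ℝ → E → (E →L[ℝ] E →L[ℝ] ℝ) →L[ℝ] ℝ} {b : ℝ → E → (E →L[ℝ] ℝ) →L[ℝ] ℝ}
    {P : ℝ} (hq : Nrm β q P) (hb : Nrm β b P) {qk : κ → ℝ → E → (E →L[ℝ] E →L[ℝ] ℝ) →L[ℝ] ℝ}
    (hs : ∀ k, ∃ C, 0 ≤ C ∧ Slv β (qk k) C)
    {η ηt : κ → ℝ → E → ℝ} {η1 : κ → ℝ → E → E →L[ℝ] ℝ} {η2 : κ → ℝ → E → E →L[ℝ] E →L[ℝ] ℝ}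
    (hη : ∀ k, ∃ N, Cut β (η k) (η1 k) (η2 k) (ηt k) N) (h1s : ∀ t x, ∑ k, η k t x = 1)
    (hqk : ∀ k t x, η k t x ≠ 0 → qk k t x = q t x) :
    ∃ lam C, 1 ≤ lam ∧ 0 ≤ C ∧ Sol β q b lam C := by
  choose Ck hCk hs using hs
  choose Nk hη using hη
  set C := ∑ k, Ck k
  set N := ∑ k, Nk k
  have hC : 0 ≤ C := Finset.sum_nonneg fun k _ => hCk k
  have hs : ∀ k, Slv β (qk k) C := fun k => (hs k).mono (Finset.single_le_sum (fun k _ => hCk k) (Finset.mem_univ k))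
  have hNk : ∀ k, 0 ≤ Nk k := fun k => (hη k).n0.nonneg
  have hN : 0 ≤ N := Finset.sum_nonneg fun k _ => hNk k
  have hη : ∀ k, Cut β (η k) (η1 k) (η2 k) (ηt k) N := fun k => by
    have h := Finset.single_le_sum (fun k _ => hNk k) (Finset.mem_univ k)
    exact ⟨(hη k).n0.mono h, (hη k).n1.mono h, (hη k).n2.mono h, (hη k).nt.mono h, (hη k).d1, (hη k).d2, (hη k).dt⟩
  have hP := hq.nonneg
  set D := Fintype.card κ * N * (2 + 24 * P) * C + 1 with hD
  have hD1 : 1 ≤ D := by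
    have : 0 ≤ Fintype.card κ * N * (2 + 24 * P) * C := by positivity
    linarith
  set ε := 1 / (12 * D) with hε
  have hε0 : 0 < ε := by positivity
  have hε1 : ε ≤ 1 := by rw [hε, div_le_one (by linarith)]; linarith
  set lam := 16 * D / ε ^ 3 + 1 with hlam
  have hl1 : 1 ≤ lam := by
    have : 0 ≤ 16 * D / ε ^ 3 := by positivity
    linarith
  have hl0 : 0 < lam := by linarith
  set m0 := 3 * ε * C + 4 * (C / lam) / ε ^ 3 with hm0
  have hm0n : 0 ≤ m0 := by positivity
  have key : Fintype.card κ * (N * m0 * (2 + 24 * P)) ≤ 1 / 2 := by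
    have e1 : Fintype.card κ * (N * m0 * (2 + 24 * P)) = (D - 1) * (3 * ε + 4 / (lam * ε ^ 3)) := by
      rw [hm0, hD]; field_simp; ring
    have e2 : 3 * ε * D = 1 / 4 := by rw [hε]; field_simp; norm_num
    have e3 : 4 / (lam * ε ^ 3) * D ≤ 1 / 4 := by
      have : lam * ε ^ 3 = 16 * D + ε ^ 3 := by rw [hlam]; field_simp
      rw [this, div_mul_eq_mul_div, div_le_div_iff₀ (by positivity) (by norm_num)]
      nlinarith [pow_pos hε0 3]
    have e4 : 0 ≤ 4 / (lam * ε ^ 3) := by positivity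
    rw [e1]; nlinarith
  set A := Fintype.card κ * (N * (C / lam)) with hA
  set B := Fintype.card κ * (2 * N * C + 6 * N * m0) with hB
  have hA0 : 0 ≤ A := by positivity
  have hB0 : 0 ≤ B := by positivity
  have := neumann (lam := lam) (a := A) (C := B) hq hb (fun g M hg => by
    have hM := hg.nonneg
    choose w w1 w2 hX hS using fun k => hs k lam hl1 g M hg
    have hi : ∀ k, Nrm β (w k) (m0 * M) ∧ Nrm β (w1 k) (m0 * M) := fun k => by
      have := (hX k).interp h0 h1 hε0 hε1
      have e : 3 * ε * (C * M) + 4 * (C * M / lam) / ε ^ 3 = m0 * M := by rw [hm0]; ring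
      rw [e] at this; exact this
    have hz0 : Nrm β (fun (_ : ℝ) (_ : E) => (0 : (E →L[ℝ] ℝ) →L[ℝ] ℝ)) P := Nrm.zero.mono hP
    refine ⟨_, _, _, fun t x => - ∑ k, cutErr (η k) (w k) (ηt k) (η1 k) (w1 k) (η2 k) q b (fun _ _ => 0) t x,
      (XB.sum fun k => (hX k).cut (hη k) (hi k).1 (hi k).2).mono (le_of_eq (by rw [hA]; ring)) (le_of_eq (by rw [hB]; ring)),
      ((Nrm.sum Finset.univ fun k _ => cutErr_nrm (hη k) (hi k).1 (hi k).2 hq hb hz0).neg).mono ?_, ?_⟩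
    · simp only [Finset.sum_const, Finset.card_univ, nsmul_eq_mul]
      calc _ = Fintype.card κ * (N * m0 * (2 + 24 * P)) * M := by ring
        _ ≤ 1 / 2 * M := by gcongr
        _ = _ := by ring
    · have hsol := fun k => (hη k).solves (b := b) (b' := fun _ _ => 0) (lam := lam) (g := g) (q := q) (w := w k) (w1 := w1 k) (w2 := w2 k) trivial
        (fun t ht x hx => by
          have := hS k t ht x
          rwa [hqk k t x hx] at this)
        (fun t ht x hx => by
          refine (((hη k).dt t x).mul (hS k t ht x)).congr_deriv ?_
          rw [hx]; ring)
      intro t ht x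
      refine (HasDerivAt.fun_sum fun k (_ : k ∈ Finset.univ) => hsol k t ht x).congr_deriv ?_
      simp only [Finset.sum_add_distrib, Finset.sum_sub_distrib, ← map_sum, ← Finset.mul_sum, ← Finset.sum_mul, h1s]
      simp only [map_add, map_sum, Finset.sum_add_distrib]
      ring)
  refine ⟨lam, 2 * A + 2 * B, hl1, by positivity, fun g M hg => ?_⟩
  have hM := hg.nonneg
  obtain ⟨w, w1, w2, hX, hS⟩ := this g M hg
  exact ⟨w, w1, w2, hX.mono (by nlinarith [mul_nonneg hA0 hM, mul_nonneg hB0 hM]) (by nlinarith [mul_nonneg hA0 hM, mul_nonneg hB0 hM]), hS⟩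
end patch

section pou
open scoped Manifold ContDiff

lemma pou_exists {V : Type} [NormedAddCommGroup V] [NormedSpace ℝ V] [FiniteDimensional ℝ V] {κ : Type} [Fintype κ]
    {K : Set V} (hK : IsClosed K) (U : κ → Set V) (ho : ∀ k, IsOpen (U k)) (hb : ∀ k, Bornology.IsBounded (U k)) (hU : K ⊆ ⋃ k, U k) :
    ∃ ρ : κ → V → ℝ, (∀ k, ContDiff ℝ ∞ (ρ k)) ∧ (∀ k, HasCompactSupport (ρ k)) ∧ (∀ k x, ρ k x ≠ 0 → x ∈ U k) ∧
      ∀ x ∈ K, ∑ k, ρ k x = 1 := by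
  obtain ⟨f, hf⟩ := SmoothPartitionOfUnity.exists_isSubordinate 𝓘(ℝ, V) hK U ho hU
  refine ⟨fun k => f k, fun k => (f k).contMDiff.contDiff, fun k => ?_, fun k x hx => hf k (subset_tsupport _ hx), fun x hx => ?_⟩
  · exact Metric.isCompact_of_isClosed_isBounded (isClosed_tsupport _) ((hb k).subset (hf k))
  · rw [← f.sum_eq_one hx, finsum_eq_sum_of_fintype]

variable {E : Type} [NormedAddCommGroup E] [NormedSpace ℝ E] {F : Type} [NormedAddCommGroup F] [NormedSpace ℝ F] {β : ℝ}

lemma Nrm.of_smooth (h0 : 0 < β) (h1 : β ≤ 1) {g : ℝ × E → F} (hg : ContDiff ℝ 1 g) (hc : HasCompactSupport g) :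
    ∃ M, Nrm β (fun t x => g (t, x)) M := by
  obtain ⟨C, hC⟩ := hg.lipschitzWith_of_hasCompactSupport hc (by norm_num)
  obtain ⟨B, hB⟩ := hc.exists_bound_of_continuous hg.continuous
  refine ⟨2 * max B C, Nrm.of_lip h0 h1 hg.continuous (fun t x => (hB _).trans (le_max_left _ _)) fun t x y => ?_⟩
  have := hC.norm_sub_le (t, x) (t, y)
  have e : ‖((t, x) : ℝ × E) - (t, y)‖ = ‖x - y‖ := by simp [Prod.norm_def]
  rw [e] at this
  exact this.trans (by gcongr; exact le_max_right _ _)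

lemma Cut.of_smooth (h0 : 0 < β) (h1 : β ≤ 1) {χ : ℝ × E → ℝ} (hg : ContDiff ℝ ∞ χ) (hc : HasCompactSupport χ) :
    ∃ η1 η2 ηt N, Cut β (fun t x => χ (t, x)) η1 η2 ηt N := by
  set R : (ℝ × E →L[ℝ] ℝ) →L[ℝ] (E →L[ℝ] ℝ) := (ContinuousLinearMap.compL ℝ E (ℝ × E) ℝ).flip (ContinuousLinearMap.inr ℝ ℝ E) with hR
  set R2 : (ℝ × E →L[ℝ] (E →L[ℝ] ℝ)) →L[ℝ] (E →L[ℝ] E →L[ℝ] ℝ) :=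
    (ContinuousLinearMap.compL ℝ E (ℝ × E) (E →L[ℝ] ℝ)).flip (ContinuousLinearMap.inr ℝ ℝ E) with hR2
  set T : (ℝ × E →L[ℝ] ℝ) →L[ℝ] ℝ := ContinuousLinearMap.apply ℝ ℝ ((1 : ℝ), (0 : E)) with hT
  have s1 : ContDiff ℝ ∞ (fderiv ℝ χ) := hg.fderiv_right (by exact_mod_cast le_top)
  have c1 := hc.fderiv ℝ
  have s2 : ContDiff ℝ ∞ (fun p => R (fderiv ℝ χ p)) := R.contDiff.comp s1
  have c2 : HasCompactSupport (fun p => R (fderiv ℝ χ p)) := c1.comp_left (map_zero R)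
  have s3 : ContDiff ℝ ∞ (fderiv ℝ fun p => R (fderiv ℝ χ p)) := s2.fderiv_right (by exact_mod_cast le_top)
  have c3 := c2.fderiv ℝ
  have s4 : ContDiff ℝ ∞ (fun p => R2 (fderiv ℝ (fun p => R (fderiv ℝ χ p)) p)) := R2.contDiff.comp s3
  have c4 : HasCompactSupport (fun p => R2 (fderiv ℝ (fun p => R (fderiv ℝ χ p)) p)) := c3.comp_left (map_zero R2)
  have s5 : ContDiff ℝ ∞ (fun p => T (fderiv ℝ χ p)) := T.contDiff.comp s1
  have c5 : HasCompactSupport (fun p => T (fderiv ℝ χ p)) := c1.comp_left (map_zero T)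
  have one : (1 : WithTop ℕ∞) ≤ ∞ := by exact_mod_cast le_top
  obtain ⟨M0, n0⟩ := Nrm.of_smooth h0 h1 (hg.of_le one) hc
  obtain ⟨M1, n1⟩ := Nrm.of_smooth h0 h1 (s2.of_le one) c2
  obtain ⟨M2, n2⟩ := Nrm.of_smooth h0 h1 (s4.of_le one) c4
  obtain ⟨M3, n3⟩ := Nrm.of_smooth h0 h1 (s5.of_le one) c5
  have p0 := n0.nonneg
  have p1 := n1.nonneg
  have p2 := n2.nonneg
  have p3 := n3.nonneg
  have hd : ∀ t x, HasFDerivAt (fun y : E => ((t, y) : ℝ × E)) (ContinuousLinearMap.inr ℝ ℝ E) x := fun t x => hasFDerivAt_prodMk_right t x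
  refine ⟨_, _, _, M0 + M1 + M2 + M3, n0.mono (by linarith), n1.mono (by linarith), n2.mono (by linarith), n3.mono (by linarith), fun t x => ?_, fun t x => ?_, fun t x => ?_⟩
  · exact ((hg.differentiable (by simp)) (t, x)).hasFDerivAt.comp x (hd t x)
  · exact ((s2.differentiable (by simp)) (t, x)).hasFDerivAt.comp x (hd t x)
  · exact ((hg.differentiable (by simp)) (t, x)).hasFDerivAt.comp_hasDerivAt t ((hasDerivAt_id t).prodMk (hasDerivAt_const t x))

lemma Cut.one_sub {η ηt : ℝ → E → ℝ} {η1 : ℝ → E → E →L[ℝ] ℝ} {η2 : ℝ → E → E →L[ℝ] E →L[ℝ] ℝ} {N : ℝ} (h : Cut β η η1 η2 ηt N) :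
    Cut β (fun t x => 1 - η t x) (fun t x => - η1 t x) (fun t x => - η2 t x) (fun t x => - ηt t x) (1 + N) := by
  refine ⟨((Nrm.const (1 : ℝ)).sub h.n0).mono (by simp), h.n1.neg.mono (by simp), h.n2.neg.mono (by simp), h.nt.neg.mono (by simp), fun t x => ?_, fun t x => ?_, fun t x => ?_⟩
  · exact (h.d1 t x).const_sub 1
  · exact (h.d2 t x).neg
  · exact (h.dt t x).const_sub 1

/-- lowering the Hölder exponent -/
lemma Nrm.lower {g : ℝ → E → F} {M α : ℝ} (h : Nrm α g M) (h0 : 0 ≤ β) (h1 : β ≤ α) : Nrm β g (2 * M) := by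
  have hM := h.nonneg
  refine ⟨h.cont, fun t x => (h.bd t x).trans (by linarith), fun t x y => ?_⟩
  rcases le_total ‖x - y‖ 1 with h' | h'
  · have : ‖x - y‖ ^ α ≤ ‖x - y‖ ^ β := Real.rpow_le_rpow_of_exponent_ge' (norm_nonneg (x - y)) h' h0 h1
    calc _ ≤ M * ‖x - y‖ ^ α := h.hol t x y
      _ ≤ M * ‖x - y‖ ^ β := by gcongr
      _ ≤ _ := by
        have : 0 ≤ M * ‖x - y‖ ^ β := by positivity
        linarith
  · have : 1 ≤ ‖x - y‖ ^ β := Real.one_le_rpow h' h0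
    calc _ ≤ ‖g t x‖ + ‖g t y‖ := norm_sub_le _ _
      _ ≤ 2 * M * 1 := by linarith [h.bd t x, h.bd t y]
      _ ≤ _ := by gcongr

/-- clamping -/
def clampε (ε r : ℝ) : ℝ := max (-ε) (min ε r)

lemma clampε_eq {ε r : ℝ} (h : |r| ≤ ε) : clampε ε r = r := by
  rw [abs_le] at h; simp [clampε, h.1, h.2]

lemma Nrm.clamp {a : ℝ → E → ℝ} {M ε : ℝ} (h : Nrm (2 * β) a M) (hε : 0 ≤ ε) (c : ℝ) :
    Nrm β (fun t x => clampε ε (a t x - c)) (ε + Real.sqrt (2 * ε * M)) := by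
  have hM := h.nonneg
  have hb : ∀ r, |clampε ε r| ≤ ε := fun r => by
    rw [abs_le]; exact ⟨le_max_left _ _, max_le (by linarith) (min_le_left _ _)⟩
  have hl : ∀ r s, |clampε ε r - clampε ε s| ≤ |r - s| := fun r s => by
    refine (abs_max_sub_max_le_max _ _ _ _).trans ?_
    rw [sub_self, abs_zero, max_eq_right (abs_nonneg _)]
    refine (abs_min_sub_min_le_max _ _ _ _).trans ?_
    rw [sub_self, abs_zero, max_eq_right (abs_nonneg _)]
  refine ⟨?_, fun t x => (hb _).trans (by linarith [Real.sqrt_nonneg (2 * ε * M)]), fun t x y => ?_⟩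
  · have := h.cont
    unfold clampε; fun_prop
  · set D := |clampε ε (a t x - c) - clampε ε (a t y - c)|
    have e1 : D ≤ 2 * ε := (abs_sub _ _).trans (by linarith [hb (a t x - c), hb (a t y - c)])
    have e2 : D ≤ M * ‖x - y‖ ^ (2 * β) := (hl _ _).trans (by
      have := h.hol t x y
      rw [Real.norm_eq_abs] at this
      simpa using this)
    have e3 : D ^ 2 ≤ (2 * ε * M) * (‖x - y‖ ^ β) ^ 2 := by
      have : (‖x - y‖ ^ β) ^ 2 = ‖x - y‖ ^ (2 * β) := by
        rw [← Real.rpow_natCast, ← Real.rpow_mul (norm_nonneg _)]; congr 1; push_cast; ring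
      rw [this]
      calc D ^ 2 = D * D := sq D
        _ ≤ (2 * ε) * (M * ‖x - y‖ ^ (2 * β)) := mul_le_mul e1 e2 (abs_nonneg _) (by linarith)
        _ = _ := by ring
    have hr : 0 ≤ ‖x - y‖ ^ β := by positivity
    have e4 : D ≤ Real.sqrt (2 * ε * M) * ‖x - y‖ ^ β := by
      refine abs_le_of_sq_le_sq (a := D) ?_ (by positivity) |> (le_abs_self D).trans
      rw [mul_pow, Real.sq_sqrt (by positivity)]; exact e3
    rw [Real.norm_eq_abs]
    refine e4.trans ?_
    nlinarith [mul_nonneg hε hr]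
end pou

section ent
open scoped ContDiff Topology
variable {d : ℕ}

/-- standard basis -/
def eb (i : Fin d) : Euc d := EuclideanSpace.single i (1 : ℝ)

def evL (i j : Fin d) : (Euc d →L[ℝ] Euc d →L[ℝ] ℝ) →L[ℝ] ℝ :=
  (ContinuousLinearMap.apply ℝ ℝ (eb j)).comp (ContinuousLinearMap.apply ℝ (Euc d →L[ℝ] ℝ) (eb i))

def qOf (A : Fin d → Fin d → ℝ) : (Euc d →L[ℝ] Euc d →L[ℝ] ℝ) →L[ℝ] ℝ := ∑ i, ∑ j, A i j • evL i j

def bOf (b : Fin d → ℝ) : (Euc d →L[ℝ] ℝ) →L[ℝ] ℝ := ∑ i, b i • ContinuousLinearMap.apply ℝ ℝ (eb i)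

lemma qOf_apply (A : Fin d → Fin d → ℝ) (H) : qOf A H = ∑ i, ∑ j, A i j * H (eb i) (eb j) := by
  simp [qOf, evL, ContinuousLinearMap.sum_apply]

lemma bOf_apply (b : Fin d → ℝ) (H) : bOf b H = ∑ i, b i * H (eb i) := by
  simp [bOf, ContinuousLinearMap.sum_apply]

def KE (d : ℕ) : ℝ := ∑ i : Fin d, ∑ j : Fin d, ‖evL i j‖
def KB (d : ℕ) : ℝ := ∑ i : Fin d, ‖ContinuousLinearMap.apply ℝ ℝ (eb i)‖

lemma Nrm.qOf {β M : ℝ} {A : ℝ → Euc d → Fin d → Fin d → ℝ} (h : ∀ i j, Nrm β (fun t x => A t x i j) M) :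
    Nrm β (fun t x => qOf (A t x)) (KE d * M) := by
  have := Nrm.sum Finset.univ fun i (_ : i ∈ Finset.univ) => Nrm.sum Finset.univ fun j (_ : j ∈ Finset.univ) =>
    (h i j).clm (ContinuousLinearMap.toSpanSingleton ℝ (evL i j))
  refine (this.mono (le_of_eq ?_)).congr fun t x => ?_
  · simp only [ContinuousLinearMap.norm_toSpanSingleton, KE, Finset.sum_mul]
  · simp [_root_.qOf]

lemma Nrm.bOf {β M : ℝ} {b : ℝ → Euc d → Fin d → ℝ} (h : ∀ i, Nrm β (fun t x => b t x i) M) :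
    Nrm β (fun t x => bOf (b t x)) (KB d * M) := by
  have := Nrm.sum Finset.univ fun i (_ : i ∈ Finset.univ) =>
    (h i).clm (ContinuousLinearMap.toSpanSingleton ℝ (ContinuousLinearMap.apply ℝ ℝ (eb i)))
  refine (this.mono (le_of_eq ?_)).congr fun t x => ?_
  · simp only [ContinuousLinearMap.norm_toSpanSingleton, KB, Finset.sum_mul]
  · simp [_root_.bOf]

/-- symmetric positive definite -/
def SPD (A : Fin d → Fin d → ℝ) : Prop := (∀ i j, A i j = A j i) ∧ ∀ ξ : Fin d → ℝ, ξ ≠ 0 → 0 < ∑ i, ∑ j, A i j * ξ i * ξ j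

open scoped MatrixOrder in
lemma SPD.factor {A : Fin d → Fin d → ℝ} (h : SPD A) :
    ∃ L : Euc d ≃L[ℝ] Euc d, qOf A = qL (EuclideanSpace.basisFun (Fin d) ℝ) (L : Euc d →L[ℝ] Euc d) := by
  have hP : (Matrix.of A).PosDef := by
    refine Matrix.PosDef.of_dotProduct_mulVec_pos (by ext i j; simp [h.1 i j]) fun ξ hξ => ?_
    have := h.2 ξ hξ
    simp only [dotProduct, Matrix.mulVec, Pi.star_apply, star_trivial, Matrix.of_apply, Finset.mul_sum]
    refine this.trans_eq (Finset.sum_congr rfl fun i _ => Finset.sum_congr rfl fun j _ => by ring)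
  obtain ⟨B, hB, hAB⟩ := CStarAlgebra.isStrictlyPositive_iff_eq_star_mul_self.mp hP.isStrictlyPositive
  have hBt : IsUnit B.transpose := Matrix.isUnit_transpose B |>.2 hB
  have hinj : Function.Injective (Matrix.toEuclideanLin B.transpose) := by
    intro x y hxy
    have h2 := Matrix.mulVec_injective_of_isUnit hBt
    have : x.ofLp = y.ofLp := h2 (by
      have := congrArg WithLp.ofLp hxy
      simpa [Matrix.toEuclideanLin_apply] using this)
    exact WithLp.ofLp_injective 2 this
  refine ⟨(LinearEquiv.ofInjectiveEndo _ hinj).toContinuousLinearEquiv, ?_⟩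
  ext H
  rw [qOf_apply, qL_apply]
  have hL : ∀ k, (((LinearEquiv.ofInjectiveEndo _ hinj).toContinuousLinearEquiv : Euc d ≃L[ℝ] Euc d) : Euc d →L[ℝ] Euc d) (EuclideanSpace.basisFun (Fin d) ℝ k)
      = ∑ i, B k i • eb i := by
    intro k
    ext i
    simp [eb, Matrix.toEuclideanLin_apply, Finset.sum_apply, PiLp.single_apply, Pi.single_apply]
  have hA : ∀ i j, A i j = ∑ k, B k i * B k j := fun i j => by
    have := congrFun (congrFun hAB i) j
    simpa [Matrix.mul_apply, Matrix.star_apply] using this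
  have hR : ∀ k, H (∑ i, B k i • eb i) (∑ i, B k i • eb i) = ∑ i, ∑ j, B k i * B k j * H (eb i) (eb j) := fun k => by
    simp only [map_sum, map_smul, ContinuousLinearMap.sum_apply, ContinuousLinearMap.smul_apply, smul_eq_mul, Finset.mul_sum]
    rw [Finset.sum_comm]
    exact Finset.sum_congr rfl fun i _ => Finset.sum_congr rfl fun j _ => by ring
  simp only [hL, hR, hA, Finset.sum_mul]
  rw [Finset.sum_comm]
  symm
  rw [Finset.sum_comm]
  rw [Finset.sum_comm]
  calc _ = ∑ i, ∑ k, ∑ j, B k i * B k j * H (eb i) (eb j) := Finset.sum_comm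
    _ = ∑ i, ∑ j, ∑ k, B k i * B k j * H (eb i) (eb j) := Finset.sum_congr rfl fun i _ => Finset.sum_comm
    _ = _ := Finset.sum_comm

lemma SPD.solver {A : Fin d → Fin d → ℝ} (h : SPD A) {β : ℝ} (hβ : 0 < β) (hβ1 : β < 1) :
    ∃ C, 0 ≤ C ∧ Slv β (fun _ _ => qOf A) C := by
  obtain ⟨L, hL⟩ := h.factor
  rw [hL]; exact const_solver _ L hβ hβ1

lemma SPD.pos {A : Fin d → Fin d → ℝ} (h : SPD A) {H : Euc d →L[ℝ] Euc d →L[ℝ] ℝ} (hH : ∀ ξ, H ξ ξ ≤ 0) : qOf A H ≤ 0 := by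
  obtain ⟨L, hL⟩ := h.factor
  rw [hL, qL_apply]; exact Finset.sum_nonpos fun i _ => hH _

def idm (i j : Fin d) : ℝ := if i = j then 1 else 0

lemma idm_spd : SPD (idm (d := d)) := by
  refine ⟨fun i j => by simp [idm, eq_comm], fun ξ hξ => ?_⟩
  have : ∑ i, ∑ j, idm i j * ξ i * ξ j = ∑ i, ξ i * ξ i := by
    refine Finset.sum_congr rfl fun i _ => ?_
    simp [idm]
  rw [this]
  obtain ⟨i, hi⟩ := Function.ne_iff.1 hξ
  exact Finset.sum_pos' (fun i _ => mul_self_nonneg _) ⟨i, Finset.mem_univ _, mul_self_pos.2 hi⟩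

lemma ent_solver {β M Mb : ℝ} (h0 : 0 < β) (h1 : β ≤ 1 / 2) {A : ℝ → Euc d → Fin d → Fin d → ℝ} {b : ℝ → Euc d → Fin d → ℝ}
    (hA : ∀ i j, Nrm (2 * β) (fun t x => A t x i j) M) (hM : 0 ≤ M) (hspd : ∀ t x, SPD (A t x)) {K : Set (ℝ × Euc d)} (hK : IsCompact K)
    (hKA : ∀ t x, (t, x) ∉ K → A t x = idm) (hb : ∀ i, Nrm β (fun t x => b t x i) Mb) (hMb : 0 ≤ Mb) :
    ∃ lam C, 1 ≤ lam ∧ 0 ≤ C ∧ Sol β (fun t x => qOf (A t x)) (fun t x => bOf (b t x)) lam C := by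
  have hβ1 : β < 1 := by linarith
  choose C hC hS using fun p : ℝ × Euc d => (hspd p.1 p.2).solver h0 hβ1
  have hε : ∀ p, ∃ ε, 0 < ε ∧ 4 * (KE d * (ε + Real.sqrt (2 * ε * M))) * C p ≤ 1 := fun p => by
    have hc : Tendsto (fun ε : ℝ => 4 * (KE d * (ε + Real.sqrt (2 * ε * M))) * C p) (𝓝[>] 0) (𝓝 0) := by
      have : Continuous (fun ε : ℝ => 4 * (KE d * (ε + Real.sqrt (2 * ε * M))) * C p) := by fun_prop
      have := this.tendsto 0
      simp only [mul_zero, zero_mul, Real.sqrt_zero, add_zero] at this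
      exact this.mono_left nhdsWithin_le_nhds
    obtain ⟨ε, h, h'⟩ := ((hc.eventually_le_const zero_lt_one).and self_mem_nhdsWithin).exists
    exact ⟨ε, h', h⟩
  choose ε hε0 hε using hε
  set U : ℝ × Euc d → Set (ℝ × Euc d) := fun p => (⋂ i, ⋂ j, {r | |A r.1 r.2 i j - A p.1 p.2 i j| < ε p}) ∩ Metric.ball p 1 with hU
  have hUo : ∀ p, IsOpen (U p) := fun p => by
    refine (isOpen_iInter_of_finite fun i => isOpen_iInter_of_finite fun j => ?_).inter Metric.isOpen_ball
    exact isOpen_lt ((hA i j).cont.sub continuous_const).abs continuous_const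
  obtain ⟨T, hT⟩ := hK.elim_finite_subcover U hUo (fun p hp => mem_iUnion.2 ⟨p, by simp [hU, hε0]⟩)
  obtain ⟨ρ, hρs, hρc, hρU, hρ1⟩ := pou_exists hK.isClosed (fun k : T => U k) (fun k => hUo k)
    (fun k => Metric.isBounded_ball.subset inter_subset_right) (by
      refine hT.trans fun p hp => ?_
      simp only [mem_iUnion] at hp ⊢
      obtain ⟨k, hk, h⟩ := hp
      exact ⟨⟨k, hk⟩, h⟩)
  choose r1 r2 rt N hr using fun k => Cut.of_smooth h0 hβ1.le (hρs k) (hρc k)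
  obtain ⟨s1, s2, st, N', hs⟩ := Cut.of_smooth h0 hβ1.le (χ := fun p => ∑ k, ρ k p) (ContDiff.sum fun k _ => hρs k) (by
    refine HasCompactSupport.intro (isCompact_iUnion fun k => hρc k) fun x hx => Finset.sum_eq_zero fun k _ => ?_
    simp only [mem_iUnion, not_exists] at hx
    exact image_eq_zero_of_notMem_tsupport (hx k))
  set P := KE d * (2 * M) + KB d * Mb
  have hKE : 0 ≤ KE d := by unfold KE; positivity
  have hKB : 0 ≤ KB d := by unfold KB; positivity
  have hqn : Nrm β (fun t x => qOf (A t x)) P :=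
    (Nrm.qOf fun i j => (hA i j).lower h0.le (by linarith)).mono (by simp only [P]; nlinarith)
  have hbn : Nrm β (fun t x => bOf (b t x)) P := (Nrm.bOf hb).mono (by simp only [P]; nlinarith [mul_nonneg hKE hM])
  refine patch (κ := Option T) h0 h1 hqn hbn
    (qk := fun k => k.elim (fun _ _ => qOf idm) fun k t x => qOf fun i j => A k.1.1 k.1.2 i j + clampε (ε k) (A t x i j - A k.1.1 k.1.2 i j))
    (η := fun k => k.elim (fun t x => 1 - ∑ k, ρ k (t, x)) fun k t x => ρ k (t, x))
    (η1 := fun k => k.elim (fun t x => - s1 t x) r1) (η2 := fun k => k.elim (fun t x => - s2 t x) r2)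
    (ηt := fun k => k.elim (fun t x => - st t x) rt) ?_ ?_ ?_ ?_
  · rintro (_ | k)
    · exact idm_spd.solver h0 hβ1
    · refine ⟨2 * C k, by have := hC k; positivity, perturb (hC k) (hS k) (hε k) ?_⟩
      refine (Nrm.qOf fun i j => (hA i j).clamp (hε0 k).le (A k.1.1 k.1.2 i j)).congr fun t x => ?_
      ext H
      simp [qOf_apply, add_mul, Finset.sum_add_distrib]
  · rintro (_ | k)
    · exact ⟨_, hs.one_sub⟩
    · exact ⟨_, hr k⟩
  · intro t x
    simp [Fintype.sum_option]
  · rintro (_ | k) t x hx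
    · have : (t, x) ∉ K := fun h => hx (sub_eq_zero.2 (hρ1 _ h).symm)
      simp [hKA t x this]
    · have := (hρU k _ hx).1
      simp only [mem_iInter, mem_setOf_eq] at this
      simp only [Option.elim]
      congr 1
      funext i j
      rw [clampε_eq (this i j).le]; ring

end ent

section maxp
open scoped Topology
variable {E : Type} [NormedAddCommGroup E] [NormedSpace ℝ E]

lemma snd_deriv_test {f : E → ℝ} {f1 : E → E →L[ℝ] ℝ} {f2 : E →L[ℝ] E →L[ℝ] ℝ} {x : E} (hm : IsLocalMax f x)
    (d1 : ∀ᶠ y in 𝓝 x, HasFDerivAt f (f1 y) y) (d2 : HasFDerivAt f1 f2 x) : f1 x = 0 ∧ ∀ ξ, f2 ξ ξ ≤ 0 := by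
  refine ⟨hm.hasFDerivAt_eq_zero d1.self_of_nhds, fun ξ => ?_⟩
  by_contra! hpos
  set l : ℝ → E := fun r => x + r • ξ with hl
  have hl0 : l 0 = x := by simp [hl]
  have hlc : Tendsto l (𝓝 0) (𝓝 x) := by
    have : Continuous l := by fun_prop
    simpa [hl0] using this.tendsto 0
  have hld : ∀ r, HasDerivAt l ξ r := fun r => by
    exact (((hasDerivAt_id r).smul_const ξ).const_add x).congr_deriv (one_smul ℝ ξ)
  have e1 : ∀ᶠ r in 𝓝 (0 : ℝ), HasDerivAt (f ∘ l) (f1 (l r) ξ) r := by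
    filter_upwards [hlc.eventually d1] with r hr
    exact hr.comp_hasDerivAt r (hld r)
  have e1' : deriv (f ∘ l) =ᶠ[𝓝 0] fun r => f1 (l r) ξ := e1.mono fun r hr => hr.deriv
  have e2 : HasDerivAt (fun r => f1 (l r) ξ) (f2 ξ ξ) 0 := by
    have := (hl0 ▸ d2 : HasFDerivAt f1 f2 (l 0)).comp_hasDerivAt 0 (hld 0)
    exact (ContinuousLinearMap.apply ℝ ℝ ξ).hasFDerivAt.comp_hasDerivAt 0 this
  have e3 : deriv (deriv (f ∘ l)) 0 = f2 ξ ξ := (e2.congr_of_eventuallyEq e1').deriv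
  have hmax : IsLocalMax (f ∘ l) 0 := by
    have : ∀ᶠ y in 𝓝 x, f y ≤ f x := hm
    filter_upwards [hlc.eventually this] with r hr
    simpa [hl0] using hr
  have hmin : IsLocalMin (f ∘ l) 0 := isLocalMin_of_deriv_deriv_pos (by rw [e3]; exact hpos) hmax.deriv_eq_zero
    e1.self_of_nhds.continuousAt
  have hconst : (f ∘ l) =ᶠ[𝓝 0] fun _ => (f ∘ l) 0 := by
    filter_upwards [hmax, hmin] with r h1 h2 using le_antisymm h1 h2
  have : deriv (deriv (f ∘ l)) 0 = 0 := by
    rw [hconst.deriv.deriv_eq]; simp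
  linarith

lemma maxp_core [FiniteDimensional ℝ E] {z zt : ℝ → E → ℝ} {z1 : ℝ → E → E →L[ℝ] ℝ} {z2 : ℝ → E → E →L[ℝ] E →L[ℝ] ℝ} {T ρ : ℝ}
    (hc : Continuous (fun p : ℝ × E => z p.1 p.2))
    (d1 : ∀ t ∈ Ioc 0 T, ∀ x ∈ Metric.ball (0 : E) ρ, HasFDerivAt (z t) (z1 t x) x)
    (d2 : ∀ t ∈ Ioc 0 T, ∀ x ∈ Metric.ball (0 : E) ρ, HasFDerivAt (z1 t) (z2 t x) x)
    (dt : ∀ t ∈ Ioc 0 T, ∀ x ∈ Metric.ball (0 : E) ρ, HasDerivAt (fun τ => z τ x) (zt t x) t)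
    (hneg : ∀ t ∈ Ioc 0 T, ∀ x ∈ Metric.ball (0 : E) ρ, 0 < z t x → z1 t x = 0 → (∀ ξ, z2 t x ξ ξ ≤ 0) → zt t x < 0)
    (h0 : ∀ x ∈ Metric.closedBall (0 : E) ρ, z 0 x ≤ 0) (hl : ∀ t ∈ Icc 0 T, ∀ x : E, ‖x‖ = ρ → z t x ≤ 0) :
    ∀ t ∈ Icc 0 T, ∀ x ∈ Metric.closedBall (0 : E) ρ, z t x ≤ 0 := by
  intro t' ht' x' hx'
  haveI : ProperSpace E := FiniteDimensional.proper_real E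
  have hK : IsCompact (Icc 0 T ×ˢ Metric.closedBall (0 : E) ρ) := isCompact_Icc.prod (isCompact_closedBall _ _)
  obtain ⟨⟨t, x⟩, ⟨ht, hx⟩, hmax⟩ := hK.exists_isMaxOn ⟨(t', x'), ht', hx'⟩ hc.continuousOn
  have hle : z t' x' ≤ z t x := hmax (show (t', x') ∈ _ from ⟨ht', hx'⟩)
  refine hle.trans ?_
  by_contra! hpos
  simp only at ht hx
  have ht0 : 0 < t := by
    rcases ht.1.eq_or_lt with h | h
    · exact absurd (h0 x hx) (by rw [← h] at hpos; exact not_le.2 hpos)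
    · exact h
  have hx0 : x ∈ Metric.ball (0 : E) ρ := by
    rw [Metric.mem_closedBall, dist_zero_right] at hx
    rw [Metric.mem_ball, dist_zero_right]
    refine lt_of_le_of_ne hx fun h => ?_
    exact absurd (hl t ht x h) (not_le.2 hpos)
  have htm : t ∈ Ioc 0 T := ⟨ht0, ht.2⟩
  have hnb : ∀ᶠ y in 𝓝 x, y ∈ Metric.ball (0 : E) ρ := Metric.isOpen_ball.mem_nhds hx0
  obtain ⟨e1, e2⟩ := snd_deriv_test (f := z t) (f1 := z1 t) (f2 := z2 t x) (x := x)
    (by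
      filter_upwards [hnb] with y hy
      exact hmax (show (t, y) ∈ _ from ⟨ht, Metric.ball_subset_closedBall hy⟩))
    (by
      filter_upwards [hnb] with y hy
      exact d1 t htm y hy) (d2 t htm x hx0)
  have hlt := hneg t htm x hx0 hpos e1 e2
  have hd := (dt t htm x hx0).hasDerivWithinAt (s := Iic t)
  have h3 : 0 ≤ zt t x := by
    refine ge_of_tendsto (hasDerivWithinAt_iff_tendsto_slope' (s := Iio t) (by simp) |>.1 ((dt t htm x hx0).hasDerivWithinAt)) ?_
    have : ∀ᶠ τ in 𝓝[<] t, 0 < τ := mem_nhdsWithin_of_mem_nhds (Ioi_mem_nhds ht0)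
    filter_upwards [this, self_mem_nhdsWithin] with τ h1 h2
    have h2' : τ < t := h2
    have h4 : z τ x ≤ z t x := hmax (show (τ, x) ∈ _ from ⟨⟨h1.le, h2'.le.trans ht.2⟩, hx⟩)
    rw [slope_def_field]
    exact div_nonneg_of_nonpos (by linarith) (by linarith)
  linarith

/-- ellipticity (weak) -/
def PosOp (q : (E →L[ℝ] E →L[ℝ] ℝ) →L[ℝ] ℝ) : Prop := ∀ H, (∀ ξ, H ξ ξ ≤ 0) → q H ≤ 0

lemma maxp_lyap [FiniteDimensional ℝ E] {v vt : ℝ → E → ℝ} {v1 : ℝ → E → E →L[ℝ] ℝ} {v2 : ℝ → E → E →L[ℝ] E →L[ℝ] ℝ} {T ρ K m : ℝ}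
    {q : ℝ → E → (E →L[ℝ] E →L[ℝ] ℝ) →L[ℝ] ℝ} {b : ℝ → E → (E →L[ℝ] ℝ) →L[ℝ] ℝ} {φ : E → ℝ} {φ1 : E → E →L[ℝ] ℝ} {φ2 : E → E →L[ℝ] E →L[ℝ] ℝ}
    (hc : Continuous (fun p : ℝ × E => v p.1 p.2))
    (d1 : ∀ t x, HasFDerivAt (v t) (v1 t x) x)
    (d2 : ∀ t x, HasFDerivAt (v1 t) (v2 t x) x)
    (dt : ∀ t ∈ Ioc 0 T, ∀ x ∈ Metric.ball (0 : E) ρ, HasDerivAt (fun τ => v τ x) (vt t x) t)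
    (hq : ∀ t ∈ Ioc 0 T, ∀ x ∈ Metric.ball (0 : E) ρ, PosOp (q t x))
    (hv : ∀ t ∈ Ioc 0 T, ∀ x ∈ Metric.ball (0 : E) ρ, vt t x ≤ q t x (v2 t x) + b t x (v1 t x))
    (hφ1 : ∀ x, HasFDerivAt φ (φ1 x) x) (hφ2 : ∀ x, HasFDerivAt φ1 (φ2 x) x) (hφ : ∀ x, 0 < φ x) (hK : 0 ≤ K) (hm : 0 ≤ m)
    (hL : ∀ t ∈ Ioc 0 T, ∀ x ∈ Metric.ball (0 : E) ρ, q t x (φ2 x) + b t x (φ1 x) ≤ K * φ x)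
    (h0 : ∀ x ∈ Metric.closedBall (0 : E) ρ, v 0 x ≤ m * φ x) (hl : ∀ t ∈ Icc 0 T, ∀ x : E, ‖x‖ = ρ → v t x ≤ m * φ x) :
    ∀ t ∈ Icc 0 T, ∀ x ∈ Metric.closedBall (0 : E) ρ, v t x ≤ m * Real.exp ((K + 1) * t) * φ x := by
  have hφc : Continuous φ := continuous_iff_continuousAt.2 fun x => (hφ1 x).continuousAt
  have key := maxp_core (T := T) (ρ := ρ) (z := fun t x => Real.exp (-(K + 1) * t) * v t x - m * φ x)
    (zt := fun t x => Real.exp (-(K + 1) * t) * (-(K + 1)) * v t x + Real.exp (-(K + 1) * t) * vt t x)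
    (z1 := fun t x => Real.exp (-(K + 1) * t) • v1 t x - m • φ1 x)
    (z2 := fun t x => Real.exp (-(K + 1) * t) • v2 t x - m • φ2 x)
    (by fun_prop)
    (fun t ht x hx => ((d1 t x).const_mul _).sub ((hφ1 x).const_mul _))
    (fun t ht x hx => ((d2 t x).fun_const_smul _).fun_sub ((hφ2 x).fun_const_smul _))
    (fun t ht x hx => by
      have h1 : HasDerivAt (fun τ : ℝ => Real.exp (-(K + 1) * τ)) (Real.exp (-(K + 1) * t) * (-(K + 1))) t := by
        simpa using ((hasDerivAt_id t).const_mul (-(K + 1))).exp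
      exact (h1.mul (dt t ht x hx)).sub_const _)
    (fun t ht x hx hz hz1 hz2 => by
      have a1 := hq t ht x hx _ hz2
      have a2 : b t x (Real.exp (-(K + 1) * t) • v1 t x - m • φ1 x) = 0 := by rw [hz1, map_zero]
      simp only [map_sub, map_smul, smul_eq_mul] at a1 a2
      have a3 := mul_le_mul_of_nonneg_left (hv t ht x hx) (Real.exp_pos (-(K + 1) * t)).le
      have a4 := mul_le_mul_of_nonneg_left (hL t ht x hx) hm
      have a5 := mul_nonneg hm (hφ x).le
      have a6 := mul_nonneg hK hz.le
      nlinarith)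
    (fun x hx => by simpa using h0 x hx)
    (fun t ht x hx => by
      have h1 := hl t ht x hx
      have h2 : Real.exp (-(K + 1) * t) ≤ 1 := Real.exp_le_one_iff.2 (by nlinarith [ht.1])
      have h3 := mul_nonneg hm (hφ x).le
      have h4 := (Real.exp_pos (-(K + 1) * t))
      nlinarith)
  intro t ht x hx
  have h := key t ht x hx
  have e : Real.exp ((K + 1) * t) * Real.exp (-(K + 1) * t) = 1 := by rw [← Real.exp_add, Real.exp_eq_one_iff]; ring
  have := mul_le_mul_of_nonneg_left (sub_nonpos.1 h) (Real.exp_pos ((K + 1) * t)).le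
  rw [← mul_assoc, e, one_mul] at this
  linarith

end maxp
section glob
open scoped Topology
variable {E : Type} [NormedAddCommGroup E] [InnerProductSpace ℝ E] [FiniteDimensional ℝ E]

/-- global maximum principle, bounded coefficients -/
lemma maxp_global {v vt : ℝ → E → ℝ} {v1 : ℝ → E → E →L[ℝ] ℝ} {v2 : ℝ → E → E →L[ℝ] E →L[ℝ] ℝ} {T P B : ℝ}
    {q : ℝ → E → (E →L[ℝ] E →L[ℝ] ℝ) →L[ℝ] ℝ} {b : ℝ → E → (E →L[ℝ] ℝ) →L[ℝ] ℝ}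
    (hc : Continuous (fun p : ℝ × E => v p.1 p.2))
    (d1 : ∀ t x, HasFDerivAt (v t) (v1 t x) x)
    (d2 : ∀ t x, HasFDerivAt (v1 t) (v2 t x) x)
    (dt : ∀ t, 0 < t → ∀ x, HasDerivAt (fun τ => v τ x) (vt t x) t)
    (hq : ∀ t x, PosOp (q t x)) (hqP : ∀ t x, ‖q t x‖ ≤ P) (hbP : ∀ t x, ‖b t x‖ ≤ P)
    (hv : ∀ t, 0 < t → ∀ x, vt t x ≤ q t x (v2 t x) + b t x (v1 t x))
    (hB : ∀ t ∈ Icc 0 T, ∀ x, v t x ≤ B) (h0 : ∀ x, v 0 x ≤ 0) :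
    ∀ t ∈ Icc 0 T, ∀ x, v t x ≤ 0 := by
  intro t ht x
  have hP : 0 ≤ P := (norm_nonneg _).trans (hqP 0 0)
  set S : E →L[ℝ] E →L[ℝ] ℝ := innerSL ℝ with hS
  set K := P * ‖(2 : ℝ) • S‖ + P * (2 * ‖S‖) with hK
  have hK0 : 0 ≤ K := by positivity
  have hφ1 : ∀ x : E, HasFDerivAt (fun x : E => 1 + ‖x‖ ^ 2) ((2 : ℝ) • S x) x := fun x => by
    have := (hasStrictFDerivAt_norm_sq x).hasFDerivAt.const_add 1
    refine this.congr_fderiv ?_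
    ext y; simp [hS, two_smul]; rfl
  have hφ2 : ∀ x : E, HasFDerivAt (fun x : E => (2 : ℝ) • S x) ((2 : ℝ) • S) x := fun x => ((2 : ℝ) • S).hasFDerivAt
  have hL : ∀ t x, q t x ((2 : ℝ) • S) + b t x ((2 : ℝ) • S x) ≤ K * (1 + ‖x‖ ^ 2) := fun t x => by
    have a1 : q t x ((2 : ℝ) • S) ≤ P * ‖(2 : ℝ) • S‖ := (le_abs_self _).trans (((q t x).le_opNorm _).trans (by gcongr; exact hqP t x))
    have a2 : b t x ((2 : ℝ) • S x) ≤ P * (2 * ‖S‖ * ‖x‖) := by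
      refine (le_abs_self _).trans (((b t x).le_opNorm _).trans (mul_le_mul (hbP t x) ?_ (norm_nonneg _) hP))
      rw [norm_smul, mul_assoc]; simp; exact S.le_opNorm x
    have a3 : ‖x‖ ≤ 1 + ‖x‖ ^ 2 := by nlinarith [sq_nonneg (‖x‖ - 1), norm_nonneg x]
    have a4 : P * (2 * ‖S‖ * ‖x‖) ≤ P * (2 * ‖S‖) * (1 + ‖x‖ ^ 2) := by
      calc _ = P * (2 * ‖S‖) * ‖x‖ := by ring
        _ ≤ _ := by gcongr
    have a5 : 0 ≤ P * ‖(2 : ℝ) • S‖ := by positivity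
    rw [hK]; nlinarith [sq_nonneg ‖x‖]
  have key : ∀ ε > 0, v t x ≤ ε * (Real.exp ((K + 1) * t) * (1 + ‖x‖ ^ 2)) := by
    intro ε hε
    set ρ := |B| / ε + ‖x‖ + 1 with hρ
    have hBε : 0 ≤ |B| / ε := by positivity
    have := maxp_lyap (T := T) (ρ := ρ) (K := K) (m := ε) (φ := fun x : E => 1 + ‖x‖ ^ 2) hc d1 d2 (fun t ht x _ => dt t ht.1 x)
      (fun t _ x _ => hq t x) (fun t ht x _ => hv t ht.1 x) hφ1 hφ2 (fun x => by positivity) hK0 hε.le (fun t _ x _ => hL t x)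
      (fun x _ => (h0 x).trans (by positivity)) (fun t ht y hy => by
        refine (hB t ht y).trans ?_
        rw [hy]
        have h1 : |B| / ε ≤ ρ := by rw [hρ]; linarith [norm_nonneg x]
        have h2 : |B| ≤ ε * ρ := by rw [div_le_iff₀ hε] at h1; linarith
        have h3 : ρ ≤ 1 + ρ ^ 2 := by nlinarith [sq_nonneg (ρ - 1)]
        nlinarith [le_abs_self B]) t ht x (by simp [hρ]; linarith)
    linarith
  have hlim : Tendsto (fun ε : ℝ => ε * (Real.exp ((K + 1) * t) * (1 + ‖x‖ ^ 2))) (𝓝[>] 0) (𝓝 0) := by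
    have : Continuous (fun ε : ℝ => ε * (Real.exp ((K + 1) * t) * (1 + ‖x‖ ^ 2))) := by fun_prop
    simpa using (this.tendsto 0).mono_left nhdsWithin_le_nhds
  exact ge_of_tendsto hlim (by filter_upwards [self_mem_nhdsWithin] with ε hε using key ε hε)
end glob

section inter
open scoped Topology
variable {E : Type} [NormedAddCommGroup E] [InnerProductSpace ℝ E] [FiniteDimensional ℝ E] [MeasurableSpace E] [BorelSpace E]
variable {β lam C P a M : ℝ} {q : ℝ → E → (E →L[ℝ] E →L[ℝ] ℝ) →L[ℝ] ℝ} {b : ℝ → E → (E →L[ℝ] ℝ) →L[ℝ] ℝ}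

lemma XB.comp_max {w : ℝ → E → ℝ} {w1 : ℝ → E → E →L[ℝ] ℝ} {w2 : ℝ → E → E →L[ℝ] E →L[ℝ] ℝ} (h : XB β w w1 w2 a M) :
    XB β (fun t x => w (max t 0) x) (fun t x => w1 (max t 0) x) (fun t x => w2 (max t 0) x) a M := by
  have hm : Continuous fun t : ℝ => max t 0 := by fun_prop
  refine ⟨h.cont.comp (f := fun p : ℝ × E => (max p.1 0, p.2)) (by fun_prop), fun t x => h.sup _ _, h.n1.comp_time hm, h.n2.comp_time hm,
    fun t x => h.d1 _ x, fun t x => h.d2 _ x, fun x => by simp [h.init]⟩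

lemma XB.transfer {w : ℝ → E → ℝ} {w1 w1' : ℝ → E → E →L[ℝ] ℝ} {w2 w2' : ℝ → E → E →L[ℝ] E →L[ℝ] ℝ} {a' M' : ℝ}
    (h : XB β w w1 w2 a M) (h' : XB β w w1' w2' a' M') : w1 = w1' ∧ w2 = w2' := by
  have e1 : w1 = w1' := by funext t x; exact (h.d1 t x).unique (h'.d1 t x)
  refine ⟨e1, ?_⟩
  funext t x
  exact (h.d2 t x).unique (e1 ▸ h'.d2 t x)

lemma uniq_le (hq : Nrm β q P) (hb : Nrm β b P) (hpos : ∀ t x, PosOp (q t x))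
    {w w' g : ℝ → E → ℝ} {w1 w1' : ℝ → E → E →L[ℝ] ℝ} {w2 w2' : ℝ → E → E →L[ℝ] E →L[ℝ] ℝ} {a' M' : ℝ}
    (hw : XB β w w1 w2 a M) (hw' : XB β w' w1' w2' a' M') (hs : Solves q b lam g w w1 w2) (hs' : Solves q b lam g w' w1' w2')
    (t : ℝ) (ht : 0 ≤ t) (x : E) : w t x ≤ w' t x := by
  have c1 := hw.cont
  have c2 := hw'.cont
  have := maxp_global (T := t) (P := P) (B := Real.exp (|lam| * t) * (a + a')) (v := fun t x => Real.exp (lam * t) * (w t x - w' t x))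
    (v1 := fun t x => Real.exp (lam * t) • (w1 t x - w1' t x)) (v2 := fun t x => Real.exp (lam * t) • (w2 t x - w2' t x))
    (vt := fun t x => q t x (Real.exp (lam * t) • (w2 t x - w2' t x)) + b t x (Real.exp (lam * t) • (w1 t x - w1' t x)))
    (q := q) (b := b) (by fun_prop) (fun t x => ((hw.d1 t x).sub (hw'.d1 t x)).const_mul _)
    (fun t x => ((hw.d2 t x).fun_sub (hw'.d2 t x)).fun_const_smul _) (fun t ht x => by
      have h1 : HasDerivAt (fun τ : ℝ => Real.exp (lam * τ)) (Real.exp (lam * t) * lam) t := by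
        simpa using ((hasDerivAt_id t).const_mul lam).exp
      refine (h1.fun_mul ((hs t ht x).fun_sub (hs' t ht x))).congr_deriv ?_
      simp only [map_smul, map_sub, smul_eq_mul]
      ring) hpos hq.bd hb.bd (fun t ht x => le_rfl) (fun τ hτ x => by
      have e1 : w τ x - w' τ x ≤ a + a' := by
        have h1 := abs_le.1 (hw.sup τ x)
        have h2 := abs_le.1 (hw'.sup τ x)
        linarith
      have e2 : 0 ≤ a + a' := by
        have h1 := (abs_nonneg _).trans (hw.sup τ x)
        have h2 := (abs_nonneg _).trans (hw'.sup τ x)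
        linarith
      have e3 : Real.exp (lam * τ) ≤ Real.exp (|lam| * t) := Real.exp_le_exp.2 (by
        have h1 := mul_le_mul_of_nonneg_right (le_abs_self lam) hτ.1
        have h2 := mul_le_mul_of_nonneg_left hτ.2 (abs_nonneg lam)
        linarith)
      calc _ ≤ Real.exp (lam * τ) * (a + a') := by gcongr
        _ ≤ _ := by gcongr) (fun x => by simp [hw.init, hw'.init]) t ⟨ht, le_rfl⟩ x
  by_contra! h
  have h3 := mul_pos (Real.exp_pos (lam * t)) (sub_pos.2 h)
  exact absurd this (not_le.2 h3)

lemma uniq_bound (hSol : Sol β q b lam C) (hq : Nrm β q P) (hb : Nrm β b P) (hpos : ∀ t x, PosOp (q t x))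
    {w g : ℝ → E → ℝ} {w1 : ℝ → E → E →L[ℝ] ℝ} {w2 : ℝ → E → E →L[ℝ] E →L[ℝ] ℝ} {G : ℝ}
    (hw : XB β w w1 w2 a M) (hw0 : ∀ t ≤ 0, ∀ x, w t x = 0) (hs : Solves q b lam g w w1 w2) (hg : Nrm β g G) :
    XB β w w1 w2 a (C * G) := by
  obtain ⟨w', w1', w2', hX, hS⟩ := hSol g G hg
  have e : w = fun t x => w' (max t 0) x := by
    funext t x
    rcases le_total t 0 with h | h
    · rw [max_eq_right h, hX.init, hw0 t h]
    · rw [max_eq_left h]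
      exact le_antisymm (uniq_le hq hb hpos hw hX hs hS t h x) (uniq_le hq hb hpos hX hw hS hs t h x)
  have hX' := hX.comp_max
  rw [← e] at hX'
  obtain ⟨h1, h2⟩ := hX'.transfer hw
  rw [h1, h2] at hX'
  exact ⟨hw.cont, hw.sup, hX'.n1, hX'.n2, hw.d1, hw.d2, hw.init⟩

lemma int_step (h0 : 0 < β) (h1 : β ≤ 1 / 2) (hSol : Sol β q b lam C) (hq : Nrm β q P) (hb : Nrm β b P) (hpos : ∀ t x, PosOp (q t x))
    {η ηt η' ηt' : ℝ → E → ℝ} {η1 η1' : ℝ → E → E →L[ℝ] ℝ} {η2 η2' : ℝ → E → E →L[ℝ] E →L[ℝ] ℝ} {N N' : ℝ}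
    (hη : Cut β η η1 η2 ηt N) (hη' : Cut β η' η1' η2' ηt' N') (hηη : ∀ t x, η t x ≠ 0 → η' t x = 1)
    {v : ℝ → E → ℝ} {v1 : ℝ → E → E →L[ℝ] ℝ} {v2 : ℝ → E → E →L[ℝ] E →L[ℝ] ℝ} {a0 M0 : ℝ}
    (hv : XB β v v1 v2 a0 M0) (hv0 : ∀ t ≤ 0, ∀ x, v t x = 0) (hvt : ∀ t, 0 < t → ∀ x, DifferentiableAt ℝ (fun τ => v τ x) t)
    (heq : ∀ t, 0 < t → ∀ x, η t x ≠ 0 → HasDerivAt (fun τ => v τ x) (q t x (v2 t x) + b t x (v1 t x) - lam * v t x) t)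
    (ha : ∀ t x, |η t x * v t x| ≤ a)
    (hX : ∃ W1 W2, XB β (fun t x => η' t x * v t x) W1 W2 a M) {ε : ℝ} (hε : 0 < ε) (hε1 : ε ≤ 1) :
    ∃ W1 W2, XB β (fun t x => η t x * v t x) W1 W2 a (C * (N * (3 * ε * M + 4 * a / ε ^ 3) * (2 + 24 * P))) := by
  obtain ⟨W1, W2, hX⟩ := hX
  obtain ⟨m0, m1⟩ := hX.interp h0 h1 hε hε1
  have e0 : (fun t x => η t x * (η' t x * v t x)) = fun t x => η t x * v t x := by
    funext t x
    by_cases h : η t x = 0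
    · simp [h]
    · rw [hηη t x h, one_mul]
  have hev : ∀ t x, η t x ≠ 0 → ∀ᶠ y in 𝓝 x, η' t y = 1 := fun t x h => by
    have hc : Continuous fun y => η t y := hη.n0.cont.comp (f := fun y => (t, y)) (by fun_prop)
    exact (hc.continuousAt.eventually_ne h).mono fun y hy => hηη t y hy
  have hev1 : ∀ t x, η t x ≠ 0 → W1 t x = v1 t x := fun t x h => by
    refine (hX.d1 t x).unique ((hv.d1 t x).congr_of_eventuallyEq ?_)
    filter_upwards [hev t x h] with y hy
    rw [hy, one_mul]
  have hev2 : ∀ t x, η t x ≠ 0 → W2 t x = v2 t x := fun t x h => by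
    refine (hX.d2 t x).unique ((hv.d2 t x).congr_of_eventuallyEq ?_)
    have hc : Continuous fun y => η t y := hη.n0.cont.comp (f := fun y => (t, y)) (by fun_prop)
    filter_upwards [hc.continuousAt.eventually_ne h] with y hy using hev1 t y hy
  have hcut := hX.cut hη m0 m1
  have hsol := hη.solves (q := q) (b := b) (b' := b) (lam := lam) (g := fun _ _ => 0) (w := fun t x => η' t x * v t x) (w1 := W1) (w2 := W2) trivial
    (fun t ht x h => by
      have hc : Continuous fun τ => η τ x := hη.n0.cont.comp (f := fun τ => (τ, x)) (by fun_prop)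
      have e : (fun τ => η' τ x * v τ x) =ᶠ[𝓝 t] fun τ => v τ x := by
        filter_upwards [hc.continuousAt.eventually_ne h] with y hy
        rw [hηη y x hy, one_mul]
      refine ((heq t ht x h).congr_of_eventuallyEq e).congr_deriv ?_
      rw [hev1 t x h, hev2 t x h, hηη t x h]; ring)
    (fun t ht x h => by
      refine ((hη.dt t x).fun_mul ((hη'.dt t x).fun_mul (hvt t ht x).hasDerivAt)).congr_deriv ?_
      rw [h]; ring)
  have hG := cutErr_nrm hη m0 m1 hq hb hb
  have hcut' : XB β (fun t x => η t x * (η' t x * v t x)) _ _ a _ :=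
    ⟨hcut.cont, fun t x => by rw [congrFun (congrFun e0 t) x]; exact ha t x, hcut.n1, hcut.n2, hcut.d1, hcut.d2, hcut.init⟩
  have := uniq_bound hSol hq hb hpos hcut' (fun t ht x => by simp [hv0 t ht x]) hsol (hG.congr fun t x => by simp)
  rw [e0] at this
  exact ⟨_, _, this⟩

lemma int_iter {X : ℕ → ℝ → Prop} (hmono : ∀ j M M', X j M → M ≤ M' → X j M') {K a M1 : ℝ} (hK : 1 ≤ K) (ha : 0 ≤ a)
    (hstep : ∀ j M ε, 0 < ε → ε ≤ 1 → X (j + 1) M → X j (K * 8 ^ j * (ε * M + a / ε ^ 3))) (hpri : ∀ j, X j (M1 * 8 ^ j)) :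
    ∀ δ > 0, X 0 (2 * (K ^ 4 * 8192 ^ 3) * a + δ) := by
  have h1 : ∀ j M, X (j + 1) M → X j (M / 8192 + (K ^ 4 * 8192 ^ 3) * 4096 ^ j * a) := by
    intro j M h
    have h8 : (1 : ℝ) ≤ 8 ^ j := one_le_pow₀ (by norm_num)
    have := hstep j M (1 / (8192 * K * 8 ^ j)) (by positivity) (by
      rw [div_le_one (by positivity)]; nlinarith) h
    refine hmono _ _ _ this (le_of_eq ?_)
    have e : (4096 : ℝ) ^ j = (8 ^ j) ^ 4 := by rw [← pow_mul, mul_comm, pow_mul]; norm_num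
    rw [e]
    field_simp
  have h2 : ∀ J M, X J M → X 0 (M / 8192 ^ J + (K ^ 4 * 8192 ^ 3) * a * ∑ j ∈ Finset.range J, (1 / 2 : ℝ) ^ j) := by
    intro J
    induction J with
    | zero => intro M h; simpa using h
    | succ J ih =>
      intro M h
      refine hmono _ _ _ (ih _ (h1 J M h)) (le_of_eq ?_)
      rw [Finset.sum_range_succ, add_div, pow_succ]
      have e : (4096 : ℝ) ^ J / 8192 ^ J = (1 / 2) ^ J := by rw [← div_pow]; norm_num
      rw [← e]; field_simp; ring
  intro δ hδ
  have hlim : Tendsto (fun J : ℕ => M1 * (1 / 1024 : ℝ) ^ J) atTop (𝓝 0) := by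
    simpa using (tendsto_pow_atTop_nhds_zero_of_lt_one (by norm_num : (0 : ℝ) ≤ 1 / 1024) (by norm_num)).const_mul M1
  obtain ⟨J, hJ⟩ := (hlim.eventually_le_const hδ).exists
  refine hmono _ _ _ (h2 J _ (hpri J)) ?_
  have e : M1 * 8 ^ J / 8192 ^ J = M1 * (1 / 1024 : ℝ) ^ J := by rw [mul_div_assoc, ← div_pow]; norm_num
  have e2 : ∑ j ∈ Finset.range J, (1 / 2 : ℝ) ^ j ≤ 2 := by
    refine (Summable.sum_le_tsum _ (fun _ _ => by positivity) summable_geometric_two).trans ?_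
    rw [tsum_geometric_two]
  rw [e]
  have : (K ^ 4 * 8192 ^ 3) * a * ∑ j ∈ Finset.range J, (1 / 2 : ℝ) ^ j ≤ (K ^ 4 * 8192 ^ 3) * a * 2 := by gcongr
  linarith

end inter

section interior
open scoped Topology ContDiff

abbrev sT : ℝ → ℝ := Real.smoothTransition

lemma sT_smooth : ContDiff ℝ ∞ sT := Real.smoothTransition.contDiff

lemma sT_d1 : ContDiff ℝ ∞ (deriv sT) := by
  have := sT_smooth
  rw [contDiff_infty_iff_deriv] at this
  exact this.2

lemma sT_d2 : ContDiff ℝ ∞ (deriv (deriv sT)) := by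
  have := sT_d1
  rw [contDiff_infty_iff_deriv] at this
  exact this.2

lemma sT_hcs : HasCompactSupport (deriv sT) := by
  refine HasCompactSupport.intro (isCompact_Icc (a := (0:ℝ)) (b := 1)) fun x hx => ?_
  have : x < 0 ∨ 1 < x := by
    by_contra! h
    exact hx h
  rcases this with h | h
  · have e : sT =ᶠ[𝓝 x] fun _ => 0 := by
      filter_upwards [Iio_mem_nhds h] with y hy using Real.smoothTransition.zero_of_nonpos (le_of_lt hy)
    rw [e.deriv_eq, deriv_const]
  · have e : sT =ᶠ[𝓝 x] fun _ => 1 := by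
      filter_upwards [Ioi_mem_nhds h] with y hy using Real.smoothTransition.one_of_one_le (le_of_lt hy)
    rw [e.deriv_eq, deriv_const]

lemma lip_of_deriv {g : ℝ → ℝ} {B : ℝ} (hg : Differentiable ℝ g) (hB : ∀ x, |deriv g x| ≤ B) (x y : ℝ) : |g x - g y| ≤ B * |x - y| := by
  have := Convex.norm_image_sub_le_of_norm_deriv_le (f := g) (s := univ) (C := B) (fun z _ => hg z) (fun z _ => hB z) convex_univ (mem_univ y) (mem_univ x)
  simpa using this

lemma sT_bounds : ∃ B : ℝ, 1 ≤ B ∧ ((∀ x, |sT x| ≤ B) ∧ ∀ x y, |sT x - sT y| ≤ B * |x - y|) ∧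
    ((∀ x, |deriv sT x| ≤ B) ∧ ∀ x y, |deriv sT x - deriv sT y| ≤ B * |x - y|) ∧
    ((∀ x, |deriv (deriv sT) x| ≤ B) ∧ ∀ x y, |deriv (deriv sT) x - deriv (deriv sT) y| ≤ B * |x - y|) := by
  obtain ⟨B1, h1⟩ := sT_hcs.exists_bound_of_continuous sT_d1.continuous
  obtain ⟨B2, h2⟩ := sT_hcs.deriv.exists_bound_of_continuous sT_d2.continuous
  have c3 : ContDiff ℝ ∞ (deriv (deriv (deriv sT))) := by
    have := sT_d2
    rw [contDiff_infty_iff_deriv] at this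
    exact this.2
  obtain ⟨B3, h3⟩ := sT_hcs.deriv.deriv.exists_bound_of_continuous c3.continuous
  have b1 : ∀ x, |deriv sT x| ≤ max 1 (max B1 (max B2 B3)) := fun x => (h1 x).trans (by simp)
  have b2 : ∀ x, |deriv (deriv sT) x| ≤ max 1 (max B1 (max B2 B3)) := fun x => (h2 x).trans (by simp)
  have b3 : ∀ x, |deriv (deriv (deriv sT)) x| ≤ max 1 (max B1 (max B2 B3)) := fun x => (h3 x).trans (by simp)
  refine ⟨max 1 (max B1 (max B2 B3)), le_max_left _ _, ⟨fun x => ?_, lip_of_deriv (sT_smooth.differentiable (by simp)) b1⟩,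
    ⟨b1, lip_of_deriv (sT_d1.differentiable (by simp)) b2⟩, ⟨b2, lip_of_deriv (sT_d2.differentiable (by simp)) b3⟩⟩
  rw [abs_of_nonneg (Real.smoothTransition.nonneg x)]
  exact (Real.smoothTransition.le_one x).trans (le_max_left _ _)

variable {E : Type} [NormedAddCommGroup E] [InnerProductSpace ℝ E] [FiniteDimensional ℝ E] [MeasurableSpace E] [BorelSpace E]
variable {β lam C P N : ℝ} {q : ℝ → E → (E →L[ℝ] E →L[ℝ] ℝ) →L[ℝ] ℝ} {b : ℝ → E → (E →L[ℝ] ℝ) →L[ℝ] ℝ}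
  {χ χt : ℝ → E → ℝ} {χ1 : ℝ → E → E →L[ℝ] ℝ} {χ2 : ℝ → E → E →L[ℝ] E →L[ℝ] ℝ}

lemma Nrm.comp_fn {φ : ℝ → ℝ} {B k : ℝ} (hB : 0 ≤ B) (hφc : Continuous φ) (hφ : (∀ x, |φ x| ≤ B) ∧ ∀ x y, |φ x - φ y| ≤ B * |x - y|)
    (hk : 1 ≤ k) (h : Nrm β χ N) : Nrm β (fun t x => φ (k * (χ t x - 1 / 2) - 1)) (k * (B * (1 + N))) := by
  have hc := h.cont
  have hN := h.nonneg
  refine ⟨by fun_prop, fun t x => (hφ.1 _).trans ?_, fun t x y => (hφ.2 _ _).trans ?_⟩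
  · have : B * 1 ≤ k * (B * (1 + N)) := by
      calc B * 1 ≤ 1 * (B * (1 + N)) := by nlinarith
        _ ≤ _ := by gcongr
    linarith
  · have e : k * (χ t x - 1 / 2) - 1 - (k * (χ t y - 1 / 2) - 1) = k * (χ t x - χ t y) := by ring
    have h2 := h.hol t x y
    rw [Real.norm_eq_abs] at h2
    rw [e, abs_mul, abs_of_nonneg (by linarith : 0 ≤ k)]
    calc B * (k * |χ t x - χ t y|) ≤ B * (k * (N * ‖x - y‖ ^ β)) := by gcongr
      _ ≤ B * (k * ((1 + N) * ‖x - y‖ ^ β)) := by gcongr; linarith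
      _ = _ := by ring

lemma Cut.comp_sT (h : Cut β χ χ1 χ2 χt N) : ∃ D : ℝ, 0 ≤ D ∧ ∀ k : ℝ, 1 ≤ k → ∃ η1 η2 ηt,
    Cut β (fun t x => sT (k * (χ t x - 1 / 2) - 1)) η1 η2 ηt (D * k ^ 3) := by
  obtain ⟨B, hB1, hb0, hb1, hb2⟩ := sT_bounds
  have hB : 0 ≤ B := by linarith
  have hN := h.n0.nonneg
  have hL : 0 ≤ B * (1 + N) := by positivity
  set L := B * (1 + N) with hLdef
  refine ⟨L + 2 * L * N + 4 * L * N * N, by positivity, fun k hk => ?_⟩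
  have hk0 : 0 ≤ k := by linarith
  have m0 := h.n0.comp_fn hB sT_smooth.continuous hb0 hk
  have m1 := h.n0.comp_fn hB sT_d1.continuous hb1 hk
  have m2 := h.n0.comp_fn hB sT_d2.continuous hb2 hk
  rw [← hLdef] at m0 m1 m2
  have p1 := m1.const_smul k
  have p2 := m2.const_smul (k * k)
  have hd1 : ∀ z, HasDerivAt sT (deriv sT z) z := fun z => (sT_smooth.differentiable (by simp) z).hasDerivAt
  have hd2 : ∀ z, HasDerivAt (deriv sT) (deriv (deriv sT) z) z := fun z => (sT_d1.differentiable (by simp) z).hasDerivAt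
  have k1 : k ≤ k ^ 3 := by nlinarith [mul_nonneg hk0 (sub_nonneg.2 hk), sq_nonneg k]
  have k2 : k * k ≤ k ^ 3 := by nlinarith [mul_nonneg hk0 (sub_nonneg.2 hk), sq_nonneg k]
  have q1 : 0 ≤ L * N := by positivity
  have q2 : 0 ≤ L * N * N := by positivity
  have r0 : k * L ≤ k ^ 3 * L := by gcongr
  have r1 : k * k * (L * N) ≤ k ^ 3 * (L * N) := by gcongr
  have r2 : 0 ≤ k ^ 3 * (L * N * N) := by positivity
  have r3 : 0 ≤ k ^ 3 * L := by positivity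
  have r4 : 0 ≤ k ^ 3 * (L * N) := by positivity
  have a1 : |k| = k := abs_of_nonneg hk0
  have a2 : |k * k| = k * k := abs_of_nonneg (mul_nonneg hk0 hk0)
  have n1 := p1.smul h.n1
  have n2 := (p1.smul h.n2).add ((p2.smul h.n1).smulRight h.n1)
  have nt := p1.smul h.nt
  rw [a1] at n1 n2 nt
  rw [a2] at n2
  refine ⟨_, _, _, m0.mono ?_, n1.mono ?_, n2.mono ?_, nt.mono ?_, fun t x => ?_, fun t x => ?_, fun t x => ?_⟩
  · linarith
  · linarith
  · linarith
  · linarith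
  · have := (hd1 (k * (χ t x - 1 / 2) - 1)).comp_hasFDerivAt x ((((h.d1 t x).sub_const (1 / 2)).const_mul k).sub_const 1)
    refine this.congr_fderiv ?_
    ext z
    simp only [ContinuousLinearMap.smul_apply, smul_eq_mul]; ring
  · have h3 := ((hd2 (k * (χ t x - 1 / 2) - 1)).comp_hasFDerivAt x ((((h.d1 t x).sub_const (1 / 2)).const_mul k).sub_const 1)).fun_const_smul k
    refine (h3.fun_smul (h.d2 t x)).congr_fderiv ?_
    ext z z'
    simp only [ContinuousLinearMap.smul_apply, ContinuousLinearMap.add_apply, ContinuousLinearMap.smulRight_apply, smul_eq_mul, Function.comp]; ring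
  · have := (hd1 (k * (χ t x - 1 / 2) - 1)).comp t ((((h.dt t x).sub_const (1 / 2)).const_mul k).sub_const 1)
    refine this.congr_deriv ?_
    simp only [smul_eq_mul]; ring

lemma interior_est (h0 : 0 < β) (h1 : β ≤ 1 / 2) (hSol : Sol β q b lam C) (hC : 0 ≤ C) (hq : Nrm β q P) (hb : Nrm β b P) (hpos : ∀ t x, PosOp (q t x))
    (hχ : Cut β χ χ1 χ2 χt N) : ∃ K : ℝ, 0 ≤ K ∧ ∀ (v : ℝ → E → ℝ) (v1 : ℝ → E → E →L[ℝ] ℝ) (v2 : ℝ → E → E →L[ℝ] E →L[ℝ] ℝ) (a0 M0 a : ℝ),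
    XB β v v1 v2 a0 M0 → (∀ t ≤ 0, ∀ x, v t x = 0) → (∀ t, 0 < t → ∀ x, DifferentiableAt ℝ (fun τ => v τ x) t) →
    (∀ t, 0 < t → ∀ x, 1 / 2 < χ t x → HasDerivAt (fun τ => v τ x) (q t x (v2 t x) + b t x (v1 t x) - lam * v t x) t) →
    0 ≤ a → (∀ t x, 1 / 2 < χ t x → |v t x| ≤ a) →
    ∀ t x, (∀ᶠ y in 𝓝 x, 1 ≤ χ t y) → ‖v1 t x‖ ≤ K * a ∧ ‖v2 t x‖ ≤ K * a := by
  obtain ⟨D, hD, hcut⟩ := hχ.comp_sT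
  have hP := hq.nonneg
  set K := C * (64 * D * 4 * (2 + 24 * P)) + 1 with hK
  have hK1 : 1 ≤ K := by
    have : 0 ≤ C * (64 * D * 4 * (2 + 24 * P)) := by positivity
    linarith
  refine ⟨2 * (K ^ 4 * 8192 ^ 3), by positivity, fun v v1 v2 a0 M0 a hv hv0 hvt heq ha hva => ?_⟩
  set k : ℕ → ℝ := fun j => 4 * 2 ^ j with hk
  have hk1 : ∀ j, 1 ≤ k j := fun j => by
    have : (1 : ℝ) ≤ 2 ^ j := one_le_pow₀ (by norm_num)
    simp only [hk]; linarith
  have hk3 : ∀ j, D * (k j) ^ 3 = 64 * D * 8 ^ j := fun j => by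
    have : (8 : ℝ) ^ j = (2 ^ j) ^ 3 := by rw [← pow_mul, mul_comm, pow_mul]; norm_num
    simp only [hk]; rw [this]; ring
  choose η1 η2 ηt hη using fun j => hcut (k j) (hk1 j)
  have hne : ∀ j t x, sT (k j * (χ t x - 1 / 2) - 1) ≠ 0 → 1 < k j * (χ t x - 1 / 2) := fun j t x h => by
    by_contra! h'
    exact h (Real.smoothTransition.zero_of_nonpos (by linarith))
  have hne2 : ∀ j t x, sT (k j * (χ t x - 1 / 2) - 1) ≠ 0 → 1 / 2 < χ t x := fun j t x h => by
    have h2 := hne j t x h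
    have h3 := hk1 j
    by_contra! h'
    have := mul_nonneg (by linarith : 0 ≤ k j) (sub_nonneg.2 h')
    nlinarith
  have hsup : ∀ j t x, |sT (k j * (χ t x - 1 / 2) - 1) * v t x| ≤ a := fun j t x => by
    by_cases h : sT (k j * (χ t x - 1 / 2) - 1) = 0
    · rw [h, zero_mul, abs_zero]; exact ha
    · rw [abs_mul, abs_of_nonneg (Real.smoothTransition.nonneg _)]
      have := hva t x (hne2 j t x h)
      calc _ ≤ 1 * |v t x| := by gcongr; exact Real.smoothTransition.le_one _
        _ ≤ a := by linarith
  have main := int_iter (X := fun j M => ∃ W1 W2, XB β (fun t x => sT (k j * (χ t x - 1 / 2) - 1) * v t x) W1 W2 a M)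
    (K := K) (a := a) (M1 := 64 * D * (2 * M0 + 6 * (3 * 1 * M0 + 4 * a0 / 1 ^ 3)))
    (fun j M M' ⟨W1, W2, h⟩ hM => ⟨W1, W2, h.mono le_rfl hM⟩) hK1 ha (fun j M ε hε hε1 hX => by
      obtain ⟨W1, W2, h⟩ := int_step h0 h1 hSol hq hb hpos (hη j) (hη (j + 1)) (fun t x h => by
        have := hne j t x h
        refine Real.smoothTransition.one_of_one_le ?_
        have e : k (j + 1) = 2 * k j := by simp only [hk]; ring
        rw [e]; linarith) hv hv0 hvt (fun t ht x h => heq t ht x (hne2 j t x h)) (hsup j) hX hε hε1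
      refine ⟨W1, W2, h.mono le_rfl ?_⟩
      obtain ⟨_, _, hX⟩ := hX
      have hM := hX.n1.nonneg
      rw [hk3]
      have e1 : 0 ≤ a / ε ^ 3 := by positivity
      have e2 : 0 ≤ ε * M := by positivity
      calc C * (64 * D * 8 ^ j * (3 * ε * M + 4 * a / ε ^ 3) * (2 + 24 * P))
          ≤ C * (64 * D * 8 ^ j * (4 * (ε * M + a / ε ^ 3)) * (2 + 24 * P)) := by
            gcongr
            rw [mul_div_assoc]; linarith
        _ = (K - 1) * 8 ^ j * (ε * M + a / ε ^ 3) := by rw [hK]; ring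
        _ ≤ K * 8 ^ j * (ε * M + a / ε ^ 3) := by gcongr; linarith)
    (fun j => by
      obtain ⟨m0, m1⟩ := hv.interp h0 h1 one_pos le_rfl
      have h := hv.cut (hη j) m0 m1
      refine ⟨_, _, ⟨h.cont, hsup j, h.n1.mono ?_, h.n2.mono ?_, h.d1, h.d2, h.init⟩⟩ <;> rw [hk3] <;> apply le_of_eq <;> ring)
  intro t x hx
  have key : ∀ δ > 0, ‖v1 t x‖ ≤ 2 * (K ^ 4 * 8192 ^ 3) * a + δ ∧ ‖v2 t x‖ ≤ 2 * (K ^ 4 * 8192 ^ 3) * a + δ := fun δ hδ => by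
    obtain ⟨W1, W2, h⟩ := main δ hδ
    have hone : ∀ y, 1 ≤ χ t y → sT (k 0 * (χ t y - 1 / 2) - 1) = 1 := fun y hy =>
      Real.smoothTransition.one_of_one_le (by simp only [hk]; norm_num; linarith)
    have e1 : ∀ y, (∀ᶠ z in 𝓝 y, 1 ≤ χ t z) → W1 t y = v1 t y := fun y hy => by
      refine (h.d1 t y).unique ((hv.d1 t y).congr_of_eventuallyEq ?_)
      filter_upwards [hy] with z hz
      rw [hone z hz, one_mul]
    have e2 : W2 t x = v2 t x := by
      refine (h.d2 t x).unique ((hv.d2 t x).congr_of_eventuallyEq ?_)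
      filter_upwards [hx.eventually_nhds] with z hz using e1 z hz
    rw [← e1 x hx, ← e2]
    exact ⟨h.n1.bd t x, h.n2.bd t x⟩
  exact ⟨le_of_forall_pos_le_add fun δ hδ => (key δ hδ).1, le_of_forall_pos_le_add fun δ hδ => (key δ hδ).2⟩

end interior

section approx
open scoped Topology ContDiff
variable {E : Type} [NormedAddCommGroup E] [InnerProductSpace ℝ E] [FiniteDimensional ℝ E] [MeasurableSpace E] [BorelSpace E]
variable {β lam C P F : ℝ} {q : ℝ → E → (E →L[ℝ] E →L[ℝ] ℝ) →L[ℝ] ℝ} {b : ℝ → E → (E →L[ℝ] ℝ) →L[ℝ] ℝ}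
  {f : E → ℝ} {f1 : E → E →L[ℝ] ℝ} {f2 : E → E →L[ℝ] E →L[ℝ] ℝ}

structure Apx (β : ℝ) (q : ℝ → E → (E →L[ℝ] E →L[ℝ] ℝ) →L[ℝ] ℝ) (b : ℝ → E → (E →L[ℝ] ℝ) →L[ℝ] ℝ) (f : E → ℝ) (f1 : E → E →L[ℝ] ℝ)
    (f2 : E → E →L[ℝ] E →L[ℝ] ℝ) (F : ℝ) (u : ℝ → E → ℝ) (u1 : ℝ → E → E →L[ℝ] ℝ) (u2 : ℝ → E → E →L[ℝ] E →L[ℝ] ℝ) : Prop where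
  c0 : Continuous fun p : ℝ × E => u p.1 p.2
  c1 : Continuous fun p : ℝ × E => u1 p.1 p.2
  c2 : Continuous fun p : ℝ × E => u2 p.1 p.2
  d1 : ∀ t x, HasFDerivAt (u t) (u1 t x) x
  d2 : ∀ t x, HasFDerivAt (u1 t) (u2 t x) x
  dt : ∀ t, 0 < t → ∀ x, HasDerivAt (fun τ => u τ x) (q t x (u2 t x) + b t x (u1 t x)) t
  init : ∀ t ≤ 0, ∀ x, u t x = f x
  sup : ∀ t x, |u t x| ≤ F
  X : ∀ (θ : ℝ → ℝ) (T B : ℝ), Continuous θ → (∀ t, T < t → θ t = 0) → (∀ t, |θ t| ≤ B) →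
    ∃ a M, XB β (fun t x => θ t * (u t x - f x)) (fun t x => θ t • (u1 t x - f1 x)) (fun t x => θ t • (u2 t x - f2 x)) a M

lemma XB.tmul {w : ℝ → E → ℝ} {w1 : ℝ → E → E →L[ℝ] ℝ} {w2 : ℝ → E → E →L[ℝ] E →L[ℝ] ℝ} {a M K : ℝ} (h : XB β w w1 w2 a M)
    {θ : ℝ → ℝ} (hθ : Continuous θ) (hb : ∀ t, |θ t| ≤ K) :
    XB β (fun t x => θ t * w t x) (fun t x => θ t • w1 t x) (fun t x => θ t • w2 t x) (K * a) (K * M) := by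
  have hK : 0 ≤ K := (abs_nonneg _).trans (hb 0)
  refine ⟨(hθ.comp continuous_fst).mul h.cont, fun t x => ?_, h.n1.tmul hθ hb, h.n2.tmul hθ hb, fun t x => (h.d1 t x).const_mul _,
    fun t x => (h.d2 t x).fun_const_smul _, fun x => by simp [h.init]⟩
  rw [abs_mul]; gcongr; exacts [hb t, h.sup t x]

lemma Nrm.of_space (h0 : 0 < β) (h1 : β ≤ 1) {F : Type} [NormedAddCommGroup F] [NormedSpace ℝ F] {g : E → F} (hg : ContDiff ℝ 1 g)
    (hc : HasCompactSupport g) : ∃ M, Nrm β (fun (_ : ℝ) x => g x) M := by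
  obtain ⟨C, hC⟩ := ContDiff.lipschitzWith_of_hasCompactSupport hc hg (by norm_num)
  obtain ⟨B, hB⟩ := hc.exists_bound_of_continuous hg.continuous
  refine ⟨2 * max B C, Nrm.of_lip h0 h1 (hg.continuous.comp continuous_snd) (fun t x => (hB _).trans (le_max_left _ _)) fun t x y => ?_⟩
  exact (hC.norm_sub_le x y).trans (by gcongr; exact le_max_right _ _)

lemma apx_exists (h0 : 0 < β) (h1 : β ≤ 1 / 2) (hlam : 1 ≤ lam) (hSol : Sol β q b lam C) (hq : Nrm β q P) (hb : Nrm β b P)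
    (hpos : ∀ t x, PosOp (q t x)) (hf : ContDiff ℝ ∞ f) (hfc : HasCompactSupport f) (hF : ∀ x, |f x| ≤ F) :
    ∃ u u1 u2, Apx β q b f (fderiv ℝ f) (fderiv ℝ (fderiv ℝ f)) F u u1 u2 := by
  have hf1 : ContDiff ℝ ∞ (fderiv ℝ f) := hf.fderiv_right (by simp)
  have hf2 : ContDiff ℝ ∞ (fderiv ℝ (fderiv ℝ f)) := hf1.fderiv_right (by simp)
  have D1 : ∀ x, HasFDerivAt f (fderiv ℝ f x) x := fun x => (hf.differentiable (by simp) x).hasFDerivAt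
  have D2 : ∀ x, HasFDerivAt (fderiv ℝ f) (fderiv ℝ (fderiv ℝ f) x) x := fun x => (hf1.differentiable (by simp) x).hasFDerivAt
  obtain ⟨M1, n1⟩ := Nrm.of_space h0 (by linarith) (hf1.of_le (by simp)) (hfc.fderiv ℝ)
  obtain ⟨M2, n2⟩ := Nrm.of_space h0 (by linarith) (hf2.of_le (by simp)) ((hfc.fderiv ℝ).fderiv ℝ)
  have cc0 := hf.continuous
  have cc1 := hf1.continuous
  have cc2 := hf2.continuous
  generalize fderiv ℝ (fderiv ℝ f) = f2 at *
  generalize fderiv ℝ f = f1 at *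
  have ng := ((hq.app n2).add (hb.app n1)).tmul (θ := fun t => Real.exp (-lam * max t 0)) (K := 1) (by fun_prop) (fun t => by
    rw [abs_of_pos (Real.exp_pos _)]
    refine Real.exp_le_one_iff.2 ?_
    have := mul_nonneg (by linarith : 0 ≤ lam) (le_max_right t 0)
    linarith)
  obtain ⟨w, w1, w2, hX, hS⟩ := hSol _ _ ng
  have hW := hX.comp_max
  have hcW := hW.cont
  have hcW1 := hW.n1.cont
  have hcW2 := hW.n2.cont
  have hdt : ∀ t, 0 < t → ∀ x, HasDerivAt (fun τ => f x + Real.exp (lam * max τ 0) * w (max τ 0) x)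
      (q t x (f2 x + Real.exp (lam * max t 0) • w2 (max t 0) x) + b t x (f1 x + Real.exp (lam * max t 0) • w1 (max t 0) x)) t := by
    intro t ht x
    have h1 : HasDerivAt (fun τ : ℝ => Real.exp (lam * τ)) (Real.exp (lam * t) * lam) t := by
      simpa using ((hasDerivAt_id t).const_mul lam).exp
    have h2 := (h1.fun_mul (hS t ht x)).const_add (f x)
    have e : (fun τ => f x + Real.exp (lam * max τ 0) * w (max τ 0) x) =ᶠ[𝓝 t] fun τ => f x + Real.exp (lam * τ) * w τ x := by
      filter_upwards [Ioi_mem_nhds ht] with τ hτ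
      rw [max_eq_left (le_of_lt hτ)]
    refine (h2.congr_of_eventuallyEq e).congr_deriv ?_
    have e2 : Real.exp (lam * t) * Real.exp (-lam * t) = 1 := by rw [← Real.exp_add]; simp
    simp only [map_add, map_smul, smul_eq_mul, max_eq_left ht.le]
    linear_combination (q t x (f2 x) + b t x (f1 x)) * e2
  refine ⟨fun t x => f x + Real.exp (lam * max t 0) * w (max t 0) x, fun t x => f1 x + Real.exp (lam * max t 0) • w1 (max t 0) x,
    fun t x => f2 x + Real.exp (lam * max t 0) • w2 (max t 0) x, ?_⟩
  have hce : Continuous fun p : ℝ × E => Real.exp (lam * max p.1 0) := by fun_prop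
  have hc0 : Continuous fun p : ℝ × E => f p.2 + Real.exp (lam * max p.1 0) * w (max p.1 0) p.2 := (cc0.comp continuous_snd).add (hce.mul hcW)
  have hd1 : ∀ (t : ℝ) x, HasFDerivAt (fun x => f x + Real.exp (lam * max t 0) * w (max t 0) x) (f1 x + Real.exp (lam * max t 0) • w1 (max t 0) x) x :=
    fun t x => (D1 x).fun_add ((hW.d1 t x).const_mul _)
  have hd2 : ∀ (t : ℝ) x, HasFDerivAt (fun x => f1 x + Real.exp (lam * max t 0) • w1 (max t 0) x) (f2 x + Real.exp (lam * max t 0) • w2 (max t 0) x) x :=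
    fun t x => (D2 x).fun_add ((hW.d2 t x).fun_const_smul _)
  have hinit : ∀ t ≤ (0:ℝ), ∀ x, f x + Real.exp (lam * max t 0) * w (max t 0) x = f x := fun t ht x => by
    rw [max_eq_right ht, hX.init]; simp
  refine ⟨hc0, (cc1.comp continuous_snd).add (hce.smul hcW1), (cc2.comp continuous_snd).add (hce.smul hcW2), hd1, hd2, hdt, hinit, fun t x => ?_, fun θ T B hθ hT hB => ?_⟩
  · rcases le_total t 0 with ht | ht
    · rw [hinit t ht]; exact hF x
    have key : ∀ σ : ℝ, |σ| = 1 → σ * (f x + Real.exp (lam * max t 0) * w (max t 0) x) - F ≤ 0 := fun σ hσ => by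
      have hσf : ∀ y, σ * f y ≤ F := fun y => by
        have h1 := le_abs_self (σ * f y)
        rw [abs_mul, hσ, one_mul] at h1
        exact h1.trans (hF y)
      refine maxp_global (T := t) (P := P) (B := Real.exp (lam * t) * (C * (1 * (2 * P * M2 + 2 * P * M1))))
        (v := fun t x => σ * (f x + Real.exp (lam * max t 0) * w (max t 0) x) - F)
        (v1 := fun t x => σ • (f1 x + Real.exp (lam * max t 0) • w1 (max t 0) x)) (v2 := fun t x => σ • (f2 x + Real.exp (lam * max t 0) • w2 (max t 0) x))
        (q := q) (b := b) (by fun_prop) (fun t x => ((hd1 t x).const_mul σ).sub_const F) (fun t x => (hd2 t x).fun_const_smul σ)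
        (fun t ht x => ((hdt t ht x).const_mul σ).sub_const F) hpos hq.bd hb.bd (fun t ht x => le_of_eq ?_) (fun τ hτ y => ?_) (fun y => ?_) t ⟨ht, le_rfl⟩ x
      · simp only [map_smul, smul_eq_mul]; ring
      · rw [max_eq_left hτ.1]
        have e1 : σ * w τ y ≤ C * (1 * (2 * P * M2 + 2 * P * M1)) := by
          have h1 := le_abs_self (σ * w τ y)
          rw [abs_mul, hσ, one_mul] at h1
          exact h1.trans (hX.sup τ y)
        have e2 : 0 ≤ C * (1 * (2 * P * M2 + 2 * P * M1)) := (abs_nonneg _).trans (hX.sup τ y)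
        have e3 : Real.exp (lam * τ) ≤ Real.exp (lam * t) := Real.exp_le_exp.2 (mul_le_mul_of_nonneg_left hτ.2 (by linarith))
        have e4 : Real.exp (lam * τ) * (σ * w τ y) ≤ Real.exp (lam * t) * (C * (1 * (2 * P * M2 + 2 * P * M1))) := by
          calc _ ≤ Real.exp (lam * τ) * (C * (1 * (2 * P * M2 + 2 * P * M1))) := by gcongr
            _ ≤ _ := by gcongr
        have := hσf y
        linarith
      · have := hσf y
        show σ * (f y + Real.exp (lam * max 0 0) * w (max 0 0) y) - F ≤ 0
        rw [hinit 0 le_rfl]; linarith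
    have k1 := key 1 (by simp)
    have k2 := key (-1) (by simp)
    exact abs_le.2 ⟨by linarith, by linarith⟩
  · have hB0 : 0 ≤ B := (abs_nonneg _).trans (hB 0)
    have := hW.tmul (θ := fun t => θ t * Real.exp (lam * max t 0)) (K := B * Real.exp (lam * max T 0)) (by fun_prop) (fun t => by
      rw [abs_mul, abs_of_pos (Real.exp_pos _)]
      rcases lt_or_ge T t with h | h
      · rw [hT t h]; simp; positivity
      · gcongr
        exact hB t)
    refine ⟨B * Real.exp (lam * max T 0) * (C * (1 * (2 * P * M2 + 2 * P * M1))), B * Real.exp (lam * max T 0) * (C * (1 * (2 * P * M2 + 2 * P * M1))), ?_⟩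
    simp only [add_sub_cancel_left, smul_smul, ← mul_assoc] at this ⊢
    exact this

end approx

section trunc
open scoped Topology ContDiff
variable {d : ℕ} {α β : ℝ}

def bmp (d n : ℕ) : ContDiffBump (0 : ℝ × Euc d) := ⟨n + 1, n + 2, by positivity, by linarith⟩

lemma bmp_smooth (n : ℕ) : ContDiff ℝ ∞ (bmp d n) := (bmp d n).contDiff

lemma bmp_one {n : ℕ} {p : ℝ × Euc d} (h : ‖p‖ ≤ n + 1) : bmp d n p = 1 :=
  (bmp d n).one_of_mem_closedBall (by rw [mem_closedBall_zero_iff]; exact h)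

lemma bmp_zero {n : ℕ} {p : ℝ × Euc d} (h : (n : ℝ) + 2 ≤ ‖p‖) : bmp d n p = 0 :=
  (bmp d n).zero_of_le_dist (by rw [dist_zero_right]; exact h)

structure LocH (α : ℝ) (g : ℝ → Euc d → ℝ) : Prop where
  cont : Continuous fun p : ℝ × Euc d => g p.1 p.2
  hol : ∀ R : ℝ, ∃ C : ℝ, 0 ≤ C ∧ ∀ t x y, ‖((t, x) : ℝ × Euc d)‖ ≤ R → ‖((t, y) : ℝ × Euc d)‖ ≤ R → |g t x - g t y| ≤ C * ‖x - y‖ ^ α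

lemma LocH.sub_const {g : ℝ → Euc d → ℝ} (h : LocH α g) (c : ℝ) : LocH α (fun t x => g t x - c) :=
  ⟨h.cont.sub continuous_const, fun R => by simpa using h.hol R⟩

lemma LocH.cut {g : ℝ → Euc d → ℝ} (h0 : 0 < α) (h1 : α ≤ 1) (h : LocH α g) (n : ℕ) : ∃ M, Nrm α (fun t x => bmp d n (t, x) * g t x) M := by
  obtain ⟨N, hN⟩ := Nrm.of_smooth h0 h1 ((bmp_smooth (d := d) n).of_le (by simp)) (bmp d n).hasCompactSupport
  obtain ⟨C, hC, hol⟩ := h.hol (n + 2)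
  obtain ⟨B, hB⟩ := (isCompact_closedBall (0 : ℝ × Euc d) ((n : ℝ) + 2)).exists_bound_of_continuousOn h.cont.continuousOn
  have hB' : ∀ t x, ‖((t, x) : ℝ × Euc d)‖ ≤ n + 2 → |g t x| ≤ B := fun t x hx => hB (t, x) (mem_closedBall_zero_iff.2 hx)
  have hB0 : 0 ≤ B := (norm_nonneg _).trans (hB 0 (mem_closedBall_zero_iff.2 (by simp; positivity)))
  have hN0 := hN.nonneg
  have hz : ∀ (t : ℝ) (x : Euc d), ¬ ‖((t, x) : ℝ × Euc d)‖ ≤ n + 2 → bmp d n (t, x) = 0 := fun t x h => bmp_zero (le_of_not_ge h)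
  have hc := h.cont
  refine ⟨N * B + N * C, ((bmp_smooth n).continuous).mul hc, fun t x => ?_, fun t x y => ?_⟩
  · by_cases hx : ‖((t, x) : ℝ × Euc d)‖ ≤ n + 2
    · have h1 := hN.bd t x
      have h2 := hB' t x hx
      rw [norm_mul]
      calc _ ≤ N * B := by gcongr; exact h2
        _ ≤ _ := by have : 0 ≤ N * C := by positivity
                    linarith
    · rw [hz t x hx]; simp; positivity
  · have hr : 0 ≤ ‖x - y‖ ^ α := by positivity
    have h3 := hN.hol t x y
    have hNC : 0 ≤ N * C * ‖x - y‖ ^ α := by positivity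
    rw [Real.norm_eq_abs] at h3 ⊢
    by_cases hx : ‖((t, x) : ℝ × Euc d)‖ ≤ n + 2
    · have e1 : |(bmp d n (t, x) - bmp d n (t, y)) * g t x| ≤ N * ‖x - y‖ ^ α * B := by
        rw [abs_mul]; gcongr; exact hB' t x hx
      by_cases hy : ‖((t, y) : ℝ × Euc d)‖ ≤ n + 2
      · have e2 : |bmp d n (t, y) * (g t x - g t y)| ≤ N * (C * ‖x - y‖ ^ α) := by
          rw [abs_mul]; gcongr; exacts [hN.bd t y, hol t x y hx hy]
        have e3 : bmp d n (t, x) * g t x - bmp d n (t, y) * g t y = (bmp d n (t, x) - bmp d n (t, y)) * g t x + bmp d n (t, y) * (g t x - g t y) := by ring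
        rw [e3]
        refine (abs_add_le _ _).trans ((add_le_add e1 e2).trans (le_of_eq (by ring)))
      · have e3 : bmp d n (t, x) * g t x - bmp d n (t, y) * g t y = (bmp d n (t, x) - bmp d n (t, y)) * g t x := by rw [hz t y hy]; ring
        rw [e3]; linarith
    · by_cases hy : ‖((t, y) : ℝ × Euc d)‖ ≤ n + 2
      · have e1 : |(bmp d n (t, x) - bmp d n (t, y)) * g t y| ≤ N * ‖x - y‖ ^ α * B := by
          rw [abs_mul]; gcongr; exact hB' t y hy
        have e3 : bmp d n (t, x) * g t x - bmp d n (t, y) * g t y = (bmp d n (t, x) - bmp d n (t, y)) * g t y := by rw [hz t x hx]; ring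
        rw [e3]; linarith
      · rw [hz t x hx, hz t y hy]; simp; positivity

lemma SPD.comb {A B : Fin d → Fin d → ℝ} (hA : SPD A) (hB : SPD B) {c : ℝ} (h0 : 0 ≤ c) (h1 : c ≤ 1) :
    SPD fun i j => B i j + c * (A i j - B i j) := by
  refine ⟨fun i j => by simp only [hA.1 i j, hB.1 i j], fun ξ hξ => ?_⟩
  have e : ∑ i, ∑ j, (B i j + c * (A i j - B i j)) * ξ i * ξ j = c * (∑ i, ∑ j, A i j * ξ i * ξ j) + (1 - c) * ∑ i, ∑ j, B i j * ξ i * ξ j := by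
    simp only [Finset.mul_sum, ← Finset.sum_add_distrib]
    refine Finset.sum_congr rfl fun i _ => Finset.sum_congr rfl fun j _ => by ring
  rw [e]
  have a := hA.2 ξ hξ
  have b := hB.2 ξ hξ
  rcases h0.eq_or_lt with h | h
  · rw [← h]; simpa using b
  · have := mul_pos h a
    have := mul_nonneg (sub_nonneg.2 h1) b.le
    linarith

def tA (A : ℝ → Euc d → Fin d → Fin d → ℝ) (n : ℕ) (t : ℝ) (x : Euc d) (i j : Fin d) : ℝ := idm i j + bmp d n (t, x) * (A t x i j - idm i j)
def tB (B : ℝ → Euc d → Fin d → ℝ) (n : ℕ) (t : ℝ) (x : Euc d) (i : Fin d) : ℝ := bmp d n (t, x) * B t x i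

lemma tA_eq {A : ℝ → Euc d → Fin d → Fin d → ℝ} {n : ℕ} {t : ℝ} {x : Euc d} (h : ‖((t, x) : ℝ × Euc d)‖ ≤ n + 1) : tA A n t x = A t x := by
  funext i j; rw [tA, bmp_one h]; ring

lemma tB_eq {B : ℝ → Euc d → Fin d → ℝ} {n : ℕ} {t : ℝ} {x : Euc d} (h : ‖((t, x) : ℝ × Euc d)‖ ≤ n + 1) : tB B n t x = B t x := by
  funext i; rw [tB, bmp_one h]; ring

lemma trunc_data (h0 : 0 < β) (h1 : β ≤ 1 / 2) {A : ℝ → Euc d → Fin d → Fin d → ℝ} {B : ℝ → Euc d → Fin d → ℝ}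
    (hA : ∀ i j, LocH (2 * β) (fun t x => A t x i j)) (hB : ∀ i, LocH (2 * β) (fun t x => B t x i)) (hspd : ∀ t x, SPD (A t x)) (n : ℕ) :
    ∃ lam C P, 1 ≤ lam ∧ 0 ≤ C ∧ Sol β (fun t x => qOf (tA A n t x)) (fun t x => bOf (tB B n t x)) lam C ∧
      Nrm β (fun t x => qOf (tA A n t x)) P ∧ Nrm β (fun t x => bOf (tB B n t x)) P ∧ ∀ t x, PosOp (qOf (tA A n t x)) := by
  choose MA hMA using fun i j => ((hA i j).sub_const (idm i j)).cut (by linarith) (by linarith) n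
  choose MB hMB using fun i => (hB i).cut (by linarith) (by linarith) n
  have pA : ∀ i j, Nrm (2 * β) (fun t x => tA A n t x i j) (‖idm i j‖ + MA i j) := fun i j => (Nrm.const (idm i j)).add (hMA i j)
  have hA1 : ∀ i j, Nrm (2 * β) (fun t x => tA A n t x i j) (∑ i, ∑ j, (‖idm i j‖ + MA i j)) := fun i j => (pA i j).mono
    ((Finset.single_le_sum (f := fun j => ‖idm i j‖ + MA i j) (fun j _ => (pA i j).nonneg) (Finset.mem_univ j)).trans
      (Finset.single_le_sum (f := fun i => ∑ j, (‖idm i j‖ + MA i j)) (fun i _ => Finset.sum_nonneg fun j _ => (pA i j).nonneg) (Finset.mem_univ i)))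
  have hB1 : ∀ i, Nrm (2 * β) (fun t x => tB B n t x i) (∑ i, MB i) := fun i => (hMB i).mono
    (Finset.single_le_sum (f := fun i => MB i) (fun i _ => (hMB i).nonneg) (Finset.mem_univ i))
  have sA : 0 ≤ ∑ i, ∑ j, (‖idm i j‖ + MA i j) := Finset.sum_nonneg fun i _ => Finset.sum_nonneg fun j _ => (pA i j).nonneg
  have sB : 0 ≤ ∑ i, MB i := Finset.sum_nonneg fun i _ => (hMB i).nonneg
  have hA2 : ∀ i j, Nrm β (fun t x => tA A n t x i j) _ := fun i j => (hA1 i j).lower h0.le (by linarith)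
  have hB2 : ∀ i, Nrm β (fun t x => tB B n t x i) _ := fun i => (hB1 i).lower h0.le (by linarith)
  have hS : ∀ t x, SPD (tA A n t x) := fun t x => (hspd t x).comb idm_spd (bmp d n).nonneg (bmp d n).le_one
  obtain ⟨lam, C, hl, hC, hSol⟩ := ent_solver h0 h1 hA1 sA hS (isCompact_closedBall (0 : ℝ × Euc d) ((n : ℝ) + 2)) (fun t x h => by
    rw [mem_closedBall_zero_iff, not_le] at h
    funext i j; rw [tA, bmp_zero h.le]; ring) hB2 (by positivity)
  refine ⟨lam, C, _, hl, hC, hSol, (Nrm.qOf hA2).mono (le_max_left _ _), (Nrm.bOf hB2).mono (le_max_right _ _), fun t x H hH => (hS t x).pos hH⟩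

end trunc

section lim
open scoped Topology ContDiff
variable {d : ℕ} {β F : ℝ} {A : ℝ → Euc d → Fin d → Fin d → ℝ} {B : ℝ → Euc d → Fin d → ℝ}
  {f : Euc d → ℝ} {f1 : Euc d → Euc d →L[ℝ] ℝ} {f2 : Euc d → Euc d →L[ℝ] Euc d →L[ℝ] ℝ}
  {u : ℕ → ℝ → Euc d → ℝ} {u1 : ℕ → ℝ → Euc d → Euc d →L[ℝ] ℝ} {u2 : ℕ → ℝ → Euc d → Euc d →L[ℝ] Euc d →L[ℝ] ℝ}

lemma sup_cauchy (hu : ∀ n, Apx β (fun t x => qOf (tA A n t x)) (fun t x => bOf (tB B n t x)) f f1 f2 F (u n) (u1 n) (u2 n))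
    (hspd : ∀ t x, SPD (A t x)) {φ : Euc d → ℝ} {φ1 : Euc d → Euc d →L[ℝ] ℝ} {φ2 : Euc d → Euc d →L[ℝ] Euc d →L[ℝ] ℝ}
    (hφ1 : ∀ x, HasFDerivAt φ (φ1 x) x) (hφ2 : ∀ x, HasFDerivAt φ1 (φ2 x) x) (hφ : ∀ x, 0 < φ x)
    (hinf : ∀ M : ℝ, ∃ R : ℝ, ∀ x : Euc d, R ≤ ‖x‖ → M ≤ φ x)
    (hL : ∀ T : ℝ, ∃ K : ℝ, 0 ≤ K ∧ ∀ t ∈ Icc 0 T, ∀ x, qOf (A t x) (φ2 x) + bOf (B t x) (φ1 x) ≤ K * φ x)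
    (R ε : ℝ) (hR : 0 ≤ R) (hε : 0 < ε) :
    ∃ n0 : ℕ, ∀ n ≥ n0, ∀ m ≥ n0, ∀ (t : ℝ) (x : Euc d), ‖((t, x) : ℝ × Euc d)‖ ≤ R → |u n t x - u m t x| ≤ ε := by
  obtain ⟨K, hK, hKL⟩ := hL R
  have hφc : Continuous φ := continuous_iff_continuousAt.2 fun x => (hφ1 x).continuousAt
  obtain ⟨Φ, hΦ⟩ := (isCompact_closedBall (0 : Euc d) R).exists_bound_of_continuousOn hφc.continuousOn
  have hΦ0 : 0 ≤ Φ := (norm_nonneg _).trans (hΦ 0 (by simpa using hR))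
  have hF0 : 0 ≤ F := (abs_nonneg _).trans ((hu 0).sup 0 0)
  set Y := 2 * F * (Real.exp ((K + 1) * R) * Φ) with hY
  have hY0 : 0 ≤ Y := by positivity
  obtain ⟨R0, hR0⟩ := hinf (Y / ε + 1)
  have hM : 0 < Y / ε + 1 := by positivity
  obtain ⟨n0, hn0⟩ := exists_nat_ge (max R R0)
  have hnR : R ≤ n0 := (le_max_left _ _).trans hn0
  have hnR0 : R0 ≤ n0 := (le_max_right _ _).trans hn0
  have hm0 : 0 ≤ 2 * F / (Y / ε + 1) := by positivity
  have key : ∀ n ≥ n0, ∀ m ≥ n0, ∀ t ∈ Icc 0 R, ∀ x : Euc d, ‖x‖ ≤ R → u n t x - u m t x ≤ ε := by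
    intro n hn m hm t ht x hx
    have hdom : ∀ k ≥ n0, ∀ t ∈ Ioc 0 R, ∀ x ∈ Metric.ball (0 : Euc d) n0, ‖((t, x) : ℝ × Euc d)‖ ≤ k + 1 := fun k hk t ht x hx => by
      have hk' : (n0 : ℝ) ≤ k := by exact_mod_cast hk
      rw [mem_ball_zero_iff] at hx
      rw [Prod.norm_def]
      refine max_le ?_ (by simp only; linarith)
      rw [Real.norm_eq_abs, abs_of_pos ht.1]
      linarith [ht.2]
    have := maxp_lyap (T := R) (ρ := n0) (K := K) (m := 2 * F / (Y / ε + 1)) (v := fun t x => u n t x - u m t x) (v1 := fun t x => u1 n t x - u1 m t x)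
      (v2 := fun t x => u2 n t x - u2 m t x) (q := fun t x => qOf (A t x)) (b := fun t x => bOf (B t x))
      (vt := fun t x => qOf (A t x) (u2 n t x - u2 m t x) + bOf (B t x) (u1 n t x - u1 m t x))
      ((hu n).c0.sub (hu m).c0) (fun t x => ((hu n).d1 t x).fun_sub ((hu m).d1 t x)) (fun t x => ((hu n).d2 t x).fun_sub ((hu m).d2 t x))
      (fun t ht x hx => by
        have h1 := (hu n).dt t ht.1 x
        have h2 := (hu m).dt t ht.1 x
        rw [tA_eq (hdom n hn t ht x hx), tB_eq (hdom n hn t ht x hx)] at h1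
        rw [tA_eq (hdom m hm t ht x hx), tB_eq (hdom m hm t ht x hx)] at h2
        refine (h1.fun_sub h2).congr_deriv ?_
        simp only [map_sub]; ring)
      (fun t _ x _ H hH => (hspd t x).pos hH) (fun t _ x _ => le_rfl) hφ1 hφ2 hφ hK hm0
      (fun t ht x _ => hKL t ⟨ht.1.le, ht.2⟩ x)
      (fun x _ => by
        simp only [(hu n).init 0 le_rfl, (hu m).init 0 le_rfl, sub_self]
        exact mul_nonneg hm0 (hφ x).le)
      (fun t _ x hx => by
        have h1 := abs_le.1 ((hu n).sup t x)
        have h2 := abs_le.1 ((hu m).sup t x)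
        have h3 := hR0 x (by rw [hx]; exact hnR0)
        calc _ ≤ 2 * F := by linarith
          _ = 2 * F / (Y / ε + 1) * (Y / ε + 1) := by field_simp
          _ ≤ _ := by gcongr) t ht x (mem_closedBall_zero_iff.2 (hx.trans hnR))
    refine this.trans ?_
    have h3 : φ x ≤ Φ := (le_abs_self _).trans (hΦ x (mem_closedBall_zero_iff.2 hx))
    calc _ ≤ 2 * F / (Y / ε + 1) * Real.exp ((K + 1) * R) * Φ := by
          gcongr
          exacts [(hφ x).le, ht.2]
      _ = Y / (Y / ε + 1) := by rw [hY]; ring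
      _ ≤ ε := by
        rw [div_le_iff₀ hM]
        have : ε * (Y / ε + 1) = Y + ε := by field_simp
        linarith
  refine ⟨n0, fun n hn m hm t x htx => ?_⟩
  rw [Prod.norm_def, max_le_iff, Real.norm_eq_abs] at htx
  rcases le_total t 0 with h | h
  · rw [(hu n).init t h, (hu m).init t h]; simpa using hε.le
  · have ht : t ∈ Icc 0 R := ⟨h, (le_abs_self t).trans htx.1⟩
    have k1 := key n hn m hm t ht x htx.2
    have k2 := key m hm n hn t ht x htx.2
    exact abs_le.2 ⟨by linarith, k1⟩

lemma XB.sub {E : Type} [NormedAddCommGroup E] [InnerProductSpace ℝ E] {w w' : ℝ → E → ℝ} {w1 w1' : ℝ → E → E →L[ℝ] ℝ} {w2 w2' : ℝ → E → E →L[ℝ] E →L[ℝ] ℝ} {a M a' M' : ℝ}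
    (h : XB β w w1 w2 a M) (h' : XB β w' w1' w2' a' M') :
    XB β (fun t x => w t x - w' t x) (fun t x => w1 t x - w1' t x) (fun t x => w2 t x - w2' t x) (a + a') (M + M') :=
  ⟨h.cont.sub h'.cont, fun t x => (abs_sub _ _).trans (add_le_add (h.sup t x) (h'.sup t x)), h.n1.sub h'.n1, h.n2.sub h'.n2,
    fun t x => (h.d1 t x).fun_sub (h'.d1 t x), fun t x => (h.d2 t x).fun_sub (h'.d2 t x), fun x => by simp [h.init, h'.init]⟩

lemma der_cauchy (h0 : 0 < β) (h1 : β ≤ 1 / 2)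
    (hA : ∀ i j, LocH (2 * β) (fun t x => A t x i j)) (hB : ∀ i, LocH (2 * β) (fun t x => B t x i)) (hspd : ∀ t x, SPD (A t x))
    (hu : ∀ n, Apx β (fun t x => qOf (tA A n t x)) (fun t x => bOf (tB B n t x)) f f1 f2 F (u n) (u1 n) (u2 n)) (N : ℕ) :
    ∃ K : ℝ, 0 ≤ K ∧ ∀ n ≥ N + 1, ∀ m ≥ N + 1, ∀ a : ℝ, 0 ≤ a → (∀ (t : ℝ) (x : Euc d), ‖((t, x) : ℝ × Euc d)‖ ≤ N + 2 → |u n t x - u m t x| ≤ a) →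
      ∀ (t : ℝ) (x : Euc d), ‖((t, x) : ℝ × Euc d)‖ < N + 1 → ‖u1 n t x - u1 m t x‖ ≤ K * a ∧ ‖u2 n t x - u2 m t x‖ ≤ K * a := by
  obtain ⟨lam, C, P, hlam, hC, hSol, hq, hb, hpos⟩ := trunc_data h0 h1 hA hB hspd (N + 1)
  obtain ⟨χ1, χ2, χt, Nχ, hχ⟩ := Cut.of_smooth h0 (by linarith) (bmp_smooth (d := d) N) (bmp d N).hasCompactSupport
  obtain ⟨K, hK, hint⟩ := interior_est h0 h1 hSol hC hq hb hpos hχ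
  refine ⟨K * Real.exp (lam * (N + 2)), by positivity, fun n hn m hm a ha hua => ?_⟩
  have hl0 : 0 ≤ lam := by linarith
  set θ : ℝ → ℝ := fun t => sT (N + 3 - t) * Real.exp (-lam * max t 0) with hθ
  have hsc := sT_smooth.continuous
  have hθc : Continuous θ := by simp only [hθ]; fun_prop
  have hθ0 : ∀ t, 0 ≤ θ t := fun t => mul_nonneg (Real.smoothTransition.nonneg _) (Real.exp_pos _).le
  have hθ1 : ∀ t, |θ t| ≤ 1 := fun t => by
    rw [abs_of_nonneg (hθ0 t)]
    refine mul_le_one₀ (Real.smoothTransition.le_one _) (Real.exp_pos _).le (Real.exp_le_one_iff.2 ?_)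
    have := mul_nonneg hl0 (le_max_right t 0)
    linarith
  have hθT : ∀ t, (N : ℝ) + 3 < t → θ t = 0 := fun t ht => by
    simp only [hθ]; rw [show sT (N + 3 - t) = 0 from Real.smoothTransition.zero_of_nonpos (by linarith)]; simp
  have hθe : ∀ t, t ≤ (N : ℝ) + 2 → θ t = Real.exp (-lam * max t 0) := fun t ht => by
    simp only [hθ]; rw [show sT (N + 3 - t) = 1 from Real.smoothTransition.one_of_one_le (by linarith)]; simp
  have hθd : ∀ t, 0 < t → DifferentiableAt ℝ θ t := fun t ht => by
    have e : θ =ᶠ[𝓝 t] fun t => sT (N + 3 - t) * Real.exp (-lam * t) := by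
      filter_upwards [Ioi_mem_nhds ht] with τ hτ
      simp only [hθ]; rw [max_eq_left (le_of_lt hτ)]
    refine DifferentiableAt.congr_of_eventuallyEq ?_ e
    have hd := sT_smooth.differentiable (by simp)
    fun_prop
  have hχN : ∀ (t : ℝ) (x : Euc d), 1 / 2 < bmp d N (t, x) → ‖((t, x) : ℝ × Euc d)‖ < N + 2 := fun t x h => by
    by_contra! h'
    rw [bmp_zero h'] at h; norm_num at h
  obtain ⟨a1, M1, x1⟩ := (hu n).X θ _ _ hθc hθT hθ1
  obtain ⟨a2, M2, x2⟩ := (hu m).X θ _ _ hθc hθT hθ1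
  have main := hint _ _ _ _ _ a (x1.sub x2) (fun t ht x => by rw [(hu n).init t ht, (hu m).init t ht, sub_self])
    (fun t ht x => by
      have e1 := ((hu n).dt t ht x).differentiableAt
      have e2 := ((hu m).dt t ht x).differentiableAt
      have e3 := hθd t ht
      fun_prop)
    (fun t ht x hx => by
      have hn2 := hχN t x hx
      have hk : ∀ k ≥ N + 1, ‖((t, x) : ℝ × Euc d)‖ ≤ k + 1 := fun k hk => by
        have : (N : ℝ) + 1 ≤ k := by exact_mod_cast hk
        linarith
      have ht2 : t < N + 2 := by
        have := (norm_fst_le ((t, x) : ℝ × Euc d)).trans_lt hn2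
        exact (le_abs_self t).trans_lt this
      have e1 := (hu n).dt t ht x
      have e2 := (hu m).dt t ht x
      rw [tA_eq (hk n hn), tB_eq (hk n hn)] at e1
      rw [tA_eq (hk m hm), tB_eq (hk m hm)] at e2
      have h3 : HasDerivAt (fun τ : ℝ => Real.exp (-lam * τ)) (Real.exp (-lam * t) * (-lam)) t := by
        simpa using ((hasDerivAt_id t).const_mul (-lam)).exp
      have e : (fun τ => θ τ * (u n τ x - f x) - θ τ * (u m τ x - f x)) =ᶠ[𝓝 t] fun τ => Real.exp (-lam * τ) * (u n τ x - u m τ x) := by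
        filter_upwards [Ioo_mem_nhds ht ht2] with τ hτ
        rw [hθe τ hτ.2.le, max_eq_left hτ.1.le]; ring
      refine ((h3.fun_mul (e1.fun_sub e2)).congr_of_eventuallyEq e).congr_deriv ?_
      have hk' := hk (N + 1) le_rfl
      rw [tA_eq hk', tB_eq hk', hθe t ht2.le, max_eq_left ht.le]
      simp only [map_sub, map_smul, smul_eq_mul]; ring)
    ha (fun t x hx => by
      have := hua t x (hχN t x hx).le
      have e : θ t * (u n t x - f x) - θ t * (u m t x - f x) = θ t * (u n t x - u m t x) := by ring
      rw [e, abs_mul]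
      calc _ ≤ 1 * a := by gcongr; exact hθ1 t
        _ = a := one_mul a)
  intro t x htx
  have hopen : ∀ᶠ y in 𝓝 x, 1 ≤ bmp d N (t, y) := by
    have hc : Continuous fun y : Euc d => ‖((t, y) : ℝ × Euc d)‖ := by fun_prop
    filter_upwards [hc.continuousAt.eventually_lt continuousAt_const htx] with y hy
    rw [bmp_one hy.le]
  obtain ⟨r1, r2⟩ := main t x hopen
  have ht2 : t ≤ N + 2 := by
    have := (norm_fst_le ((t, x) : ℝ × Euc d)).trans_lt htx
    have := (le_abs_self t).trans_lt this
    linarith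
  have hθl : 1 ≤ Real.exp (lam * (N + 2)) * θ t := by
    rw [hθe t ht2, ← Real.exp_add]
    refine Real.one_le_exp ?_
    have : lam * max t 0 ≤ lam * (N + 2) := mul_le_mul_of_nonneg_left (max_le ht2 (by positivity)) hl0
    linarith
  have fin : ∀ {G : Type} [NormedAddCommGroup G] [NormedSpace ℝ G] (y z w : G), ‖θ t • (y - w) - θ t • (z - w)‖ ≤ K * a → ‖y - z‖ ≤ K * Real.exp (lam * (N + 2)) * a := by
    intro G _ _ y z w h
    have e : θ t • (y - w) - θ t • (z - w) = θ t • (y - z) := by rw [← smul_sub]; congr 1; abel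
    rw [e, norm_smul, Real.norm_eq_abs, abs_of_nonneg (hθ0 t)] at h
    calc ‖y - z‖ = 1 * ‖y - z‖ := (one_mul _).symm
      _ ≤ Real.exp (lam * (N + 2)) * θ t * ‖y - z‖ := by gcongr
      _ = Real.exp (lam * (N + 2)) * (θ t * ‖y - z‖) := by ring
      _ ≤ Real.exp (lam * (N + 2)) * (K * a) := by gcongr
      _ = _ := by ring
  exact ⟨fin _ _ _ r1, fin _ _ _ r2⟩

end lim

section exi
open scoped Topology ContDiff

lemma lim_exists {V G : Type} [NormedAddCommGroup V] [NormedAddCommGroup G] [CompleteSpace G] {g : ℕ → V → G} (hc : ∀ n, Continuous (g n))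
    (h : ∀ N : ℕ, ∀ ε > (0 : ℝ), ∃ n0, ∀ n ≥ n0, ∀ m ≥ n0, ∀ p, ‖p‖ < N → ‖g n p - g m p‖ ≤ ε) :
    ∃ L : V → G, Continuous L ∧ (∀ p, Tendsto (fun n => g n p) atTop (𝓝 (L p))) ∧ ∀ N : ℕ, TendstoUniformlyOn g L atTop (Metric.ball 0 N) := by
  have hN : ∀ p : V, ∃ N : ℕ, ‖p‖ < N := fun p => exists_nat_gt ‖p‖
  have hU : ∀ N : ℕ, UniformCauchySeqOn g atTop (Metric.ball 0 N) := fun N => by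
    rw [Metric.uniformCauchySeqOn_iff]
    intro ε hε
    obtain ⟨n0, hn⟩ := h N (ε / 2) (by linarith)
    refine ⟨n0, fun m hm n hn' p hp => ?_⟩
    rw [dist_eq_norm]
    exact (hn m hm n hn' p (mem_ball_zero_iff.1 hp)).trans_lt (by linarith)
  have hl : ∀ p, ∃ l, Tendsto (fun n => g n p) atTop (𝓝 l) := fun p => by
    obtain ⟨N, hp⟩ := hN p
    exact cauchySeq_tendsto_of_complete ((hU N).cauchySeq (mem_ball_zero_iff.2 hp))
  choose L hL using hl
  have hT : ∀ N : ℕ, TendstoUniformlyOn g L atTop (Metric.ball 0 N) := fun N => (hU N).tendstoUniformlyOn_of_tendsto fun p _ => hL p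
  refine ⟨L, continuous_iff_continuousAt.2 fun p => ?_, hL, hT⟩
  obtain ⟨N, hp⟩ := hN p
  exact ((hT N).continuousOn (Frequently.of_forall fun n => (hc n).continuousOn)).continuousAt
    (Metric.isOpen_ball.mem_nhds (mem_ball_zero_iff.2 hp))

variable {d : ℕ} {β F : ℝ} {A : ℝ → Euc d → Fin d → Fin d → ℝ} {B : ℝ → Euc d → Fin d → ℝ} {f : Euc d → ℝ}

lemma qOf_cont (hA : ∀ i j, Continuous fun p : ℝ × Euc d => A p.1 p.2 i j) : Continuous fun p : ℝ × Euc d => qOf (A p.1 p.2) := by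
  unfold qOf
  exact continuous_finset_sum _ fun i _ => continuous_finset_sum _ fun j _ => (hA i j).smul continuous_const

lemma bOf_cont (hB : ∀ i, Continuous fun p : ℝ × Euc d => B p.1 p.2 i) : Continuous fun p : ℝ × Euc d => bOf (B p.1 p.2) := by
  unfold bOf
  exact continuous_finset_sum _ fun i _ => (hB i).smul continuous_const

lemma exists_sol (h0 : 0 < β) (h1 : β ≤ 1 / 2)
    (hA : ∀ i j, LocH (2 * β) (fun t x => A t x i j)) (hB : ∀ i, LocH (2 * β) (fun t x => B t x i)) (hspd : ∀ t x, SPD (A t x))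
    {φ : Euc d → ℝ} {φ1 : Euc d → Euc d →L[ℝ] ℝ} {φ2 : Euc d → Euc d →L[ℝ] Euc d →L[ℝ] ℝ}
    (hφ1 : ∀ x, HasFDerivAt φ (φ1 x) x) (hφ2 : ∀ x, HasFDerivAt φ1 (φ2 x) x) (hφ : ∀ x, 0 < φ x)
    (hinf : ∀ M : ℝ, ∃ R : ℝ, ∀ x : Euc d, R ≤ ‖x‖ → M ≤ φ x)
    (hL : ∀ T : ℝ, ∃ K : ℝ, 0 ≤ K ∧ ∀ t ∈ Icc 0 T, ∀ x, qOf (A t x) (φ2 x) + bOf (B t x) (φ1 x) ≤ K * φ x)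
    (hf : ContDiff ℝ ∞ f) (hfc : HasCompactSupport f) (hF : ∀ x, |f x| ≤ F) :
    ∃ (U : ℝ → Euc d → ℝ) (U1 : ℝ → Euc d → Euc d →L[ℝ] ℝ) (U2 : ℝ → Euc d → Euc d →L[ℝ] Euc d →L[ℝ] ℝ),
      (Continuous fun p : ℝ × Euc d => U p.1 p.2) ∧ (Continuous fun p : ℝ × Euc d => U1 p.1 p.2) ∧ (Continuous fun p : ℝ × Euc d => U2 p.1 p.2) ∧
      (∀ t x, HasFDerivAt (U t) (U1 t x) x) ∧ (∀ t x, HasFDerivAt (U1 t) (U2 t x) x) ∧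
      (∀ t, 0 < t → ∀ x, HasDerivAt (fun τ => U τ x) (qOf (A t x) (U2 t x) + bOf (B t x) (U1 t x)) t) ∧
      (∀ x, U 0 x = f x) ∧ ∀ t x, |U t x| ≤ F := by
  have hex : ∀ n, ∃ u u1 u2, Apx β (fun t x => qOf (tA A n t x)) (fun t x => bOf (tB B n t x)) f (fderiv ℝ f) (fderiv ℝ (fderiv ℝ f)) F u u1 u2 := fun n => by
    obtain ⟨lam, C, P, hlam, hC, hSol, hq, hb, hpos⟩ := trunc_data h0 h1 hA hB hspd n
    exact apx_exists h0 h1 hlam hSol hq hb hpos hf hfc hF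
  choose u u1 u2 hu using hex
  have s0 : ∀ R ε : ℝ, 0 ≤ R → 0 < ε → ∃ n0 : ℕ, ∀ n ≥ n0, ∀ m ≥ n0, ∀ (t : ℝ) (x : Euc d), ‖((t, x) : ℝ × Euc d)‖ ≤ R → |u n t x - u m t x| ≤ ε :=
    fun R ε => sup_cauchy hu hspd hφ1 hφ2 hφ hinf hL R ε
  have s12 : ∀ N : ℕ, ∀ ε > (0:ℝ), ∃ n0, ∀ n ≥ n0, ∀ m ≥ n0, ∀ p : ℝ × Euc d, ‖p‖ < N →
      ‖u1 n p.1 p.2 - u1 m p.1 p.2‖ ≤ ε ∧ ‖u2 n p.1 p.2 - u2 m p.1 p.2‖ ≤ ε := by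
    intro N ε hε
    obtain ⟨K, hK, hd⟩ := der_cauchy h0 h1 hA hB hspd hu N
    obtain ⟨n0, hn0⟩ := s0 (N + 2) (ε / (K + 1)) (by positivity) (by positivity)
    refine ⟨max n0 (N + 1), fun n hn m hm p hp => ?_⟩
    have := hd n ((le_max_right _ _).trans hn) m ((le_max_right _ _).trans hm) (ε / (K + 1)) (by positivity)
      (hn0 n ((le_max_left _ _).trans hn) m ((le_max_left _ _).trans hm)) p.1 p.2 (lt_trans hp (by linarith))
    have e : K * (ε / (K + 1)) ≤ ε := by
      rw [mul_div_assoc', div_le_iff₀ (by positivity)]; nlinarith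
    exact ⟨this.1.trans e, this.2.trans e⟩
  obtain ⟨U, cU, tU, -⟩ := lim_exists (g := fun n (p : ℝ × Euc d) => u n p.1 p.2) (fun n => (hu n).c0) (fun N ε hε => by
    obtain ⟨n0, hn0⟩ := s0 N ε (by positivity) hε
    exact ⟨n0, fun n hn m hm p hp => hn0 n hn m hm p.1 p.2 hp.le⟩)
  obtain ⟨U1, cU1, tU1, uU1⟩ := lim_exists (g := fun n (p : ℝ × Euc d) => u1 n p.1 p.2) (fun n => (hu n).c1) (fun N ε hε => by
    obtain ⟨n0, hn0⟩ := s12 N ε hε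
    exact ⟨n0, fun n hn m hm p hp => (hn0 n hn m hm p hp).1⟩)
  obtain ⟨U2, cU2, tU2, uU2⟩ := lim_exists (g := fun n (p : ℝ × Euc d) => u2 n p.1 p.2) (fun n => (hu n).c2) (fun N ε hε => by
    obtain ⟨n0, hn0⟩ := s12 N ε hε
    exact ⟨n0, fun n hn m hm p hp => (hn0 n hn m hm p hp).2⟩)
  have cq := qOf_cont fun i j => (hA i j).cont
  have cb := bOf_cont fun i => (hB i).cont
  obtain ⟨Ut, cUt, tUt, uUt⟩ := lim_exists (g := fun n (p : ℝ × Euc d) => qOf (A p.1 p.2) (u2 n p.1 p.2) + bOf (B p.1 p.2) (u1 n p.1 p.2))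
    (fun n => (cq.clm_apply (hu n).c2).add (cb.clm_apply (hu n).c1)) (fun N ε hε => by
    obtain ⟨k1, hk1⟩ := (isCompact_closedBall (0 : ℝ × Euc d) N).exists_bound_of_continuousOn cq.continuousOn
    obtain ⟨k2, hk2⟩ := (isCompact_closedBall (0 : ℝ × Euc d) N).exists_bound_of_continuousOn cb.continuousOn
    have p1 : 0 ≤ k1 := (norm_nonneg _).trans (hk1 0 (by simp))
    have p2 : 0 ≤ k2 := (norm_nonneg _).trans (hk2 0 (by simp))
    obtain ⟨n0, hn0⟩ := s12 N (ε / (k1 + k2 + 1)) (by positivity)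
    refine ⟨n0, fun n hn m hm p hp => ?_⟩
    obtain ⟨a1, a2⟩ := hn0 n hn m hm p hp
    have hp' : p ∈ Metric.closedBall (0 : ℝ × Euc d) N := mem_closedBall_zero_iff.2 hp.le
    have e : qOf (A p.1 p.2) (u2 n p.1 p.2) + bOf (B p.1 p.2) (u1 n p.1 p.2) - (qOf (A p.1 p.2) (u2 m p.1 p.2) + bOf (B p.1 p.2) (u1 m p.1 p.2))
        = qOf (A p.1 p.2) (u2 n p.1 p.2 - u2 m p.1 p.2) + bOf (B p.1 p.2) (u1 n p.1 p.2 - u1 m p.1 p.2) := by simp only [map_sub]; ring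
    rw [e]
    calc _ ≤ ‖qOf (A p.1 p.2) (u2 n p.1 p.2 - u2 m p.1 p.2)‖ + ‖bOf (B p.1 p.2) (u1 n p.1 p.2 - u1 m p.1 p.2)‖ := norm_add_le _ _
      _ ≤ k1 * (ε / (k1 + k2 + 1)) + k2 * (ε / (k1 + k2 + 1)) := by
        refine add_le_add ((ContinuousLinearMap.le_opNorm _ _).trans ?_) ((ContinuousLinearMap.le_opNorm _ _).trans ?_)
        · gcongr; exact hk1 p hp'
        · gcongr; exact hk2 p hp'
      _ ≤ ε := by
        rw [← add_mul, mul_div_assoc', div_le_iff₀ (by positivity)]; nlinarith)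
  refine ⟨fun t x => U (t, x), fun t x => U1 (t, x), fun t x => U2 (t, x), cU, cU1, cU2, fun t x => ?_, fun t x => ?_, fun t ht x => ?_, fun x => ?_, fun t x => ?_⟩
  · obtain ⟨N, hN⟩ := exists_nat_gt ‖((t, x) : ℝ × Euc d)‖
    have hc : Continuous fun y : Euc d => ((t, y) : ℝ × Euc d) := by fun_prop
    exact hasFDerivAt_of_tendstoUniformlyOn (Metric.isOpen_ball.preimage hc) ((uU1 N).comp fun y : Euc d => (t, y))
      (fun n y _ => (hu n).d1 t y) (fun y _ => tU (t, y)) (x := x) (mem_ball_zero_iff.2 hN)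
  · obtain ⟨N, hN⟩ := exists_nat_gt ‖((t, x) : ℝ × Euc d)‖
    have hc : Continuous fun y : Euc d => ((t, y) : ℝ × Euc d) := by fun_prop
    exact hasFDerivAt_of_tendstoUniformlyOn (Metric.isOpen_ball.preimage hc) ((uU2 N).comp fun y : Euc d => (t, y))
      (fun n y _ => (hu n).d2 t y) (fun y _ => tU1 (t, y)) (x := x) (mem_ball_zero_iff.2 hN)
  · obtain ⟨N, hN⟩ := exists_nat_gt ‖((t, x) : ℝ × Euc d)‖
    have hc : Continuous fun τ : ℝ => ((τ, x) : ℝ × Euc d) := by fun_prop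
    have e : Ut (t, x) = qOf (A t x) (U2 (t, x)) + bOf (B t x) (U1 (t, x)) :=
      tendsto_nhds_unique (tUt (t, x)) ((((qOf (A t x)).continuous.tendsto _).comp (tU2 (t, x))).add (((bOf (B t x)).continuous.tendsto _).comp (tU1 (t, x))))
    rw [← e]
    refine hasDerivAt_of_tendstoUniformlyOn ((Metric.isOpen_ball.preimage hc).inter isOpen_Ioi)
      (((uUt N).comp fun τ : ℝ => (τ, x)).mono inter_subset_left) ?_ (fun τ _ => tU (τ, x)) (x := t) ⟨mem_ball_zero_iff.2 hN, ht⟩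
    filter_upwards [eventually_ge_atTop N] with n hn τ hτ
    have hb : ‖((τ, x) : ℝ × Euc d)‖ ≤ n + 1 := by
      have h2 : ‖((τ, x) : ℝ × Euc d)‖ < N := mem_ball_zero_iff.1 hτ.1
      have h3 : (N : ℝ) ≤ n := by exact_mod_cast hn
      linarith
    have := (hu n).dt τ hτ.2 x
    rw [tA_eq hb, tB_eq hb] at this
    exact this
  · refine tendsto_nhds_unique (tU (0, x)) ?_
    simp only [(hu _).init 0 le_rfl]
    exact tendsto_const_nhds
  · exact le_of_tendsto (tU (t, x)).abs (Eventually.of_forall fun n => (hu n).sup t x)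

end exi

section fin
open scoped Topology ContDiff
variable {d : ℕ}

lemma locH_of {α s : ℝ} {I : Set ℝ} (h0 : 0 < α) (hI : ∀ t, s ≤ t → t ∈ I) {g : ℝ → Euc d → ℝ} (h : LocHolderParab d α I g) :
    LocH α (fun t x => g (s + max t 0) x) := by
  have key : ∀ R : ℝ, ∃ C > 0, ∀ p q : ℝ × Euc d, ‖p‖ ≤ R → ‖q‖ ≤ R →
      |g (s + max p.1 0) p.2 - g (s + max q.1 0) q.2| ≤ C * pdist d (s + max p.1 0, p.2) (s + max q.1 0, q.2) ^ α := by
    intro R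
    obtain ⟨C, hC, hh⟩ := h (Icc s (s + max R 0) ×ˢ Metric.closedBall (0 : Euc d) R)
      (isCompact_Icc.prod (isCompact_closedBall _ _)) (prod_mono (fun t ht => hI t ht.1) (subset_univ _))
    have hm : ∀ p : ℝ × Euc d, ‖p‖ ≤ R → (s + max p.1 0, p.2) ∈ Icc s (s + max R 0) ×ˢ Metric.closedBall (0 : Euc d) R := by
      intro p hp
      have h1 : p.1 ≤ R := (le_abs_self _).trans ((norm_fst_le p).trans hp)
      refine ⟨⟨?_, ?_⟩, ?_⟩
      · simp
      · simp only [add_le_add_iff_left]; exact max_le_max h1 le_rfl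
      · simpa using (norm_snd_le p).trans hp
    exact ⟨C, hC, fun p q hp hq => hh _ (hm p hp) _ (hm q hq)⟩
  refine ⟨continuous_iff_continuousAt.2 fun p => ?_, fun R => ?_⟩
  · obtain ⟨C, hC, hh⟩ := key (‖p‖ + 1)
    have hnb : ∀ᶠ q in 𝓝 p, ‖q‖ ≤ ‖p‖ + 1 := by
      have : Tendsto (fun q : ℝ × Euc d => ‖q‖) (𝓝 p) (𝓝 ‖p‖) := continuous_norm.continuousAt
      exact (this.eventually (gt_mem_nhds (lt_add_one _))).mono fun q hq => le_of_lt hq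
    have hlim : Tendsto (fun q : ℝ × Euc d => C * pdist d (s + max q.1 0, q.2) (s + max p.1 0, p.2) ^ α) (𝓝 p) (𝓝 0) := by
      have hc : Continuous fun q : ℝ × Euc d => C * pdist d (s + max q.1 0, q.2) (s + max p.1 0, p.2) ^ α := by
        unfold pdist
        refine continuous_const.mul (Continuous.rpow_const ?_ fun _ => Or.inr h0.le)
        fun_prop
      have := hc.tendsto p
      simpa [pdist, Real.zero_rpow h0.ne'] using this
    rw [ContinuousAt, tendsto_iff_norm_sub_tendsto_zero]
    refine squeeze_zero' (Eventually.of_forall fun _ => norm_nonneg _) (hnb.mono fun q hq => ?_) hlim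
    exact hh q p hq (by linarith)
  · obtain ⟨C, hC, hh⟩ := key R
    refine ⟨C, hC.le, fun t x y hx hy => ?_⟩
    have := hh (t, x) (t, y) hx hy
    simpa [pdist] using this

lemma spd_of {A : Fin d → Fin d → ℝ} {ν₀ : ℝ} (h0 : 0 < ν₀) (hs : ∀ i j, A i j = A j i) (h : ν₀ ≤ minEig d A) : SPD A := by
  refine ⟨hs, fun ξ hξ => ?_⟩
  have hbb : BddBelow {r : ℝ | ∃ ξ : Euc d, ‖ξ‖ = 1 ∧ (∑ i, ∑ j, A i j * ξ i * ξ j) = r} := by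
    refine ⟨-∑ i, ∑ j, |A i j|, ?_⟩
    rintro r ⟨η, hη, rfl⟩
    rw [← Finset.sum_neg_distrib]
    refine Finset.sum_le_sum fun i _ => ?_
    rw [← Finset.sum_neg_distrib]
    refine Finset.sum_le_sum fun j _ => ?_
    have hi : ∀ i, |η i| ≤ 1 := fun i => hη ▸ (PiLp.norm_apply_le η i)
    have : |A i j * η i * η j| ≤ |A i j| := by
      rw [abs_mul, abs_mul]
      have h1 : |A i j| * |η i| ≤ |A i j| := mul_le_of_le_one_right (abs_nonneg _) (hi i)
      exact (mul_le_of_le_one_right (by positivity) (hi j)).trans h1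
    exact (abs_le.1 this).1.trans' (le_refl _)
  have hz : (WithLp.toLp 2 ξ : Euc d) ≠ 0 := fun hh => hξ (by
    ext i; simpa using congrArg (fun v : Euc d => v i) hh)
  set η : Euc d := WithLp.toLp 2 ξ with hη
  have hn : 0 < ‖η‖ := norm_pos_iff.2 hz
  have hle := h.trans (csInf_le hbb ⟨‖η‖⁻¹ • η, by rw [norm_smul, norm_inv, norm_norm, inv_mul_cancel₀ hn.ne'], rfl⟩)
  have he : (∑ i, ∑ j, A i j * (‖η‖⁻¹ • η) i * (‖η‖⁻¹ • η) j) = ‖η‖⁻¹ ^ 2 * ∑ i, ∑ j, A i j * ξ i * ξ j := by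
    simp only [Finset.mul_sum, PiLp.smul_apply, smul_eq_mul]
    refine Finset.sum_congr rfl fun i _ => Finset.sum_congr rfl fun j _ => ?_
    simp only [hη]; ring
  rw [he] at hle
  exact (mul_pos_iff_of_pos_left (by positivity)).1 (lt_of_lt_of_le h0 hle)

lemma hess_of {g : Euc d → ℝ} {g1 : Euc d → Euc d →L[ℝ] ℝ} {g2 : Euc d →L[ℝ] Euc d →L[ℝ] ℝ} {x : Euc d} (h1 : ∀ x, HasFDerivAt g (g1 x) x)
    (h2 : HasFDerivAt g1 g2 x) (i j : Fin d) : hess d g x i j = g2 (eb i) (eb j) := by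
  unfold hess
  have : (fun y => fderiv ℝ g y (EuclideanSpace.single j 1)) = fun y => g1 y (eb j) := by
    ext y; rw [(h1 y).fderiv]; rfl
  rw [this]
  have h3 := ((ContinuousLinearMap.apply ℝ ℝ (eb j)).hasFDerivAt (x := g1 x)).comp x h2
  have h4 : HasFDerivAt (fun y => g1 y (eb j)) ((ContinuousLinearMap.apply ℝ ℝ (eb j)).comp g2) x := h3
  rw [h4.fderiv]; rfl

lemma Aop_of {g : Euc d → ℝ} {g1 : Euc d → Euc d →L[ℝ] ℝ} {g2 : Euc d →L[ℝ] Euc d →L[ℝ] ℝ} {x : Euc d} (h1 : ∀ x, HasFDerivAt g (g1 x) x)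
    (h2 : HasFDerivAt g1 g2 x) (Q : ℝ → Euc d → Fin d → Fin d → ℝ) (b : ℝ → Euc d → Fin d → ℝ) (t : ℝ) :
    Aop d Q b (fun _ _ => 0) t g x = qOf (Q t x) g2 + bOf (b t x) (g1 x) := by
  unfold Aop
  rw [qOf_apply, bOf_apply, (h1 x).fderiv]
  simp only [hess_of h1 h2, zero_mul, add_zero]
  rfl

lemma exists_classical {I : Set ℝ}
    (hI : ∀ ⦃t t' : ℝ⦄, t ∈ I → t ≤ t' → t' ∈ I)
    (Q : ℝ → Euc d → Fin d → Fin d → ℝ) (b : ℝ → Euc d → Fin d → ℝ)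
    (α : ℝ) (hα : α ∈ Ioo (0:ℝ) 1)
    (hQhold : ∀ i j, LocHolderParab d α I (fun t x => Q t x i j))
    (hbhold : ∀ j, LocHolderParab d α I (fun t x => b t x j))
    (hsymm : ∀ t ∈ I, ∀ x : Euc d, ∀ i j, Q t x i j = Q t x j i)
    (ν₀ : ℝ) (hν₀ : 0 < ν₀) (hell : ∀ t ∈ I, ∀ x : Euc d, ν₀ ≤ minEig d (Q t x))
    (hLyap : ∃ φ : Euc d → ℝ, ContDiff ℝ 2 φ ∧ (∀ x, 0 < φ x) ∧
      (∀ M : ℝ, ∃ R : ℝ, ∀ x : Euc d, R ≤ ‖x‖ → M ≤ φ x) ∧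
      (∀ a b' : ℝ, Icc a b' ⊆ I → ∃ lam > 0, ∀ t ∈ Icc a b', ∀ x : Euc d,
        Aop d Q b (fun _ _ => 0) t φ x ≤ lam * φ x))
    {s : ℝ} (hs : s ∈ I) {f : Euc d → ℝ} {F : ℝ} (hf : ContDiff ℝ ∞ f) (hfc : HasCompactSupport f) (hF : ∀ x, |f x| ≤ F) :
    ∃ u : ℝ → Euc d → ℝ, IsClassicalSolution d Q b (fun _ _ => 0) s f u ∧ BoundedOnStrips d s u ∧ ∀ t x, |u t x| ≤ F := by
  obtain ⟨φ, hφc, hφ, hinf, hL⟩ := hLyap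
  have hI' : ∀ t, s ≤ t → t ∈ I := fun t ht => hI hs ht
  have hsm : ∀ t : ℝ, s + max t 0 ∈ I := fun t => hI' _ (by simp)
  have hφ1 : ∀ x, HasFDerivAt φ (fderiv ℝ φ x) x := fun x => (hφc.differentiable (by simp) x).hasFDerivAt
  have hφ2 : ∀ x, HasFDerivAt (fderiv ℝ φ) (fderiv ℝ (fderiv ℝ φ) x) x := fun x =>
    ((hφc.fderiv_right (m := 1) (by norm_num)).differentiable (by simp) x).hasFDerivAt
  have h2 : 2 * (α / 2) = α := by ring
  obtain ⟨U, U1, U2, hUc, hU1c, hU2c, hU1, hU2, hUt, hU0, hUF⟩ := exists_sol (d := d) (β := α / 2)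
    (A := fun t x => Q (s + max t 0) x) (B := fun t x => b (s + max t 0) x) (φ := φ) (φ1 := fderiv ℝ φ) (φ2 := fderiv ℝ (fderiv ℝ φ))
    (f := f) (F := F) (by linarith [hα.1]) (by linarith [hα.2])
    (fun i j => by rw [h2]; exact locH_of hα.1 hI' (hQhold i j)) (fun i => by rw [h2]; exact locH_of hα.1 hI' (hbhold i))
    (fun t x => spd_of hν₀ (hsymm _ (hsm t) x) (hell _ (hsm t) x)) hφ1 hφ2 hφ hinf
    (fun T => by
      obtain ⟨lam, hl, hh⟩ := hL s (s + T) (fun t ht => hI' t ht.1)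
      refine ⟨lam, hl.le, fun t ht x => ?_⟩
      rw [max_eq_left ht.1]
      have := hh (s + t) ⟨by linarith [ht.1], by linarith [ht.2]⟩ x
      rwa [Aop_of hφ1 (hφ2 x)] at this) hf hfc hF
  have hsh : Continuous fun p : ℝ × Euc d => ((p.1 - s, p.2) : ℝ × Euc d) := by fun_prop
  have hfd : ∀ t, fderiv ℝ (U t) = U1 t := fun t => funext fun x => (hU1 t x).fderiv
  have hfd2 : ∀ t, fderiv ℝ (U1 t) = U2 t := fun t => funext fun x => (hU2 t x).fderiv
  have hpd : ∀ t, s < t → ∀ x, HasDerivAt (fun τ => U (τ - s) x) (Aop d Q b (fun _ _ => 0) t (U (t - s)) x) t := by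
    intro t ht x
    have h := hUt (t - s) (by linarith) x
    rw [max_eq_left (by linarith), add_sub_cancel] at h
    rw [Aop_of (hU1 _) (hU2 _ x)]
    exact HasDerivAt.comp_sub_const t s h
  have hhess : ∀ t x, hess d (U t) x = fun i j => U2 t x (eb i) (eb j) := fun t x => funext fun i => funext fun j => hess_of (hU1 t) (hU2 t x) i j
  refine ⟨fun t x => U (t - s) x, ⟨?_, ?_, ?_, ?_, ?_, ?_, ?_, ?_⟩, ?_, fun t x => hUF _ x⟩
  · exact (hUc.comp hsh).continuousOn
  · exact fun t ht x => (hpd t ht x).differentiableAt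
  · have hcQ : ∀ i j, Continuous fun p : ℝ × Euc d => Q (s + max (p.1 - s) 0) p.2 i j := fun i j =>
      (locH_of hα.1 hI' (hQhold i j)).cont.comp hsh
    have hcb : ∀ i, Continuous fun p : ℝ × Euc d => b (s + max (p.1 - s) 0) p.2 i := fun i =>
      (locH_of hα.1 hI' (hbhold i)).cont.comp hsh
    have hc : Continuous fun p : ℝ × Euc d => (∑ i, ∑ j, Q (s + max (p.1 - s) 0) p.2 i j * U2 (p.1 - s) p.2 (eb i) (eb j)) +
        ∑ i, b (s + max (p.1 - s) 0) p.2 i * U1 (p.1 - s) p.2 (eb i) := by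
      have e2 : Continuous fun p : ℝ × Euc d => U2 (p.1 - s) p.2 := hU2c.comp hsh
      have e1 : Continuous fun p : ℝ × Euc d => U1 (p.1 - s) p.2 := hU1c.comp hsh
      refine Continuous.add (continuous_finset_sum _ fun i _ => continuous_finset_sum _ fun j _ => (hcQ i j).mul ?_)
        (continuous_finset_sum _ fun i _ => (hcb i).mul ?_)
      · exact (e2.clm_apply continuous_const).clm_apply continuous_const
      · exact e1.clm_apply continuous_const
    refine hc.continuousOn.congr fun p hp => ?_
    have hp1 : s < p.1 := hp.1
    show deriv (fun τ => U (τ - s) p.2) p.1 = _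
    rw [(hpd p.1 hp1 p.2).deriv, Aop_of (hU1 _) (hU2 _ p.2), qOf_apply, bOf_apply]
    have e3 : s + max (p.1 - s) 0 = p.1 := by rw [max_eq_left (by linarith)]; ring
    simp only [e3]
  · intro t ht
    have hc2 : Continuous (U2 (t - s)) := hU2c.comp (by fun_prop : Continuous fun x : Euc d => ((t - s, x) : ℝ × Euc d))
    have c1 : ContDiff ℝ 1 (U1 (t - s)) := by
      rw [contDiff_one_iff_fderiv, hfd2]
      exact ⟨fun x => (hU2 _ x).differentiableAt, hc2⟩
    have : ContDiff ℝ (1 + 1) (U (t - s)) := by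
      rw [contDiff_succ_iff_fderiv, hfd]
      exact ⟨fun x => (hU1 _ x).differentiableAt, by simp, c1⟩
    exact this
  · simp only [hfd]; exact (hU1c.comp hsh).continuousOn
  · simp only [hhess]
    have e2 : Continuous fun p : ℝ × Euc d => U2 (p.1 - s) p.2 := hU2c.comp hsh
    refine Continuous.continuousOn (continuous_pi fun i => continuous_pi fun j => ?_)
    exact (e2.clm_apply continuous_const).clm_apply continuous_const
  · exact fun t ht x => (hpd t ht x).deriv
  · intro x; simp [hU0]
  · exact fun T hT => ⟨F, fun t _ x => hUF _ x⟩

end fin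

section fin2
open scoped Topology ContDiff
variable {d : ℕ}

lemma meas_ext {m n : Measure (Euc d)} [IsProbabilityMeasure m] [IsProbabilityMeasure n]
    (h : ∀ f : Euc d → ℝ, ContDiff ℝ ∞ f → HasCompactSupport f → ∫ x, f x ∂m = ∫ x, f x ∂n) : m = n := by
  refine ext_of_generate_finite {s | IsOpen s} (BorelSpace.measurable_eq.trans rfl) isPiSystem_isOpen ?_ (by simp)
  intro O hO'
  have hO : IsOpen O := hO'
  obtain ⟨g, hg, hgs, hgr⟩ := IsOpen.exists_contDiff_support_eq (n := ⊤) hO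
  let bp : ℕ → ContDiffBump (0 : Euc d) := fun k => ⟨k + 1, k + 2, by positivity, by linarith⟩
  let F : ℕ → Euc d → ℝ := fun k x => Real.smoothTransition (k * g x) * bp k x
  have hFs : ∀ k, ContDiff ℝ ∞ (F k) := fun k =>
    (Real.smoothTransition.contDiff.comp (contDiff_const.mul hgs)).mul (bp k).contDiff
  have hFc : ∀ k, HasCompactSupport (F k) := fun k => (bp k).hasCompactSupport.mul_left
  have hFb : ∀ k x, ‖F k x‖ ≤ 1 := fun k x => by
    have h1 := Real.smoothTransition.nonneg (k * g x)
    have h2 := Real.smoothTransition.le_one (k * g x)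
    have h3 : 0 ≤ bp k x := (bp k).nonneg
    have h4 : bp k x ≤ 1 := (bp k).le_one
    rw [Real.norm_of_nonneg (mul_nonneg h1 h3)]
    exact mul_le_one₀ h2 h3 h4
  have hlim : ∀ x, Tendsto (fun k => F k x) atTop (𝓝 (O.indicator (fun _ => (1:ℝ)) x)) := by
    intro x
    by_cases hx : x ∈ O
    · rw [indicator_of_mem hx]
      have hgx : 0 < g x := lt_of_le_of_ne (hgr ⟨x, rfl⟩).1 (by
        have : x ∈ Function.support g := hg ▸ hx
        exact fun hh => this hh.symm)
      obtain ⟨k1, hk1⟩ := exists_nat_ge (1 / g x)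
      obtain ⟨k2, hk2⟩ := exists_nat_ge ‖x‖
      refine tendsto_const_nhds.congr' ?_
      filter_upwards [eventually_ge_atTop (max k1 k2)] with k hk
      have e1 : (k1 : ℝ) ≤ k := by exact_mod_cast (le_max_left _ _).trans hk
      have e2 : (k2 : ℝ) ≤ k := by exact_mod_cast (le_max_right _ _).trans hk
      have h1 : Real.smoothTransition (k * g x) = 1 := Real.smoothTransition.one_of_one_le (by
        have := hk1.trans e1
        rwa [div_le_iff₀ hgx] at this)
      have h2 : bp k x = 1 := (bp k).one_of_mem_closedBall (by
        rw [mem_closedBall_zero_iff]; show ‖x‖ ≤ (k : ℝ) + 1; linarith)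
      simp only [F, h1, h2, one_mul]
    · rw [indicator_of_notMem hx]
      have hgx : g x = 0 := by
        by_contra hh; exact hx (hg ▸ (hh : x ∈ Function.support g))
      simp [F, hgx]
  have hm : ∀ (m : Measure (Euc d)) [IsProbabilityMeasure m], Tendsto (fun k => ∫ x, F k x ∂m) atTop (𝓝 (m.real O)) := by
    intro m _
    have := tendsto_integral_of_dominated_convergence (μ := m) (F := F) (f := O.indicator (fun _ => (1:ℝ))) (fun _ => 1)
      (fun k => (hFs k).continuous.aestronglyMeasurable) (integrable_const _) (fun k => ae_of_all _ (hFb k)) (ae_of_all _ hlim)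
    rwa [integral_indicator_const _ hO.measurableSet, smul_eq_mul, mul_one] at this
  have he := tendsto_nhds_unique (hm m) ((hm n).congr fun k => (h _ (hFs k) (hFc k)).symm)
  exact (measureReal_eq_measureReal_iff).1 he

lemma int_close {m : Measure (Euc d)} [IsProbabilityMeasure m] {u : Euc d → ℝ} (hu : Continuous u) {F δ ε R : ℝ}
    (hF : ∀ x, |u x| ≤ F) (hR : 0 < R) (hδ : ∀ x, ‖x‖ < R → |u x - u 0| ≤ δ) (hε : 1 - ε < (m (Metric.ball (0 : Euc d) R)).toReal) :
    |∫ x, u x ∂m - u 0| ≤ δ + 2 * F * ε := by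
  set S := Metric.ball (0 : Euc d) R with hS
  have hSm : MeasurableSet S := Metric.isOpen_ball.measurableSet
  have hF0 : 0 ≤ F := (abs_nonneg _).trans (hF 0)
  have hi : Integrable u m := Integrable.of_bound hu.aestronglyMeasurable F (ae_of_all _ hF)
  have hδ0 : 0 ≤ δ := (abs_nonneg _).trans (hδ 0 (by simpa using hR))
  have e1 : ∫ x, u x ∂m - u 0 = ∫ x, (u x - u 0) ∂m := by
    rw [integral_sub hi (integrable_const _)]; simp
  have hi2 : Integrable (fun x => u x - u 0) m := hi.sub (integrable_const _)
  have e2 : ∫ x, (δ + Sᶜ.indicator (fun _ => 2 * F) x) ∂m = δ + m.real Sᶜ * (2 * F) := by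
    have q1 : Integrable (Sᶜ.indicator (fun _ => 2 * F)) m := (integrable_const (2 * F)).indicator hSm.compl
    have q2 : ∫ x, Sᶜ.indicator (fun _ => 2 * F) x ∂m = m.real Sᶜ * (2 * F) := integral_indicator_const _ hSm.compl
    have q3 : Integrable (fun _ : Euc d => δ) m := integrable_const δ
    rw [integral_add q3 q1, q2]
    simp
  rw [e1]
  have e3 : |∫ x, (u x - u 0) ∂m| ≤ ∫ x, (δ + Sᶜ.indicator (fun _ => 2 * F) x) ∂m := by
    have q1 : Integrable (Sᶜ.indicator (fun _ => 2 * F)) m := (integrable_const (2 * F)).indicator hSm.compl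
    have q3 : Integrable (fun _ : Euc d => δ) m := integrable_const δ
    rw [← Real.norm_eq_abs]
    refine norm_integral_le_of_norm_le (f := fun x => u x - u 0) (q3.add q1) (ae_of_all _ fun x => ?_)
    by_cases hx : x ∈ S
    · rw [indicator_of_notMem (by simpa using hx), add_zero]
      exact hδ x (by simpa [hS] using hx)
    · rw [indicator_of_mem (by simpa using hx)]
      have h1 : |u x - u 0| ≤ |u x| + |u 0| := abs_sub _ _
      have := hF x
      have := hF 0
      show |u x - u 0| ≤ _
      linarith
  rw [e2] at e3
  have e4 : m.real Sᶜ ≤ ε := by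
    rw [probReal_compl_eq_one_sub hSm]
    have : 1 - ε < m.real S := hε
    linarith
  nlinarith

lemma main_uniq
    (I : Set ℝ)
    (hI : ∀ ⦃t t' : ℝ⦄, t ∈ I → t ≤ t' → t' ∈ I)
    (Q : ℝ → Euc d → Fin d → Fin d → ℝ) (b : ℝ → Euc d → Fin d → ℝ)
    (α : ℝ) (hα : α ∈ Ioo (0:ℝ) 1)
    (hQhold : ∀ i j, LocHolderParab d α I (fun t x => Q t x i j))
    (hbhold : ∀ j, LocHolderParab d α I (fun t x => b t x j))
    (hsymm : ∀ t ∈ I, ∀ x : Euc d, ∀ i j, Q t x i j = Q t x j i)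
    (ν₀ : ℝ) (hν₀ : 0 < ν₀) (hell : ∀ t ∈ I, ∀ x : Euc d, ν₀ ≤ minEig d (Q t x))
    (hLyap : ∃ φ : Euc d → ℝ, ContDiff ℝ 2 φ ∧ (∀ x, 0 < φ x) ∧
      (∀ M : ℝ, ∃ R : ℝ, ∀ x : Euc d, R ≤ ‖x‖ → M ≤ φ x) ∧
      (∀ a b' : ℝ, Icc a b' ⊆ I → ∃ lam > 0, ∀ t ∈ Icc a b', ∀ x : Euc d,
        Aop d Q b (fun _ _ => 0) t φ x ≤ lam * φ x))
    (σinf : ℝ) (hσ : σinf < 0)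
    (hgrad : NegUniformGradEst d I Q b σinf)
    (μ ν : ℝ → Measure (Euc d))
    (hμ : IsTightEvolutionSystem d I Q b μ)
    (hν : IsTightEvolutionSystem d I Q b ν) :
    ∀ t ∈ I, μ t = ν t := by
  intro s hs
  haveI := hμ.prob s hs
  haveI := hν.prob s hs
  refine meas_ext fun f hf hfc => ?_
  obtain ⟨F, hF⟩ := hfc.exists_bound_of_continuous hf.continuous
  obtain ⟨G, hG⟩ := (hfc.fderiv (𝕜 := ℝ)).exists_bound_of_continuous (hf.continuous_fderiv (by simp))
  have hF0 : 0 ≤ F := (norm_nonneg _).trans (hF 0)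
  have hG0 : 0 ≤ G := (norm_nonneg _).trans (hG 0)
  obtain ⟨u, hu, hub, huF⟩ := exists_classical hI Q b α hα hQhold hbhold hsymm ν₀ hν₀ hell hLyap hs hf hfc hF
  have key : ∀ ε > 0, |∫ x, f x ∂μ s - ∫ x, f x ∂ν s| ≤ 2 * (2 * F * ε) := by
    intro ε hε
    obtain ⟨R1, hR1, h1⟩ := hμ.tight ε hε
    obtain ⟨R2, hR2, h2⟩ := hν.tight ε hε
    set R := max R1 R2
    have hest : ∀ t, s < t → |∫ x, f x ∂μ s - ∫ x, f x ∂ν s| ≤ 2 * (Real.exp (σinf * (t - s)) * (F + G) * R + 2 * F * ε) := by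
      intro t ht
      have htI := hI hs ht.le
      haveI := hμ.prob t htI
      haveI := hν.prob t htI
      rw [← hμ.invariant s hs t htI ht f hf.continuous ⟨F, hF⟩ u hu hub, ← hν.invariant s hs t htI ht f hf.continuous ⟨F, hF⟩ u hu hub]
      have hc : Continuous (u t) := (hu.xdiff t ht).continuous
      have hL : ∀ x, ‖x‖ < R → |u t x - u t 0| ≤ Real.exp (σinf * (t - s)) * (F + G) * R := by
        intro x hx
        have := Convex.norm_image_sub_le_of_norm_fderiv_le (𝕜 := ℝ) (f := u t) (s := univ) (x := 0) (y := x)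
          (fun y _ => (hu.xdiff t ht).differentiable (by simp) y)
          (fun y _ => hgrad s hs f (hf.of_le (by exact_mod_cast le_top)) F G hF hG u hu hub t ht y) convex_univ (mem_univ _) (mem_univ _)
        rw [sub_zero] at this
        exact this.trans (mul_le_mul_of_nonneg_left hx.le (by positivity))
      have hb : ∀ (m : Measure (Euc d)) [IsProbabilityMeasure m] (r : ℝ), r ≤ R → 1 - ε < (m (Metric.ball 0 r)).toReal →
          1 - ε < (m (Metric.ball 0 R)).toReal := fun m _ r hr h =>
        h.trans_le (ENNReal.toReal_mono (measure_ne_top _ _) (measure_mono (Metric.ball_subset_ball hr)))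
      have a1 := int_close hc (huF t) (lt_max_of_lt_left hR1) hL (hb (μ t) R1 (le_max_left _ _) (h1 t htI))
      have a2 := int_close hc (huF t) (lt_max_of_lt_left hR1) hL (hb (ν t) R2 (le_max_right _ _) (h2 t htI))
      rw [abs_le] at a1 a2 ⊢
      constructor <;> linarith [a1.1, a1.2, a2.1, a2.2]
    have hlim : Tendsto (fun t => 2 * (Real.exp (σinf * (t - s)) * (F + G) * R + 2 * F * ε)) atTop (𝓝 (2 * (0 * (F + G) * R + 2 * F * ε))) := by
      have : Tendsto (fun t => Real.exp (σinf * (t - s))) atTop (𝓝 0) :=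
        Real.tendsto_exp_atBot.comp ((tendsto_atTop_add_const_right atTop (-s) tendsto_id).const_mul_atTop_of_neg hσ)
      exact (((this.mul_const _).mul_const _).add_const _).const_mul _
    have := ge_of_tendsto hlim ((eventually_gt_atTop s).mono fun t ht => hest t ht)
    linarith
  have h0 : |∫ x, f x ∂μ s - ∫ x, f x ∂ν s| ≤ 0 := by
    refine le_of_forall_pos_le_add fun ε hε => ?_
    have := key (ε / (4 * (F + 1))) (by positivity)
    refine this.trans ?_
    rw [zero_add]
    have h4 : 2 * (2 * F * (ε / (4 * (F + 1)))) = ε * (F / (F + 1)) := by field_simp; ring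
    rw [h4]
    exact mul_le_of_le_one_right hε.le ((div_le_one (by positivity)).2 (by linarith))
  exact sub_eq_zero.1 (abs_nonpos_iff.1 h0)

end fin2

end devel

/-- under the negative uniform gradient estimate, there is at most one tight
evolution system of measures. -/
theorem uniqueness_of_tight_evolution_system
    (d : ℕ) (hd : 1 ≤ d) (I : Set ℝ)
    (hI : ∀ ⦃t t' : ℝ⦄, t ∈ I → t ≤ t' → t' ∈ I)
    (Q : ℝ → Euc d → Fin d → Fin d → ℝ) (b : ℝ → Euc d → Fin d → ℝ)
    (α : ℝ) (hα : α ∈ Ioo (0:ℝ) 1)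
    (hQhold : ∀ i j, LocHolderParab d α I (fun t x => Q t x i j))
    (hbhold : ∀ j, LocHolderParab d α I (fun t x => b t x j))
    (hsymm : ∀ t ∈ I, ∀ x : Euc d, ∀ i j, Q t x i j = Q t x j i)
    (ν₀ : ℝ) (hν₀ : 0 < ν₀) (hell : ∀ t ∈ I, ∀ x : Euc d, ν₀ ≤ minEig d (Q t x))
    (hLyap : ∃ φ : Euc d → ℝ, ContDiff ℝ 2 φ ∧ (∀ x, 0 < φ x) ∧
      (∀ M : ℝ, ∃ R : ℝ, ∀ x : Euc d, R ≤ ‖x‖ → M ≤ φ x) ∧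
      (∀ a b' : ℝ, Icc a b' ⊆ I → ∃ lam > 0, ∀ t ∈ Icc a b', ∀ x : Euc d,
        Aop d Q b (fun _ _ => 0) t φ x ≤ lam * φ x))
    (σinf : ℝ) (hσ : σinf < 0)
    (hgrad : NegUniformGradEst d I Q b σinf)
    (μ ν : ℝ → Measure (Euc d))
    (hμ : IsTightEvolutionSystem d I Q b μ)
    (hν : IsTightEvolutionSystem d I Q b ν) :
    ∀ t ∈ I, μ t = ν t := by
  exact main_uniq I hI Q b α hα hQhold hbhold hsymm ν₀ hν₀ hell hLyap σinf hσ hgrad μ ν hμ hν
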